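/- Let N ≥ 2, 0 < R₀ < R₁, p ∈ (1,∞) and s ∈ (0, R₁ − R₀). Let u be a first eigenfunction of the p-Laplacian on Ω_s, and suppose the function t ↦ λ₁(p, Ω_t) is differentiable at s with derivative 0. Define r₀ := inf{ ‖x − s e₁‖ : x ∈ Ω_s, ⟨∇u(x), x − s e₁⟩ = 0 } and r₁ := sup{ ‖x‖ : x ∈ Ω_s, ⟨∇u(x), x⟩ = 0 }. Then r₀ = r₁. -/

import Mathlib

open MeasureTheory Metric Set Filter
open scoped RealInnerProductSpace ENNReal Topology

/-- The first Dirichlet eigenvalue of the p-Laplacian on `Ω`, defined variationally as the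
infimum of Rayleigh quotients of smooth, not identically zero functions with compact
support contained in `Ω`. -/
noncomputable def lam1 {N : ℕ} (p : ℝ) (Ω : Set (EuclideanSpace ℝ (Fin N))) : ℝ :=
  sInf { r : ℝ | ∃ u : EuclideanSpace ℝ (Fin N) → ℝ,
    ContDiff ℝ (⊤ : ℕ∞) u ∧ u ≠ 0 ∧ HasCompactSupport u ∧ tsupport u ⊆ Ω ∧
    r = (∫ x in Ω, ‖gradient u x‖ ^ p) / (∫ x in Ω, |u x| ^ p) }

/-- The first standard basis vector `e₁` of `ℝ^N`. -/
noncomputable def e1 (N : ℕ) : EuclideanSpace ℝ (Fin N) :=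
  (WithLp.equiv 2 (Fin N → ℝ)).symm (fun i => if (i : ℕ) = 0 then 1 else 0)

/-- The eccentric annulus `Ω_s = B_{R₁}(0) \ closure (B_{R₀}(s e₁))`. -/
noncomputable def Om (N : ℕ) (R₀ R₁ s : ℝ) : Set (EuclideanSpace ℝ (Fin N)) :=
  ball 0 R₁ \ closure (ball (s • e1 N) R₀)

/-- `u` is a first eigenfunction of the p-Laplacian on `Ω` with eigenvalue `lam`:
C¹ on an open set containing the closure of `Ω`, positive in `Ω`, zero on `∂Ω`, and a weak
solution of `−Δ_p u = lam · u^{p−1}`. -/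
def IsFirstEigenfunction {N : ℕ} (p : ℝ) (Ω : Set (EuclideanSpace ℝ (Fin N)))
    (lam : ℝ) (u : EuclideanSpace ℝ (Fin N) → ℝ) : Prop :=
  (∃ V : Set (EuclideanSpace ℝ (Fin N)), IsOpen V ∧ closure Ω ⊆ V ∧ ContDiffOn ℝ 1 u V) ∧
  (∀ x ∈ Ω, 0 < u x) ∧
  (∀ x ∈ frontier Ω, u x = 0) ∧
  (∀ φ : EuclideanSpace ℝ (Fin N) → ℝ, ContDiff ℝ (⊤ : ℕ∞) φ → HasCompactSupport φ →
    tsupport φ ⊆ Ω →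
    ∫ x in Ω, ‖gradient u x‖ ^ (p - 2) * ⟪gradient u x, gradient φ x⟫ =
      lam * ∫ x in Ω, (u x) ^ (p - 1) * φ x)

abbrev EE (N : ℕ) := EuclideanSpace ℝ (Fin N)

/-- The p-Laplace flux. -/
noncomputable def Afl {N : ℕ} (p : ℝ) (ξ : EE N) : EE N := ‖ξ‖ ^ (p - 2) • ξ

lemma norm_Afl {N : ℕ} {p : ℝ} (hp : 1 < p) (ξ : EE N) : ‖Afl p ξ‖ = ‖ξ‖ ^ (p - 1) := by
  unfold Afl
  rw [norm_smul, Real.norm_of_nonneg (by positivity)]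
  rcases eq_or_ne ξ 0 with rfl | h
  · simp [Real.zero_rpow (by linarith : p - 1 ≠ 0)]
  · have : 0 < ‖ξ‖ := norm_pos_iff.2 h
    rw [← Real.rpow_add_one this.ne']; congr 1; ring

lemma Afl_zero {N : ℕ} (p : ℝ) : Afl p (0 : EE N) = 0 := by simp [Afl]

lemma inner_Afl_self {N : ℕ} {p : ℝ} (hp : 1 < p) (ξ : EE N) : ⟪Afl p ξ, ξ⟫ = ‖ξ‖ ^ p := by
  unfold Afl
  rw [real_inner_smul_left, real_inner_self_eq_norm_sq]
  rcases eq_or_ne ξ 0 with rfl | h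
  · simp [Real.zero_rpow (by linarith : p ≠ 0)]
  · have : 0 < ‖ξ‖ := norm_pos_iff.2 h
    rw [← Real.rpow_natCast, ← Real.rpow_add this]; congr 1; push_cast; ring

lemma Afl_smul {N : ℕ} {p : ℝ} {t : ℝ} (ht : 0 < t) (ξ : EE N) :
    Afl p (t • ξ) = t ^ (p - 1) • Afl p ξ := by
  unfold Afl
  rw [norm_smul, Real.norm_of_nonneg ht.le, Real.mul_rpow ht.le (norm_nonneg _), smul_smul, smul_smul]
  congr 1
  have : t ^ (p - 1) = t ^ (p - 2) * t := by
    rw [← Real.rpow_add_one ht.ne']; congr 1; ring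
  rw [this]; ring

lemma continuous_Afl {N : ℕ} {p : ℝ} (hp : 1 < p) : Continuous (Afl (N := N) p) := by
  rw [continuous_iff_continuousAt]
  intro ξ
  rcases eq_or_ne ξ 0 with rfl | h
  · unfold ContinuousAt
    rw [Afl_zero, tendsto_zero_iff_norm_tendsto_zero]
    simp_rw [norm_Afl hp]
    have : Continuous fun ξ : EE N => ‖ξ‖ ^ (p - 1) :=
      continuous_norm.rpow_const (fun _ => Or.inr (by linarith))
    have h2 := this.tendsto 0
    simpa [Real.zero_rpow (by linarith : p - 1 ≠ 0)] using h2
  · unfold Afl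
    exact (ContinuousAt.rpow_const continuous_norm.continuousAt
      (Or.inl (norm_ne_zero_iff.2 h))).smul continuousAt_id

/-- strict convexity, scalar version -/
lemma young_scalar {p a b : ℝ} (hp : 1 < p) (ha : 0 ≤ a) (hb : 0 ≤ b) :
    p * (b ^ (p - 1) * a) ≤ a ^ p + (p - 1) * b ^ p ∧
    (p * (b ^ (p - 1) * a) = a ^ p + (p - 1) * b ^ p → a = b) := by
  rcases hb.eq_or_lt with rfl | hb
  · rw [Real.zero_rpow (by linarith : p - 1 ≠ 0), Real.zero_rpow (by linarith : p ≠ 0)]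
    refine ⟨by simp; positivity, fun h => ?_⟩
    simp at h
    rcases ha.eq_or_lt with h1 | h1
    · exact h1.symm
    · have := Real.rpow_pos_of_pos h1 p; linarith
  · obtain ⟨s, rfl⟩ : ∃ s, a = b * (1 + s) := ⟨a / b - 1, by field_simp; ring⟩
    have hs : 0 ≤ 1 + s := by
      by_contra h; push Not at h; nlinarith
    have hbp : b ^ p = b ^ (p - 1) * b := by
      rw [← Real.rpow_add_one hb.ne']; congr 1; ring
    have hpos := Real.rpow_pos_of_pos hb p
    have e1 : p * (b ^ (p - 1) * (b * (1 + s))) = b ^ p * (p * (1 + s)) := by rw [hbp]; ring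
    rw [e1, Real.mul_rpow hb.le hs]
    rcases eq_or_ne s 0 with rfl | hne
    · simp; ring_nf; exact le_refl _
    · have := one_add_mul_self_lt_rpow_one_add (by linarith : -1 ≤ s) hne hp
      constructor
      · nlinarith
      · intro h; exfalso; nlinarith

lemma picone_basic {N : ℕ} {p : ℝ} (hp : 1 < p) (α β : EE N) :
    p * ⟪Afl p β, α⟫ ≤ ‖α‖ ^ p + (p - 1) * ‖β‖ ^ p ∧
    (p * ⟪Afl p β, α⟫ = ‖α‖ ^ p + (p - 1) * ‖β‖ ^ p → α = β) := by
  have h1 : ⟪Afl p β, α⟫ ≤ ‖β‖ ^ (p - 1) * ‖α‖ := by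
    rw [← norm_Afl hp]; exact real_inner_le_norm _ _
  have h2 := young_scalar hp (norm_nonneg α) (norm_nonneg β)
  refine ⟨by nlinarith [h2.1], fun h => ?_⟩
  have h3 : p * (‖β‖ ^ (p - 1) * ‖α‖) = ‖α‖ ^ p + (p - 1) * ‖β‖ ^ p := by
    apply le_antisymm h2.1; rw [← h]; nlinarith
  have h4 := h2.2 h3
  have h5 : ⟪Afl p β, α⟫ = ‖β‖ ^ (p - 1) * ‖α‖ := by
    have : p * ⟪Afl p β, α⟫ = p * (‖β‖ ^ (p - 1) * ‖α‖) := by rw [h, h3]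
    exact mul_left_cancel₀ (by linarith) this
  rcases eq_or_ne β 0 with rfl | hβ
  · simpa using h4
  have hb : 0 < ‖β‖ := norm_pos_iff.2 hβ
  unfold Afl at h5
  rw [real_inner_smul_left, h4] at h5
  have e : ‖β‖ ^ (p - 1) = ‖β‖ ^ (p - 2) * ‖β‖ := by
    rw [← Real.rpow_add_one hb.ne']; congr 1; ring
  rw [e, mul_assoc] at h5
  have h6 : ⟪β, α⟫ = ‖β‖ * ‖β‖ := mul_left_cancel₀ (Real.rpow_pos_of_pos hb _).ne' h5
  have h7 : ‖α - β‖ ^ 2 = 0 := by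
    rw [norm_sub_sq_real, real_inner_comm, h6, h4]; ring
  have h8 : ‖α - β‖ = 0 := by simpa using h7
  exact sub_eq_zero.1 (norm_eq_zero.1 h8)

/-- local ellipticity away from zero -/
lemma Afl_elliptic {N : ℕ} {p : ℝ} (hp : 1 < p) (ξ₀ : EE N) (h0 : ξ₀ ≠ 0) :
    ∃ ρ > 0, ∃ c > 0, ∃ C > 0, ∀ ξ ∈ ball ξ₀ ρ, ∀ ζ ∈ ball ξ₀ ρ,
      c * ‖ξ - ζ‖ ^ (2 : ℝ) ≤ ⟪Afl p ξ - Afl p ζ, ξ - ζ⟫ ∧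
      ‖Afl p ξ - Afl p ζ‖ ≤ C * ‖ξ - ζ‖ ^ ((2 : ℝ) - 1) := by
  have hn : 0 < ‖ξ₀‖ := norm_pos_iff.2 h0
  -- derivative
  set g : EE N → ℝ := fun ξ => (‖ξ‖ ^ 2) ^ ((p - 2) / 2) with hg
  have hgA : ∀ ξ : EE N, Afl p ξ = g ξ • ξ := by
    intro ξ
    simp only [hg, Afl]
    congr 1
    rw [← Real.rpow_natCast, ← Real.rpow_mul (norm_nonneg _)]; congr 1; push_cast; ring
  have hgd : HasStrictFDerivAt g
      (((p - 2) / 2 * (‖ξ₀‖ ^ 2) ^ ((p - 2) / 2 - 1)) • ((2 : ℝ) • innerSL ℝ ξ₀)) ξ₀ := by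
    have h1 : HasStrictFDerivAt (fun ξ : EE N => ‖ξ‖ ^ 2) ((2 : ℝ) • innerSL ℝ ξ₀) ξ₀ := by
      have e : ((2 : ℝ) • innerSL ℝ ξ₀) = (2 : ℕ) • innerSL ℝ ξ₀ := by rw [two_smul, two_nsmul]
      rw [e]; exact hasStrictFDerivAt_norm_sq ξ₀
    have h2 := (Real.hasStrictDerivAt_rpow_const (x := ‖ξ₀‖ ^ 2) (p := (p - 2) / 2)
      (Or.inl (by positivity)))
    exact h2.comp_hasStrictFDerivAt ξ₀ h1
  have hA := hgd.smul (hasStrictFDerivAt_id (𝕜 := ℝ) ξ₀)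
  set Lm := g ξ₀ • ContinuousLinearMap.id ℝ (EE N) +
    (((p - 2) / 2 * (‖ξ₀‖ ^ 2) ^ ((p - 2) / 2 - 1)) • ((2 : ℝ) • innerSL ℝ ξ₀)).smulRight (id ξ₀)
    with hL
  set m : ℝ := min 1 (p - 1) * ‖ξ₀‖ ^ (p - 2) with hm
  have hmpos : 0 < m := by
    have : 0 < min 1 (p - 1) := lt_min one_pos (by linarith)
    positivity
  have hgx : g ξ₀ = ‖ξ₀‖ ^ (p - 2) := by
    simp only [hg]
    rw [← Real.rpow_natCast, ← Real.rpow_mul (norm_nonneg _)]; congr 1; push_cast; ring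
  have hco : (‖ξ₀‖ ^ 2) ^ ((p - 2) / 2 - 1) = ‖ξ₀‖ ^ (p - 2) / ‖ξ₀‖ ^ 2 := by
    rw [Real.rpow_sub_one (by positivity)]; congr 1
  have hLpos : ∀ v, m * ‖v‖ ^ 2 ≤ ⟪Lm v, v⟫ := by
    intro v
    have e : ⟪Lm v, v⟫ = ‖ξ₀‖ ^ (p - 2) * (‖v‖ ^ 2 + (p - 2) * (⟪ξ₀, v⟫ ^ 2 / ‖ξ₀‖ ^ 2)) := by
      simp only [hL, add_apply, smul_apply,
        ContinuousLinearMap.id_apply, ContinuousLinearMap.smulRight_apply, innerSL_apply_apply, id,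
        inner_add_left, real_inner_smul_left, real_inner_self_eq_norm_sq, hgx, hco, smul_eq_mul]
      ring
    rw [e, hm]
    have hcs : ⟪ξ₀, v⟫ ^ 2 / ‖ξ₀‖ ^ 2 ≤ ‖v‖ ^ 2 := by
      rw [div_le_iff₀ (by positivity)]
      have := abs_real_inner_le_norm ξ₀ v
      have h2 := sq_le_sq' (by have := neg_abs_le ⟪ξ₀, v⟫; linarith) ((le_abs_self _).trans this)
      nlinarith
    have hnn : 0 ≤ ⟪ξ₀, v⟫ ^ 2 / ‖ξ₀‖ ^ 2 := by positivity
    set w := ⟪ξ₀, v⟫ ^ 2 / ‖ξ₀‖ ^ 2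
    have key : min 1 (p - 1) * ‖v‖ ^ 2 ≤ ‖v‖ ^ 2 + (p - 2) * w := by
      rcases le_total p 2 with h | h
      · rw [min_eq_right (by linarith)]; nlinarith
      · rw [min_eq_left (by linarith)]; nlinarith
    have : 0 < ‖ξ₀‖ ^ (p - 2) := Real.rpow_pos_of_pos hn _
    nlinarith
  have hlo := (hasStrictFDerivAt_iff_isLittleO.1 hA)
  have hev := hlo.def (by positivity : 0 < m / 2)
  rw [nhds_prod_eq] at hev
  obtain ⟨s, hs, hs2⟩ := Filter.mem_prod_self_iff.1 hev
  obtain ⟨ρ, hρ, hρs⟩ := Metric.mem_nhds_iff.1 hs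
  refine ⟨ρ, hρ, m / 2, by positivity, ‖Lm‖ + m / 2, by positivity, fun ξ hξ ζ hζ => ?_⟩
  have hb := hs2 (Set.mk_mem_prod (hρs hξ) (hρs hζ))
  simp only [Set.mem_ofPred_eq, Pi.smul_apply', id] at hb
  rw [← hgA, ← hgA] at hb
  set r := Afl p ξ - Afl p ζ - Lm (ξ - ζ) with hr
  have hb' : ‖r‖ ≤ m / 2 * ‖ξ - ζ‖ := hb
  have er : Afl p ξ - Afl p ζ = Lm (ξ - ζ) + r := by rw [hr]; abel
  rw [er]
  rw [show ((2:ℝ) - 1) = 1 by norm_num, Real.rpow_one, Real.rpow_two]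
  constructor
  · rw [inner_add_left]
    have h1 := hLpos (ξ - ζ)
    have h2 := abs_real_inner_le_norm r (ξ - ζ)
    have h3 := neg_abs_le ⟪r, ξ - ζ⟫
    nlinarith [norm_nonneg (ξ - ζ)]
  · calc ‖Lm (ξ - ζ) + r‖ ≤ ‖Lm (ξ - ζ)‖ + ‖r‖ := norm_add_le _ _
      _ ≤ ‖Lm‖ * ‖ξ - ζ‖ + m / 2 * ‖ξ - ζ‖ := add_le_add (Lm.le_opNorm _) hb'
      _ = _ := by ring


/-! ### gradient calculus -/

lemma hg_iff {N : ℕ} {f : EE N → ℝ} {g x : EE N} :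
    HasGradientAt f g x ↔ HasFDerivAt f (innerSL ℝ g) x := by
  rw [hasGradientAt_iff_hasFDerivAt]; rfl

lemma hg_mul {N : ℕ} {f g : EE N → ℝ} {a b x : EE N} (hf : HasGradientAt f a x)
    (hg : HasGradientAt g b x) :
    HasGradientAt (fun y => f y * g y) (f x • b + g x • a) x := by
  rw [hg_iff] at *
  rw [map_add, map_smul, map_smul]
  exact hf.mul hg

lemma hg_add {N : ℕ} {f g : EE N → ℝ} {a b x : EE N} (hf : HasGradientAt f a x)
    (hg : HasGradientAt g b x) : HasGradientAt (fun y => f y + g y) (a + b) x := by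
  rw [hg_iff] at *
  rw [map_add]
  exact hf.add hg

lemma hg_sub {N : ℕ} {f g : EE N → ℝ} {a b x : EE N} (hf : HasGradientAt f a x)
    (hg : HasGradientAt g b x) : HasGradientAt (fun y => f y - g y) (a - b) x := by
  rw [hg_iff] at *
  rw [map_sub]
  exact hf.sub hg

lemma hg_add_const {N : ℕ} {f : EE N → ℝ} {a x : EE N} (hf : HasGradientAt f a x) (c : ℝ) :
    HasGradientAt (fun y => f y + c) a x := by
  rw [hg_iff] at *
  exact hf.add_const c

lemma hg_comp {N : ℕ} {f : EE N → ℝ} {a x : EE N} {h : ℝ → ℝ} {h' : ℝ}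
    (hh : HasDerivAt h h' (f x)) (hf : HasGradientAt f a x) :
    HasGradientAt (fun y => h (f y)) (h' • a) x := by
  rw [hg_iff] at *
  rw [map_smul]
  exact hh.comp_hasFDerivAt x hf

lemma hg_normsq {N : ℕ} (c x : EE N) :
    HasGradientAt (fun y => ‖y - c‖ ^ 2) ((2 : ℝ) • (x - c)) x := by
  rw [hg_iff]
  have h1 : HasFDerivAt (fun y : EE N => y - c) (ContinuousLinearMap.id ℝ (EE N)) x :=
    (hasFDerivAt_id x).sub_const c
  have h2 := h1.norm_sq
  have e : (innerSL ℝ) ((2 : ℝ) • (x - c)) =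
      2 • (innerSL ℝ (x - c)).comp (ContinuousLinearMap.id ℝ (EE N)) := by
    rw [map_smul, two_smul, two_nsmul]; rfl
  rw [e]
  exact h2

lemma hg_inner {N : ℕ} (c v x : EE N) :
    HasGradientAt (fun y => ⟪y - c, v⟫) v x := by
  rw [hg_iff]
  have h1 : HasFDerivAt (fun y : EE N => y - c) (ContinuousLinearMap.id ℝ (EE N)) x :=
    (hasFDerivAt_id x).sub_const c
  have h2 := (innerSL ℝ v).hasFDerivAt.comp x h1
  have e : (fun y => ⟪y - c, v⟫) = (fun y => (innerSL ℝ v) (y - c)) := by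
    ext y; rw [innerSL_apply_apply, real_inner_comm]
  rw [e]; exact h2

lemma gradient_continuous {N : ℕ} {f : EE N → ℝ} (h : ContDiff ℝ 1 f) :
    Continuous (gradient f) := by
  have : Continuous (fderiv ℝ f) := h.continuous_fderiv (by norm_num)
  unfold gradient
  exact (InnerProductSpace.toDual ℝ (EE N)).symm.continuous.comp this

lemma gradient_continuousOn {N : ℕ} {f : EE N → ℝ} {V : Set (EE N)} (hV : IsOpen V)
    (h : ContDiffOn ℝ 1 f V) : ContinuousOn (gradient f) V := by
  have : ContinuousOn (fderiv ℝ f) V := h.continuousOn_fderiv_of_isOpen hV (by norm_num)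
  unfold gradient
  exact (InnerProductSpace.toDual ℝ (EE N)).symm.continuous.comp_continuousOn this

lemma hasGradientAt_of_contDiffOn {N : ℕ} {f : EE N → ℝ} {V : Set (EE N)} (hV : IsOpen V)
    (h : ContDiffOn ℝ 1 f V) {x : EE N} (hx : x ∈ V) : HasGradientAt f (gradient f x) x :=
  ((h.differentiableOn (by norm_num)).differentiableAt (hV.mem_nhds hx)).hasGradientAt

lemma hasGradientAt_of_contDiff {N : ℕ} {f : EE N → ℝ}
    (h : ContDiff ℝ 1 f) (x : EE N) : HasGradientAt f (gradient f x) x :=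
  (h.differentiable (by norm_num) x).hasGradientAt

lemma gradient_eq_zero_off {N : ℕ} {f : EE N → ℝ} {x : EE N} (hx : x ∉ tsupport f) :
    gradient f x = 0 := by
  have : fderiv ℝ f x = 0 := by
    by_contra h
    exact hx (support_fderiv_subset ℝ h)
  simp [gradient, this]

lemma norm_gradient_sub {N : ℕ} (f g : EE N → ℝ) (x : EE N) :
    ‖gradient f x - gradient g x‖ = ‖fderiv ℝ f x - fderiv ℝ g x‖ := by
  unfold gradient
  rw [← map_sub, LinearIsometryEquiv.norm_map]

/-- a function that is C¹ on an open set and vanishes off a compact subset is a test function -/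
lemma test_C1 {N : ℕ} {φ : EE N → ℝ} {Ω K : Set (EE N)} (hΩ : IsOpen Ω) (hK : IsCompact K)
    (hKΩ : K ⊆ Ω) (h1 : ContDiffOn ℝ 1 φ Ω) (h0 : ∀ x, x ∉ K → φ x = 0) :
    ContDiff ℝ 1 φ ∧ HasCompactSupport φ ∧ tsupport φ ⊆ K := by
  have hts : tsupport φ ⊆ K := by
    refine closure_minimal ?_ hK.isClosed
    intro x hx
    by_contra h
    exact hx (h0 x h)
  refine ⟨?_, HasCompactSupport.intro hK h0, hts⟩
  rw [contDiff_iff_contDiffAt]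
  intro x
  by_cases hx : x ∈ Ω
  · exact h1.contDiffAt (hΩ.mem_nhds hx)
  · have : φ =ᶠ[𝓝 x] fun _ => 0 := by
      have : Kᶜ ∈ 𝓝 x := hK.isClosed.isOpen_compl.mem_nhds (fun h => hx (hKΩ h))
      filter_upwards [this] with y hy using h0 y hy
    exact contDiffAt_const.congr_of_eventuallyEq this

/-! ### mollification -/

lemma mollify {N : ℕ} {φ : EE N → ℝ} {Ω : Set (EE N)} (hΩ : IsOpen Ω)
    (h1 : ContDiff ℝ 1 φ) (hc : HasCompactSupport φ) (hs : tsupport φ ⊆ Ω) :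
    ∃ K, IsCompact K ∧ K ⊆ Ω ∧ tsupport φ ⊆ K ∧ ∀ ε > 0, ∃ ψ : EE N → ℝ, ContDiff ℝ (⊤ : ℕ∞) ψ ∧
      HasCompactSupport ψ ∧ tsupport ψ ⊆ K ∧ ∀ x, |ψ x - φ x| ≤ ε ∧
        ‖gradient ψ x - gradient φ x‖ ≤ ε := by
  obtain ⟨r, hr, hrΩ⟩ := IsCompact.exists_cthickening_subset_open hc hΩ hs
  have hKc : IsCompact (cthickening r (tsupport φ)) := IsCompact.cthickening hc
  refine ⟨_, hKc, hrΩ, self_subset_cthickening _, fun ε hε => ?_⟩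
  have hcd : HasCompactSupport (fderiv ℝ φ) := hc.fderiv ℝ
  have cd : Continuous (fderiv ℝ φ) := h1.continuous_fderiv (by norm_num)
  obtain ⟨d1, hd1, H1⟩ := Metric.uniformContinuous_iff.1
    (hc.uniformContinuous_of_continuous h1.continuous) ε hε
  obtain ⟨d2, hd2, H2⟩ := Metric.uniformContinuous_iff.1
    (hcd.uniformContinuous_of_continuous cd) ε hε
  set d := min r (min d1 d2) with hd
  have hdpos : 0 < d := lt_min hr (lt_min hd1 hd2)
  have hdd1 : d ≤ d1 := (min_le_right _ _).trans (min_le_left _ _)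
  have hdd2 : d ≤ d2 := (min_le_right _ _).trans (min_le_right _ _)
  let b : ContDiffBump (0 : EE N) := ⟨d / 2, d, by linarith, by linarith⟩
  set ψ := convolution (b.normed volume) φ (ContinuousLinearMap.lsmul ℝ ℝ) volume with hψ
  have hli : LocallyIntegrable φ volume := h1.continuous.locallyIntegrable
  have hbs : HasCompactSupport (b.normed (volume : Measure (EE N))) := b.hasCompactSupport_normed
  have hsm : ContDiff ℝ (⊤ : ℕ∞) ψ :=
    hbs.contDiff_convolution_left _ b.contDiff_normed hli
  have hsupp : ∀ x, x ∉ cthickening r (tsupport φ) → ψ x = 0 := by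
    intro x hx
    by_contra h
    apply hx
    obtain ⟨a, ha, c, hcc, rfl⟩ := support_convolution_subset _ h
    rw [b.support_normed_eq] at ha
    refine mem_cthickening_of_dist_le (a + c) c r _ (subset_tsupport _ hcc) ?_
    have : ‖a‖ < d := by simpa using ha
    rw [dist_eq_norm]; simp; exact this.le.trans (min_le_left _ _)
  have hts : tsupport ψ ⊆ cthickening r (tsupport φ) := by
    refine closure_minimal ?_ hKc.isClosed
    intro x hx
    by_contra h
    exact hx (hsupp x h)
  refine ⟨ψ, hsm, HasCompactSupport.intro hKc hsupp, hts, fun x => ⟨?_, ?_⟩⟩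
  · rw [← Real.norm_eq_abs, ← dist_eq_norm]
    refine b.dist_normed_convolution_le h1.continuous.aestronglyMeasurable ?_
    intro y hy
    exact (H1 (lt_of_lt_of_le (mem_ball.1 hy) hdd1)).le
  · rw [norm_gradient_sub]
    have hfd : fderiv ℝ ψ x = convolution (b.normed volume) (fderiv ℝ φ)
        (ContinuousLinearMap.lsmul ℝ ℝ) volume x := by
      have := hc.hasFDerivAt_convolution_right (ContinuousLinearMap.lsmul ℝ ℝ)
        (b.continuous_normed.locallyIntegrable : LocallyIntegrable (b.normed volume) volume) h1 x
      rw [this.fderiv]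
      rfl
    rw [hfd, ← dist_eq_norm]
    refine b.dist_normed_convolution_le cd.aestronglyMeasurable ?_
    intro y hy
    exact (H2 (lt_of_lt_of_le (mem_ball.1 hy) hdd2)).le


/-! ### integrals of compactly supported functions -/

lemma integrable_supp {N : ℕ} {E : Type*} [NormedAddCommGroup E] {g : EE N → E}
    {K : Set (EE N)} (hK : IsCompact K)
    (hg : ContinuousOn g K) (h0 : ∀ x, x ∉ K → g x = 0) : Integrable g := by
  have h1 : IntegrableOn g K := hg.integrableOn_compact hK
  refine (integrableOn_iff_integrable_of_support_subset ?_).1 h1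
  intro x hx
  by_contra h
  exact hx (h0 x h)

lemma abs_integral_supp {N : ℕ} {g : EE N → ℝ} {K : Set (EE N)} (hK : IsCompact K) {C : ℝ}
    (hg : ∀ x ∈ K, |g x| ≤ C) (h0 : ∀ x, x ∉ K → g x = 0) :
    |∫ x, g x| ≤ C * (volume K).toReal := by
  rw [← setIntegral_eq_integral_of_forall_compl_eq_zero h0, ← Real.norm_eq_abs]
  exact norm_setIntegral_le_of_norm_le_const hK.measure_lt_top hg

lemma weak_of_smooth {N : ℕ} {Ω : Set (EE N)} (hΩ : IsOpen Ω) {F : EE N → EE N} {f : EE N → ℝ}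
    (hF : ContinuousOn F Ω) (hf : ContinuousOn f Ω)
    (H : ∀ φ : EE N → ℝ, ContDiff ℝ (⊤ : ℕ∞) φ → HasCompactSupport φ → tsupport φ ⊆ Ω →
      ∫ x, ⟪F x, gradient φ x⟫ = ∫ x, f x * φ x)
    (φ : EE N → ℝ) (h1 : ContDiff ℝ 1 φ) (hc : HasCompactSupport φ) (hs : tsupport φ ⊆ Ω) :
    ∫ x, ⟪F x, gradient φ x⟫ = ∫ x, f x * φ x := by
  obtain ⟨K, hK, hKΩ, hφK, hK2⟩ := mollify hΩ h1 hc hs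
  obtain ⟨M1, hM1⟩ := hK.exists_bound_of_continuousOn (hF.mono hKΩ)
  obtain ⟨M2, hM2⟩ := hK.exists_bound_of_continuousOn (hf.mono hKΩ)
  have int1 : ∀ ψ : EE N → ℝ, ContDiff ℝ 1 ψ → tsupport ψ ⊆ K →
      Integrable (fun x => ⟪F x, gradient ψ x⟫) := by
    intro ψ h1 h2
    refine integrable_supp hK ((hF.mono hKΩ).inner (𝕜 := ℝ) (gradient_continuous h1).continuousOn) ?_
    intro x hx
    simp [gradient_eq_zero_off (fun h => hx (h2 h))]
  have int2 : ∀ ψ : EE N → ℝ, ContDiff ℝ 1 ψ → tsupport ψ ⊆ K →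
      Integrable (fun x => f x * ψ x) := by
    intro ψ h1 h2
    refine integrable_supp hK ((hf.mono hKΩ).mul h1.continuous.continuousOn) ?_
    intro x hx
    simp [image_eq_zero_of_notMem_tsupport (fun h => hx (h2 h))]
  have key : ∀ ε > 0, |(∫ x, ⟪F x, gradient φ x⟫) - ∫ x, f x * φ x| ≤
      ((|M1| + |M2|) * (volume K).toReal) * ε := by
    intro ε hε
    obtain ⟨ψ, g1, g2, g3, g4⟩ := hK2 ε hε
    have g1' : ContDiff ℝ 1 ψ := g1.of_le (by exact_mod_cast le_top)
    have e := H ψ g1 g2 (g3.trans hKΩ)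
    have e2 : (∫ x, ⟪F x, gradient φ x⟫) - ∫ x, f x * φ x =
        ∫ x, ((⟪F x, gradient φ x⟫ - ⟪F x, gradient ψ x⟫) - (f x * φ x - f x * ψ x)) := by
      have q := integral_sub ((int1 φ h1 hφK).sub (int1 ψ g1' g3))
        ((int2 φ h1 hφK).sub (int2 ψ g1' g3))
      simp only [Pi.sub_apply] at q
      rw [q, integral_sub (int1 φ h1 hφK) (int1 ψ g1' g3), integral_sub (int2 φ h1 hφK) (int2 ψ g1' g3), e]
      ring
    rw [e2]
    have := abs_integral_supp (C := (|M1| + |M2|) * ε) hK (g := fun x =>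
      ((⟪F x, gradient φ x⟫ - ⟪F x, gradient ψ x⟫) - (f x * φ x - f x * ψ x))) ?_ ?_
    · linarith
    · intro x hx
      rw [← inner_sub_right, ← mul_sub]
      refine (abs_sub _ _).trans ?_
      have a1 : |⟪F x, gradient φ x - gradient ψ x⟫| ≤ |M1| * ε := by
        refine (abs_real_inner_le_norm _ _).trans ?_
        rw [norm_sub_rev]
        exact mul_le_mul ((hM1 x hx).trans (le_abs_self _)) (g4 x).2 (norm_nonneg _) (abs_nonneg _)
      have a2 : |f x * (φ x - ψ x)| ≤ |M2| * ε := by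
        rw [abs_mul, abs_sub_comm (φ x)]
        exact mul_le_mul ((hM2 x hx).trans (le_abs_self _)) (g4 x).1 (abs_nonneg _) (abs_nonneg _)
      linarith
    · intro x hx
      simp [gradient_eq_zero_off (fun h => hx (g3 h)), gradient_eq_zero_off (fun h => hx (hφK h)),
        image_eq_zero_of_notMem_tsupport (fun h => hx (g3 h)),
        image_eq_zero_of_notMem_tsupport (fun h => hx (hφK h))]
  set C := (|M1| + |M2|) * (volume K).toReal with hC
  have hC0 : 0 ≤ C := by positivity
  have : |(∫ x, ⟪F x, gradient φ x⟫) - ∫ x, f x * φ x| ≤ 0 := by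
    refine le_of_forall_pos_le_add fun ε hε => ?_
    have := key (ε / (C + 1)) (by positivity)
    have h3 : C * (ε / (C + 1)) ≤ ε := by
      rw [mul_div_assoc', div_le_iff₀ (by linarith)]; nlinarith
    linarith
  exact sub_eq_zero.1 (abs_eq_zero.1 (le_antisymm this (abs_nonneg _)))

lemma setIntegral_test {N : ℕ} {Ω : Set (EE N)} {g : EE N → ℝ}
    (h0 : ∀ x, x ∉ Ω → g x = 0) : ∫ x in Ω, g x = ∫ x, g x :=
  setIntegral_eq_integral_of_forall_compl_eq_zero h0

lemma lam1_nonneg {N : ℕ} (p : ℝ) (Ω : Set (EE N)) : 0 ≤ lam1 p Ω := by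
  refine Real.sInf_nonneg ?_
  rintro r ⟨u, -, -, -, -, rfl⟩
  refine div_nonneg (integral_nonneg fun x => ?_) (integral_nonneg fun x => ?_)
  · show 0 ≤ ‖gradient u x‖ ^ p
    positivity
  · show 0 ≤ |u x| ^ p
    positivity

lemma lam1_le_smooth {N : ℕ} {p : ℝ} (hp : 1 < p) {Ω : Set (EE N)} (φ : EE N → ℝ)
    (h1 : ContDiff ℝ (⊤ : ℕ∞) φ) (hc : HasCompactSupport φ) (hs : tsupport φ ⊆ Ω) :
    lam1 p Ω * ∫ x, |φ x| ^ p ≤ ∫ x, ‖gradient φ x‖ ^ p := by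
  have hp0 : p ≠ 0 := by linarith
  have n1 : 0 ≤ ∫ x, ‖gradient φ x‖ ^ p := integral_nonneg fun x => by
    show 0 ≤ ‖gradient φ x‖ ^ p
    positivity
  have n2 : 0 ≤ ∫ x, |φ x| ^ p := integral_nonneg fun x => by
    show 0 ≤ |φ x| ^ p
    positivity
  rcases n2.eq_or_lt with h | h
  · rw [← h]; simpa using n1
  have hne : φ ≠ 0 := by
    rintro rfl
    simp [Real.zero_rpow hp0] at h
  have e1 : ∫ x in Ω, ‖gradient φ x‖ ^ p = ∫ x, ‖gradient φ x‖ ^ p := by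
    refine setIntegral_test fun x hx => ?_
    simp [gradient_eq_zero_off (fun h => hx (hs h)), Real.zero_rpow hp0]
  have e2 : ∫ x in Ω, |φ x| ^ p = ∫ x, |φ x| ^ p := by
    refine setIntegral_test fun x hx => ?_
    simp [image_eq_zero_of_notMem_tsupport (fun h => hx (hs h)), Real.zero_rpow hp0]
  have : lam1 p Ω ≤ (∫ x, ‖gradient φ x‖ ^ p) / ∫ x, |φ x| ^ p := by
    refine csInf_le ⟨0, ?_⟩ ⟨φ, h1, hne, hc, hs, by rw [e1, e2]⟩
    rintro r ⟨u, -, -, -, -, rfl⟩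
    refine div_nonneg (integral_nonneg fun x => ?_) (integral_nonneg fun x => ?_)
    · show 0 ≤ ‖gradient u x‖ ^ p
      positivity
    · show 0 ≤ |u x| ^ p
      positivity
  rwa [le_div_iff₀ h] at this

lemma lam1_le_C1 {N : ℕ} {p : ℝ} (hp : 1 < p) {Ω : Set (EE N)} (hΩ : IsOpen Ω) (φ : EE N → ℝ)
    (h1 : ContDiff ℝ 1 φ) (hc : HasCompactSupport φ) (hs : tsupport φ ⊆ Ω) :
    lam1 p Ω * ∫ x, |φ x| ^ p ≤ ∫ x, ‖gradient φ x‖ ^ p := by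
  have hp0 : 0 < p := by linarith
  obtain ⟨K, hK, hKΩ, hφK, hK2⟩ := mollify hΩ h1 hc hs
  choose ψ g1 g2 g3 g4 using fun n : ℕ => hK2 (1 / ((n : ℝ) + 1)) (by positivity)
  have g1' : ∀ n, ContDiff ℝ 1 (ψ n) := fun n => (g1 n).of_le (by exact_mod_cast le_top)
  obtain ⟨M1, hM1⟩ := hK.exists_bound_of_continuousOn h1.continuous.continuousOn
  obtain ⟨M2, hM2⟩ := hK.exists_bound_of_continuousOn (gradient_continuous h1).continuousOn
  have hle1 : ∀ n : ℕ, 1 / ((n : ℝ) + 1) ≤ 1 := fun n => by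
    rw [div_le_one (by positivity)]; linarith [(Nat.cast_nonneg n : (0:ℝ) ≤ n)]
  have ht0 : Tendsto (fun n : ℕ => 1 / ((n : ℝ) + 1)) atTop (𝓝 0) :=
    tendsto_one_div_add_atTop_nhds_zero_nat
  have t1 : Tendsto (fun n => ∫ x, |ψ n x| ^ p) atTop (𝓝 (∫ x, |φ x| ^ p)) := by
    refine tendsto_integral_of_dominated_convergence (K.indicator fun _ => (|M1| + 1) ^ p)
      (fun n => ?_) ?_ (fun n => ?_) ?_
    · exact ((g1' n).continuous.abs.rpow_const (fun _ => Or.inr hp0.le)).aestronglyMeasurable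
    · exact (integrable_indicator_iff hK.measurableSet).2
        (integrableOn_const hK.measure_lt_top.ne)
    · refine ae_of_all _ fun x => ?_
      rw [Real.norm_of_nonneg (by positivity)]
      by_cases hx : x ∈ K
      · rw [indicator_of_mem hx]
        refine Real.rpow_le_rpow (abs_nonneg _) ?_ hp0.le
        have a1 := (g4 n x).1
        have a2 := (hM1 x hx).trans (le_abs_self M1)
        rw [Real.norm_eq_abs] at a2
        have a3 : |ψ n x| ≤ |ψ n x - φ x| + |φ x| := by
          simpa using abs_add_le (ψ n x - φ x) (φ x)
        linarith [hle1 n]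
      · rw [indicator_of_notMem hx, image_eq_zero_of_notMem_tsupport (fun h => hx (g3 n h))]
        simp [Real.zero_rpow hp0.ne']
    · refine ae_of_all _ fun x => ?_
      have : Tendsto (fun n => ψ n x) atTop (𝓝 (φ x)) := by
        rw [tendsto_iff_dist_tendsto_zero]
        exact squeeze_zero (fun _ => dist_nonneg) (fun n => (g4 n x).1) ht0
      exact (this.abs).rpow_const (Or.inr hp0.le)
  have t2 : Tendsto (fun n => ∫ x, ‖gradient (ψ n) x‖ ^ p) atTop (𝓝 (∫ x, ‖gradient φ x‖ ^ p)) := by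
    refine tendsto_integral_of_dominated_convergence (K.indicator fun _ => (|M2| + 1) ^ p)
      (fun n => ?_) ?_ (fun n => ?_) ?_
    · exact ((gradient_continuous (g1' n)).norm.rpow_const
        (fun _ => Or.inr hp0.le)).aestronglyMeasurable
    · exact (integrable_indicator_iff hK.measurableSet).2
        (integrableOn_const hK.measure_lt_top.ne)
    · refine ae_of_all _ fun x => ?_
      rw [Real.norm_of_nonneg (by positivity)]
      by_cases hx : x ∈ K
      · rw [indicator_of_mem hx]
        refine Real.rpow_le_rpow (norm_nonneg _) ?_ hp0.le
        have a1 := (g4 n x).2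
        have a2 := (hM2 x hx).trans (le_abs_self M2)
        have a3 : ‖gradient (ψ n) x‖ ≤ ‖gradient (ψ n) x - gradient φ x‖ + ‖gradient φ x‖ := by
          simpa using norm_add_le (gradient (ψ n) x - gradient φ x) (gradient φ x)
        linarith [hle1 n]
      · rw [indicator_of_notMem hx, gradient_eq_zero_off (fun h => hx (g3 n h))]
        simp [Real.zero_rpow hp0.ne']
    · refine ae_of_all _ fun x => ?_
      have : Tendsto (fun n => gradient (ψ n) x) atTop (𝓝 (gradient φ x)) := by
        rw [tendsto_iff_norm_sub_tendsto_zero]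
        exact squeeze_zero (fun _ => norm_nonneg _) (fun n => (g4 n x).2) ht0
      exact (this.norm).rpow_const (Or.inr hp0.le)
  exact le_of_tendsto_of_tendsto' (t1.const_mul _) t2
    (fun n => lam1_le_smooth hp (ψ n) (g1 n) (g2 n) ((g3 n).trans hKΩ))

/-! ### the solution structure -/

structure USol {N : ℕ} (p lam : ℝ) (Ω : Set (EE N)) (u : EE N → ℝ) : Prop where
  hp : 1 < p
  opn : IsOpen Ω
  cpt : IsCompact (closure Ω)
  lam0 : 0 ≤ lam
  smooth : ∃ V : Set (EE N), IsOpen V ∧ closure Ω ⊆ V ∧ ContDiffOn ℝ 1 u V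
  pos : ∀ x ∈ Ω, 0 < u x
  zer : ∀ x ∈ frontier Ω, u x = 0
  weak : ∀ φ : EE N → ℝ, ContDiff ℝ 1 φ → HasCompactSupport φ → tsupport φ ⊆ Ω →
    ∫ x, ⟪Afl p (gradient u x), gradient φ x⟫ = ∫ x, (lam * u x ^ (p - 1)) * φ x

namespace USol
variable {N : ℕ} {p lam : ℝ} {Ω : Set (EE N)} {u : EE N → ℝ}

lemma cgrad (h : USol p lam Ω u) : ContinuousOn (gradient u) (closure Ω) := by
  obtain ⟨V, h1, h2, h3⟩ := h.smooth
  exact (gradient_continuousOn h1 h3).mono h2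

lemma cont (h : USol p lam Ω u) : ContinuousOn u (closure Ω) := by
  obtain ⟨V, h1, h2, h3⟩ := h.smooth
  exact h3.continuousOn.mono h2

lemma hgrad (h : USol p lam Ω u) {x : EE N} (hx : x ∈ closure Ω) :
    HasGradientAt u (gradient u x) x := by
  obtain ⟨V, h1, h2, h3⟩ := h.smooth
  exact hasGradientAt_of_contDiffOn h1 h3 (h2 hx)

lemma contDiffOn (h : USol p lam Ω u) : ContDiffOn ℝ 1 u Ω := by
  obtain ⟨V, h1, h2, h3⟩ := h.smooth
  exact h3.mono (subset_closure.trans h2)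

lemma nonneg (h : USol p lam Ω u) {x : EE N} (hx : x ∈ closure Ω) : 0 ≤ u x := by
  rw [closure_eq_self_union_frontier] at hx
  rcases hx with hx | hx
  · exact (h.pos x hx).le
  · exact (h.zer x hx).ge

lemma mem_of_pos (h : USol p lam Ω u) {x : EE N} (hx : x ∈ closure Ω) (hu : 0 < u x) : x ∈ Ω := by
  rw [closure_eq_self_union_frontier] at hx
  rcases hx with hx | hx
  · exact hx
  · exact absurd (h.zer x hx) hu.ne'

lemma bound (h : USol p lam Ω u) : ∃ M > 0, ∀ x ∈ closure Ω, ‖gradient u x‖ ≤ M ∧ u x ≤ M := by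
  obtain ⟨M1, hM1⟩ := h.cpt.exists_bound_of_continuousOn h.cgrad
  obtain ⟨M2, hM2⟩ := h.cpt.exists_bound_of_continuousOn h.cont
  refine ⟨max (max M1 M2) 1, by positivity, fun x hx => ⟨?_, ?_⟩⟩
  · exact (hM1 x hx).trans ((le_max_left _ _).trans (le_max_left _ _))
  · exact (le_abs_self _).trans
      ((hM2 x hx).trans ((le_max_right _ _).trans (le_max_left _ _)))

end USol

lemma Om_open (N : ℕ) (R₀ R₁ s : ℝ) : IsOpen (Om N R₀ R₁ s) :=
  isOpen_ball.sdiff isClosed_closure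

lemma isCompact_closure_Om (N : ℕ) (R₀ R₁ s : ℝ) : IsCompact (closure (Om N R₀ R₁ s)) :=
  (isBounded_ball.subset sdiff_subset).isCompact_closure

lemma USol_of {N : ℕ} {p : ℝ} (hp : 1 < p) {Ω : Set (EE N)} (hΩ : IsOpen Ω)
    (hc : IsCompact (closure Ω)) {u : EE N → ℝ}
    (hu : IsFirstEigenfunction p Ω (lam1 p Ω) u) : USol p (lam1 p Ω) Ω u := by
  obtain ⟨⟨V, V1, V2, V3⟩, h2, h3, h4⟩ := hu
  refine ⟨hp, hΩ, hc, lam1_nonneg _ _, ⟨V, V1, V2, V3⟩, h2, h3, ?_⟩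
  have hΩV : Ω ⊆ V := subset_closure.trans V2
  refine weak_of_smooth hΩ ?_ ?_ ?_
  · exact (continuous_Afl hp).comp_continuousOn ((gradient_continuousOn V1 V3).mono hΩV)
  · exact continuousOn_const.mul ((V3.continuousOn.mono hΩV).rpow_const
      (fun _ _ => Or.inr (by linarith)))
  · intro φ g1 g2 g3
    have := h4 φ g1 g2 g3
    rw [setIntegral_test, setIntegral_test, ← integral_const_mul] at this
    · simp only [Afl, real_inner_smul_left, mul_assoc]
      exact this
    · intro x hx
      simp [image_eq_zero_of_notMem_tsupport (fun h => hx (g3 h))]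
    · intro x hx
      simp [gradient_eq_zero_off (fun h => hx (g3 h))]


/-! ### scalar cutoffs -/

lemma hasDerivAt_maxsq (a t : ℝ) :
    HasDerivAt (fun t => (max (t - a) 0) ^ 2) (2 * max (t - a) 0) t := by
  rcases lt_trichotomy t a with h | h | h
  · have : (fun t => (max (t - a) 0) ^ 2) =ᶠ[𝓝 t] fun _ => 0 := by
      filter_upwards [Iio_mem_nhds h] with y hy
      rw [max_eq_right (by simp only [mem_Iio] at hy; linarith)]; norm_num
    rw [max_eq_right (by linarith)]
    simpa using (hasDerivAt_const t (0:ℝ)).congr_of_eventuallyEq this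
  · subst h
    simp only [sub_self, max_self, mul_zero]
    rw [hasDerivAt_iff_isLittleO_nhds_zero]
    simp only [add_sub_cancel_left, sub_self, max_self, smul_zero, sub_zero]
    have h1 : (fun h : ℝ => max h 0 ^ 2 - 0 ^ 2) =O[𝓝 0] fun h => h ^ 2 := by
      refine Asymptotics.isBigO_of_le _ fun h => ?_
      simp only [Real.norm_eq_abs, abs_pow]
      rcases le_total h 0 with hh | hh
      · rw [max_eq_right hh]; simp; positivity
      · rw [max_eq_left hh]; simp
    refine h1.trans_isLittleO ?_
    exact (Asymptotics.isLittleO_pow_id one_lt_two)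
  · have : (fun t => (max (t - a) 0) ^ 2) =ᶠ[𝓝 t] fun t => (t - a) ^ 2 := by
      filter_upwards [Ioi_mem_nhds h] with y hy
      rw [max_eq_left (by simp only [mem_Ioi] at hy; linarith)]
    rw [max_eq_left (by linarith)]
    have h2 : HasDerivAt (fun t : ℝ => (t - a) ^ 2) (2 * (t - a)) t := by
      exact (((hasDerivAt_id t).sub_const a).pow 2).congr_deriv (by simp)
    exact h2.congr_of_eventuallyEq this

noncomputable def hcut (δ t : ℝ) : ℝ := ((max (t - δ) 0) ^ 2 - (max (t - 2 * δ) 0) ^ 2) / (2 * δ)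
noncomputable def hcutD (δ t : ℝ) : ℝ := (max (t - δ) 0 - max (t - 2 * δ) 0) / δ

lemma hcut_deriv {δ : ℝ} (hδ : 0 < δ) (t : ℝ) : HasDerivAt (hcut δ) (hcutD δ t) t := by
  have := ((hasDerivAt_maxsq δ t).sub (hasDerivAt_maxsq (2 * δ) t)).div_const (2 * δ)
  refine this.congr_deriv ?_
  unfold hcutD; field_simp

lemma hcutD_cont (δ : ℝ) : Continuous (hcutD δ) := by
  unfold hcutD; fun_prop

lemma contDiff_of_deriv {f f' : ℝ → ℝ} (h : ∀ t, HasDerivAt f (f' t) t) (hc : Continuous f') :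
    ContDiff ℝ 1 f := by
  rw [contDiff_one_iff_deriv]
  refine ⟨fun t => (h t).differentiableAt, ?_⟩
  have : deriv f = f' := funext fun t => (h t).deriv
  rwa [this]

lemma hcut_C1 {δ : ℝ} (hδ : 0 < δ) : ContDiff ℝ 1 (hcut δ) :=
  contDiff_of_deriv (hcut_deriv hδ) (hcutD_cont δ)

lemma hcut_zero {δ t : ℝ} (hδ : 0 < δ) (ht : t ≤ δ) : hcut δ t = 0 := by
  unfold hcut; rw [max_eq_right (by linarith), max_eq_right (by linarith)]; simp

lemma hcutD_zero {δ t : ℝ} (hδ : 0 < δ) (ht : t ≤ δ) : hcutD δ t = 0 := by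
  unfold hcutD; rw [max_eq_right (by linarith), max_eq_right (by linarith)]; simp

lemma hcut_large {δ t : ℝ} (hδ : 0 < δ) (ht : 2 * δ ≤ t) : hcut δ t = t - 3 / 2 * δ := by
  unfold hcut; rw [max_eq_left (by linarith), max_eq_left (by linarith)]; field_simp; ring

lemma hcutD_large {δ t : ℝ} (hδ : 0 < δ) (ht : 2 * δ ≤ t) : hcutD δ t = 1 := by
  unfold hcutD; rw [max_eq_left (by linarith), max_eq_left (by linarith)]; field_simp; ring

lemma hcut_mid {δ t : ℝ} (h1 : δ ≤ t) (ht : t ≤ 2 * δ) :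
    hcut δ t = (t - δ) ^ 2 / (2 * δ) := by
  unfold hcut; rw [max_eq_left (by linarith), max_eq_right (by linarith)]; simp

lemma hcutD_mid {δ t : ℝ} (h1 : δ ≤ t) (ht : t ≤ 2 * δ) :
    hcutD δ t = (t - δ) / δ := by
  unfold hcutD; rw [max_eq_left (by linarith), max_eq_right (by linarith)]; simp

lemma hcut_facts {δ : ℝ} (hδ : 0 < δ) (t : ℝ) :
    0 ≤ hcut δ t ∧ hcut δ t ≤ |t| ∧ 0 ≤ hcutD δ t ∧ hcutD δ t ≤ 1 ∧
    0 ≤ hcutD δ t * t - hcut δ t ∧ hcutD δ t * t - hcut δ t ≤ 2 * δ := by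
  rcases le_total t δ with h1 | h1
  · rw [hcut_zero hδ h1, hcutD_zero hδ h1]; simp [hδ.le]
  have ht : |t| = t := abs_of_nonneg (by linarith)
  rcases le_total t (2 * δ) with h2 | h2
  · rw [hcut_mid h1 h2, hcutD_mid h1 h2, ht]
    obtain ⟨r, rfl⟩ : ∃ r, t = r * δ := ⟨t / δ, by field_simp⟩
    have r1 : 1 ≤ r := by by_contra h; push Not at h; nlinarith
    have r2 : r ≤ 2 := by by_contra h; push Not at h; nlinarith
    have e1 : (r * δ - δ) ^ 2 / (2 * δ) = (r - 1) ^ 2 / 2 * δ := by field_simp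
    have e2 : (r * δ - δ) / δ = r - 1 := by field_simp
    rw [e1, e2]
    refine ⟨by positivity, ?_, by linarith, by linarith, ?_, ?_⟩
    · exact mul_le_mul_of_nonneg_right (by nlinarith) hδ.le
    · have : 0 ≤ ((r - 1) * r - (r - 1) ^ 2 / 2) * δ := mul_nonneg (by nlinarith) hδ.le
      linarith
    · have : ((r - 1) * r - (r - 1) ^ 2 / 2) * δ ≤ 2 * δ :=
        mul_le_mul_of_nonneg_right (by nlinarith) hδ.le
      linarith
  · rw [hcut_large hδ h2, hcutD_large hδ h2, ht]
    refine ⟨by linarith, by linarith, by norm_num, by norm_num, by linarith, by linarith⟩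

noncomputable def Sc (t : ℝ) : ℝ :=
  2 * ((max (t - 1) 0) ^ 2 - 2 * (max (t - 3 / 2) 0) ^ 2 + (max (t - 2) 0) ^ 2)
noncomputable def ScD (t : ℝ) : ℝ :=
  4 * (max (t - 1) 0 - 2 * max (t - 3 / 2) 0 + max (t - 2) 0)

lemma Sc_deriv (t : ℝ) : HasDerivAt Sc (ScD t) t := by
  have := (((hasDerivAt_maxsq 1 t).sub ((hasDerivAt_maxsq (3 / 2) t).const_mul 2)).add
    (hasDerivAt_maxsq 2 t)).const_mul 2
  refine this.congr_deriv ?_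
  unfold ScD; ring

lemma ScD_cont : Continuous ScD := by unfold ScD; fun_prop

lemma Sc_C1 : ContDiff ℝ 1 Sc := contDiff_of_deriv Sc_deriv ScD_cont

lemma Sc_zero {t : ℝ} (h : t ≤ 1) : Sc t = 0 ∧ ScD t = 0 := by
  unfold Sc ScD
  rw [max_eq_right (by linarith), max_eq_right (by linarith), max_eq_right (by linarith)]; simp

lemma Sc_one {t : ℝ} (h : 2 ≤ t) : Sc t = 1 ∧ ScD t = 0 := by
  unfold Sc ScD
  rw [max_eq_left (by linarith), max_eq_left (by linarith), max_eq_left (by linarith)]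
  constructor <;> ring

lemma Sc_facts (t : ℝ) : 0 ≤ Sc t ∧ Sc t ≤ 1 ∧ 0 ≤ ScD t ∧ ScD t ≤ 2 := by
  rcases le_total t 1 with h1 | h1
  · rw [(Sc_zero h1).1, (Sc_zero h1).2]; norm_num
  rcases le_total 2 t with h2 | h2
  · rw [(Sc_one h2).1, (Sc_one h2).2]; norm_num
  unfold Sc ScD
  rw [max_eq_left (by linarith : 0 ≤ t - 1), max_eq_right (by linarith : t - 2 ≤ 0)]
  rcases le_total t (3 / 2) with h3 | h3
  · rw [max_eq_right (by linarith)]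
    refine ⟨by nlinarith, by nlinarith, by nlinarith, by nlinarith⟩
  · rw [max_eq_left (by linarith)]
    refine ⟨by nlinarith, by nlinarith, by nlinarith, by nlinarith⟩

lemma ScD_ge {t : ℝ} (h1 : 5 / 4 ≤ t) (h2 : t ≤ 7 / 4) : 1 ≤ ScD t := by
  unfold ScD
  rw [max_eq_left (by linarith : 0 ≤ t - 1), max_eq_right (by linarith : t - 2 ≤ 0)]
  rcases le_total t (3 / 2) with h3 | h3
  · rw [max_eq_right (by linarith)]; linarith
  · rw [max_eq_left (by linarith)]; linarith

/-- radial cutoff -/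
noncomputable def etaK {N : ℕ} (c : EE N) (κ R k : ℝ) (x : EE N) : ℝ :=
  Sc (k * (κ * (‖x - c‖ ^ 2 - R ^ 2)))

lemma etaK_grad {N : ℕ} (c : EE N) (κ R k : ℝ) (x : EE N) :
    HasGradientAt (etaK c κ R k)
      ((2 * κ * (k * ScD (k * (κ * (‖x - c‖ ^ 2 - R ^ 2))))) • (x - c)) x := by
  have h1 := hg_normsq c x
  have h2 : HasDerivAt (fun t => Sc (k * (κ * (t - R ^ 2))))
      (ScD (k * (κ * (‖x - c‖ ^ 2 - R ^ 2))) * (k * (κ * 1))) (‖x - c‖ ^ 2) := by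
    have h3 : HasDerivAt (fun t => k * (κ * (t - R ^ 2))) (k * (κ * 1)) (‖x - c‖ ^ 2) :=
      (((hasDerivAt_id _).sub_const _).const_mul κ).const_mul k
    exact (Sc_deriv _).comp _ h3
  have h4 := hg_comp h2 h1
  rw [smul_smul] at h4
  have e : 2 * κ * (k * ScD (k * (κ * (‖x - c‖ ^ 2 - R ^ 2)))) =
      ScD (k * (κ * (‖x - c‖ ^ 2 - R ^ 2))) * (k * (κ * 1)) * 2 := by ring
  rw [e]; exact h4

lemma etaK_C1 {N : ℕ} (c : EE N) (κ R k : ℝ) : ContDiff ℝ 1 (etaK c κ R k) := by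
  unfold etaK
  refine Sc_C1.comp ?_
  exact contDiff_const.mul (contDiff_const.mul
    (((contDiff_id.sub contDiff_const).norm_sq ℝ).sub contDiff_const))

/-! ### reflections -/

noncomputable def Tl {N : ℕ} (e : EE N) : EE N ≃ₗᵢ[ℝ] EE N := (ℝ ∙ e)ᗮ.reflection

lemma Tl_apply {N : ℕ} {e : EE N} (he : ‖e‖ = 1) (v : EE N) : Tl e v = v - (2 * ⟪v, e⟫) • e := by
  unfold Tl
  rw [Submodule.reflection_orthogonal_apply, Submodule.reflection_singleton_apply, he,
    real_inner_comm]
  simp [mul_smul, two_smul]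

lemma Tl_Tl {N : ℕ} (e v : EE N) : Tl e (Tl e v) = v := Submodule.reflection_reflection _ v

lemma inner_Tl {N : ℕ} (e v w : EE N) : ⟪Tl e v, w⟫ = ⟪v, Tl e w⟫ := by
  conv_lhs => rw [← Tl_Tl e w]
  exact LinearIsometryEquiv.inner_map_map _ _ _

lemma Afl_Tl {N : ℕ} (p : ℝ) (e ξ : EE N) : Afl p (Tl e ξ) = Tl e (Afl p ξ) := by
  unfold Afl; rw [map_smul, LinearIsometryEquiv.norm_map]

noncomputable def sig {N : ℕ} (c e x : EE N) : EE N := c + Tl e (x - c)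

lemma sig_sub {N : ℕ} (c e x : EE N) : sig c e x - c = Tl e (x - c) := by simp [sig]

lemma sig_sig {N : ℕ} (c e x : EE N) : sig c e (sig c e x) = x := by
  unfold sig; simp [Tl_Tl]

lemma sig_apply {N : ℕ} {c e : EE N} (he : ‖e‖ = 1) (x : EE N) :
    sig c e x = x - (2 * ⟪x - c, e⟫) • e := by
  unfold sig; rw [Tl_apply he]; abel

lemma norm_sig_sub {N : ℕ} (c e x : EE N) : ‖sig c e x - c‖ = ‖x - c‖ := by
  rw [sig_sub, LinearIsometryEquiv.norm_map]

lemma sig_fix {N : ℕ} {c e x : EE N} (he : ‖e‖ = 1) (h : ⟪x - c, e⟫ = 0) : sig c e x = x := by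
  rw [sig_apply he, h]; simp

lemma inner_sig {N : ℕ} {c e : EE N} (he : ‖e‖ = 1) (x : EE N) :
    ⟪sig c e x - c, e⟫ = - ⟪x - c, e⟫ := by
  rw [sig_sub, Tl_apply he, inner_sub_left, real_inner_smul_left, real_inner_self_eq_norm_sq, he]
  ring

lemma sig_cont {N : ℕ} (c e : EE N) : Continuous (sig c e) := by
  unfold sig
  exact continuous_const.add ((Tl e).continuous.comp (continuous_id.sub continuous_const))

lemma sig_mp {N : ℕ} (c e : EE N) : MeasurePreserving (sig c e) := by
  have h1 : MeasurePreserving (fun x : EE N => x - c) := measurePreserving_sub_right volume c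
  have h2 : MeasurePreserving (Tl e) := (Tl e).measurePreserving
  have h3 : MeasurePreserving (fun x : EE N => c + x) := measurePreserving_add_left volume c
  exact h3.comp (h2.comp h1)

noncomputable def sigH {N : ℕ} (c e : EE N) : EE N ≃ₜ EE N where
  toFun := sig c e
  invFun := sig c e
  left_inv := sig_sig c e
  right_inv := sig_sig c e
  continuous_toFun := sig_cont c e
  continuous_invFun := sig_cont c e

lemma integral_sig {N : ℕ} (c e : EE N) (g : EE N → ℝ) : ∫ x, g (sig c e x) = ∫ x, g x :=
  (sig_mp c e).integral_comp (sigH c e).measurableEmbedding g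

lemma sig_contDiff {N : ℕ} (c e : EE N) {n : WithTop ℕ∞} : ContDiff ℝ n (sig c e) := by
  unfold sig
  exact contDiff_const.add ((Tl e).contDiff.comp (contDiff_id.sub contDiff_const))

lemma hg_sig {N : ℕ} {c e x g : EE N} {f : EE N → ℝ} (hf : HasGradientAt f g (sig c e x)) :
    HasGradientAt (fun y => f (sig c e y)) (Tl e g) x := by
  rw [hg_iff] at *
  have h1 : HasFDerivAt (sig c e) ((Tl e).toContinuousLinearEquiv : EE N →L[ℝ] EE N) x := by
    unfold sig
    have h2 := (Tl e).toContinuousLinearEquiv.hasFDerivAt (x := x - c)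
    have h3 := h2.comp x ((hasFDerivAt_id (𝕜 := ℝ) x).sub_const c)
    exact h3.const_add c
  have h2 := hf.comp x h1
  have e2 : innerSL ℝ (Tl e g) = (innerSL ℝ g).comp
      ((Tl e).toContinuousLinearEquiv : EE N →L[ℝ] EE N) := by
    ext v
    exact inner_Tl e g v
  rw [e2]; exact h2

lemma gradient_sig {N : ℕ} {c e x : EE N} {f : EE N → ℝ} (hf : DifferentiableAt ℝ f (sig c e x)) :
    gradient (fun y => f (sig c e y)) x = Tl e (gradient f (sig c e x)) :=
  (hg_sig hf.hasGradientAt).gradient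

lemma closure_sig {N : ℕ} (c e : EE N) (s : Set (EE N)) :
    closure (sig c e ⁻¹' s) = sig c e ⁻¹' closure s :=
  ((sigH c e).preimage_closure s).symm

lemma frontier_sig {N : ℕ} (c e : EE N) (s : Set (EE N)) :
    frontier (sig c e ⁻¹' s) = sig c e ⁻¹' frontier s :=
  ((sigH c e).preimage_frontier s).symm

lemma USol.sig {N : ℕ} {p lam : ℝ} {Ω : Set (EE N)} {u : EE N → ℝ} (h : USol p lam Ω u)
    (c e : EE N) : USol p lam (sig c e ⁻¹' Ω) (fun x => u (sig c e x)) := by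
  obtain ⟨V, V1, V2, V3⟩ := h.smooth
  refine ⟨h.hp, h.opn.preimage (sig_cont c e), ?_, h.lam0,
    ⟨_root_.sig c e ⁻¹' V, V1.preimage (sig_cont c e), ?_, ?_⟩, fun x hx => h.pos _ hx, ?_, ?_⟩
  · rw [closure_sig]
    exact (sigH c e).isCompact_preimage.2 h.cpt
  · rw [closure_sig]; exact preimage_mono V2
  · exact V3.comp (sig_contDiff c e).contDiffOn (fun x hx => hx)
  · intro x hx
    rw [frontier_sig] at hx
    exact h.zer _ hx
  · intro φ f1 f2 f3
    have g1 : ContDiff ℝ 1 (fun x => φ (_root_.sig c e x)) := f1.comp (sig_contDiff c e)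
    have g2 : HasCompactSupport (fun x => φ (_root_.sig c e x)) :=
      f2.comp_homeomorph (sigH c e)
    have g3 : tsupport (fun x => φ (_root_.sig c e x)) ⊆ Ω := by
      have : tsupport (fun x => φ (_root_.sig c e x)) = _root_.sig c e ⁻¹' tsupport φ := by
        unfold tsupport; rw [← closure_sig]; rfl
      rw [this]
      intro x hx
      have := f3 hx
      simpa [sig_sig] using this
    have hw := h.weak _ g1 g2 g3
    rw [← integral_sig c e, ← integral_sig c e (fun x => lam * u x ^ (p - 1) * _)] at hw
    simp only [sig_sig] at hw
    rw [← hw]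
    congr 1
    ext x
    by_cases hx : x ∈ _root_.sig c e ⁻¹' Ω
    · rw [gradient_sig (h.hgrad (subset_closure hx)).differentiableAt, Afl_Tl,
        gradient_sig (f1.differentiable (by norm_num) _), inner_Tl, sig_sig]
    · have hx2 : x ∉ tsupport φ := fun h => hx (f3 h)
      rw [gradient_sig (f1.differentiable (by norm_num) _), sig_sig, gradient_eq_zero_off hx2]
      simp


lemma tendsto_setInt {N : ℕ} {Ω : Set (EE N)} (hΩ : MeasurableSet Ω) (hv : volume Ω < ⊤)
    {f : ℕ → EE N → ℝ} {g : EE N → ℝ} (C : ℝ) (hf : ∀ᶠ n in atTop, ContinuousOn (f n) Ω)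
    (hC : ∀ᶠ n in atTop, ∀ x ∈ Ω, |f n x| ≤ C)
    (hl : ∀ x ∈ Ω, Tendsto (fun n => f n x) atTop (𝓝 (g x))) :
    Tendsto (fun n => ∫ x in Ω, f n x) atTop (𝓝 (∫ x in Ω, g x)) := by
  refine tendsto_integral_filter_of_dominated_convergence (fun _ => C) ?_ ?_ ?_ ?_
  · filter_upwards [hf] with n hn using hn.aestronglyMeasurable hΩ
  · filter_upwards [hC] with n hn
    exact (ae_restrict_iff' hΩ).2 (ae_of_all _ fun x hx => hn x hx)
  · exact integrableOn_const hv.ne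
  · exact (ae_restrict_iff' hΩ).2 (ae_of_all _ fun x hx => hl x hx)

lemma tendsto_hcut {t : ℝ} (ht : 0 < t) :
    Tendsto (fun n : ℕ => hcut (1 / ((n : ℝ) + 1)) t) atTop (𝓝 t) ∧
    ∀ᶠ n : ℕ in atTop, hcutD (1 / ((n : ℝ) + 1)) t = 1 := by
  have h0 : Tendsto (fun n : ℕ => 1 / ((n : ℝ) + 1)) atTop (𝓝 0) :=
    tendsto_one_div_add_atTop_nhds_zero_nat
  have hev : ∀ᶠ n : ℕ in atTop, 2 * (1 / ((n : ℝ) + 1)) ≤ t := by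
    filter_upwards [h0.eventually (Iio_mem_nhds (by linarith : 0 < t / 2))] with n hn
    linarith
  constructor
  · have : Tendsto (fun n : ℕ => t - 3 / 2 * (1 / ((n : ℝ) + 1))) atTop (𝓝 t) := by
      simpa using (h0.const_mul (3 / 2)).const_sub t
    refine this.congr' ?_
    filter_upwards [hev] with n hn
    rw [hcut_large (by positivity) hn]
  · filter_upwards [hev] with n hn
    rw [hcutD_large (by positivity) hn]

namespace USol
variable {N : ℕ} {p lam : ℝ} {Ω : Set (EE N)} {u : EE N → ℝ}

lemma vol (h : USol p lam Ω u) : volume Ω < ⊤ :=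
  (measure_mono subset_closure).trans_lt h.cpt.measure_lt_top

lemma contOn (h : USol p lam Ω u) : ContinuousOn u Ω := h.cont.mono subset_closure

lemma cgradOn (h : USol p lam Ω u) : ContinuousOn (gradient u) Ω := h.cgrad.mono subset_closure

lemma superlevel (h : USol p lam Ω u) {δ : ℝ} (hδ : 0 < δ) :
    IsCompact {x ∈ closure Ω | δ ≤ u x} ∧ {x ∈ closure Ω | δ ≤ u x} ⊆ Ω := by
  constructor
  · have : IsClosed {x ∈ closure Ω | δ ≤ u x} :=
      h.cont.preimage_isClosed_of_isClosed isClosed_closure isClosed_Ici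
    exact h.cpt.of_isClosed_subset this (fun x hx => hx.1)
  · rintro x ⟨h1, h2⟩
    exact h.mem_of_pos h1 (hδ.trans_le h2)

lemma hcut_test (h : USol p lam Ω u) {δ : ℝ} (hδ : 0 < δ) :
    ContDiff ℝ 1 (Ω.indicator fun x => hcut δ (u x)) ∧
    HasCompactSupport (Ω.indicator fun x => hcut δ (u x)) ∧
    tsupport (Ω.indicator fun x => hcut δ (u x)) ⊆ {x ∈ closure Ω | δ ≤ u x} ∧
    ∀ x ∈ Ω, gradient (Ω.indicator fun x => hcut δ (u x)) x = hcutD δ (u x) • gradient u x := by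
  obtain ⟨h1, h2⟩ := h.superlevel hδ
  have hE : ∀ x ∈ Ω, (Ω.indicator fun x => hcut δ (u x)) =ᶠ[𝓝 x] fun x => hcut δ (u x) := by
    intro x hx
    filter_upwards [h.opn.mem_nhds hx] with y hy using indicator_of_mem hy _
  obtain ⟨a, b, c⟩ := test_C1 (φ := Ω.indicator fun x => hcut δ (u x)) h.opn h1 h2
    (((hcut_C1 hδ).comp_contDiffOn h.contDiffOn).congr fun x hx => indicator_of_mem hx _)
    (by
      intro x hx
      by_cases hxo : x ∈ Ω
      · rw [indicator_of_mem hxo]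
        refine hcut_zero hδ ?_
        by_contra hh
        push Not at hh
        exact hx ⟨subset_closure hxo, hh.le⟩
      · exact indicator_of_notMem hxo _)
  refine ⟨a, b, c, fun x hx => ?_⟩
  rw [(hE x hx).gradient_eq]
  exact (hg_comp (hcut_deriv hδ _) (h.hgrad (subset_closure hx))).gradient

lemma energy (h : USol p lam Ω u) :
    ∫ x in Ω, ‖gradient u x‖ ^ p = lam * ∫ x in Ω, u x ^ p := by
  obtain ⟨M, hM0, hM⟩ := h.bound
  have hp := h.hp
  have key : ∀ n : ℕ, ∫ x in Ω, hcutD (1 / ((n : ℝ) + 1)) (u x) * ‖gradient u x‖ ^ p =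
      lam * ∫ x in Ω, u x ^ (p - 1) * hcut (1 / ((n : ℝ) + 1)) (u x) := by
    intro n
    have hδ : 0 < 1 / ((n : ℝ) + 1) := by positivity
    set δ := 1 / ((n : ℝ) + 1)
    obtain ⟨a, b, c, d⟩ := h.hcut_test hδ
    have hw := h.weak _ a b (c.trans (h.superlevel hδ).2)
    rw [← setIntegral_test (Ω := Ω), ← setIntegral_test (Ω := Ω)] at hw
    · rw [← integral_const_mul]
      refine Eq.trans ?_ (hw.trans ?_)
      · refine setIntegral_congr_fun h.opn.measurableSet fun x hx => ?_
        simp only [d x hx, real_inner_smul_right, inner_Afl_self hp]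
      · refine setIntegral_congr_fun h.opn.measurableSet fun x hx => ?_
        simp only [indicator_of_mem hx]; ring
    · intro x hx; simp [indicator_of_notMem hx]
    · intro x hx
      rw [gradient_eq_zero_off (fun h' => hx ((h.superlevel hδ).2 (c h')))]; simp
  have t1 : Tendsto (fun n : ℕ => ∫ x in Ω, hcutD (1 / ((n : ℝ) + 1)) (u x) * ‖gradient u x‖ ^ p)
      atTop (𝓝 (∫ x in Ω, ‖gradient u x‖ ^ p)) := by
    refine tendsto_setInt h.opn.measurableSet h.vol (M ^ p) (Eventually.of_forall fun n => ?_)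
      (Eventually.of_forall fun n => ?_) ?_
    · exact ((hcutD_cont _).comp_continuousOn h.contOn).mul
        (h.cgradOn.norm.rpow_const fun _ _ => Or.inr (by linarith))
    · intro x hx
      obtain ⟨-, -, f3, f4, -, -⟩ := hcut_facts (by positivity : 0 < 1 / ((n : ℝ) + 1)) (u x)
      have hb : ‖gradient u x‖ ^ p ≤ M ^ p :=
        Real.rpow_le_rpow (norm_nonneg _) (hM x (subset_closure hx)).1 (by linarith)
      have hb0 : 0 ≤ ‖gradient u x‖ ^ p := by positivity
      rw [abs_of_nonneg (mul_nonneg f3 hb0)]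
      nlinarith
    · intro x hx
      refine tendsto_const_nhds.congr' ?_
      filter_upwards [(tendsto_hcut (h.pos x hx)).2] with n hn
      rw [hn, one_mul]
  have t2 : Tendsto (fun n : ℕ => lam * ∫ x in Ω, u x ^ (p - 1) * hcut (1 / ((n : ℝ) + 1)) (u x))
      atTop (𝓝 (lam * ∫ x in Ω, u x ^ p)) := by
    refine Tendsto.const_mul _ ?_
    refine tendsto_setInt h.opn.measurableSet h.vol (M ^ (p - 1) * M)
      (Eventually.of_forall fun n => ?_)
      (Eventually.of_forall fun n => ?_) ?_
    · exact (h.contOn.rpow_const fun _ _ => Or.inr (by linarith)).mul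
        ((hcut_C1 (by positivity)).continuous.comp_continuousOn h.contOn)
    · intro x hx
      obtain ⟨f1, f2, -, -, -, -⟩ := hcut_facts (by positivity : 0 < 1 / ((n : ℝ) + 1)) (u x)
      have hu := (h.pos x hx).le
      have hM' := (hM x (subset_closure hx)).2
      rw [abs_of_nonneg hu] at f2
      have hb : u x ^ (p - 1) ≤ M ^ (p - 1) := Real.rpow_le_rpow hu hM' (by linarith)
      have hb0 : 0 ≤ u x ^ (p - 1) := by positivity
      rw [abs_of_nonneg (mul_nonneg hb0 f1)]
      exact mul_le_mul hb (f2.trans hM') f1 (hb0.trans hb)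
    · intro x hx
      have hu := h.pos x hx
      have e : u x ^ p = u x ^ (p - 1) * u x := by
        rw [← Real.rpow_add_one hu.ne']; congr 1; ring
      rw [e]
      exact (tendsto_hcut hu).1.const_mul _
  exact tendsto_nhds_unique (t1.congr key) t2

end USol


/-! ### Hadamard variation -/

noncomputable def DTh {N : ℕ} (τ : ℝ) (n e : EE N) : EE N →L[ℝ] EE N :=
  ContinuousLinearMap.id ℝ (EE N) + (τ • innerSL ℝ n).smulRight e

lemma DTh_apply {N : ℕ} (τ : ℝ) (n e v : EE N) : DTh τ n e v = v + (τ * ⟪n, v⟫) • e := by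
  simp [DTh]

lemma DTh_det {N : ℕ} (τ : ℝ) (n e : EE N) : (DTh τ n e).det = 1 + τ * ⟪n, e⟫ := by
  have h := LinearMap.transvection.det ((τ • innerSL ℝ n : EE N →L[ℝ] ℝ) : EE N →ₗ[ℝ] ℝ) e
  have e1 : ((DTh τ n e : EE N →L[ℝ] EE N) : EE N →ₗ[ℝ] EE N) =
      LinearMap.transvection ((τ • innerSL ℝ n : EE N →L[ℝ] ℝ) : EE N →ₗ[ℝ] ℝ) e := by
    ext v
    simp [DTh, LinearMap.transvection.apply]
  unfold ContinuousLinearMap.det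
  rw [e1, h]
  simp

noncomputable def DThE {N : ℕ} (τ : ℝ) (n e : EE N) (h : 1 + τ * ⟪n, e⟫ ≠ 0) :
    EE N ≃L[ℝ] EE N :=
  ContinuousLinearEquiv.equivOfInverse (DTh τ n e) (DTh (-(τ / (1 + τ * ⟪n, e⟫))) n e)
    (by
      intro v
      rw [DTh_apply, DTh_apply, inner_add_right, real_inner_smul_right, add_assoc, ← add_smul]
      have : τ * ⟪n, v⟫ + -(τ / (1 + τ * ⟪n, e⟫)) * (⟪n, v⟫ + τ * ⟪n, v⟫ * ⟪n, e⟫) = 0 := by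
        field_simp; ring
      rw [this]; simp)
    (by
      intro v
      rw [DTh_apply, DTh_apply, inner_add_right, real_inner_smul_right, add_assoc, ← add_smul]
      have : -(τ / (1 + τ * ⟪n, e⟫)) * ⟪n, v⟫ +
          τ * (⟪n, v⟫ + -(τ / (1 + τ * ⟪n, e⟫)) * ⟪n, v⟫ * ⟪n, e⟫) = 0 := by
        field_simp; ring
      rw [this]; simp)

noncomputable def Th {N : ℕ} (τ : ℝ) (η : EE N → ℝ) (e x : EE N) : EE N := x + (τ * η x) • e

lemma Th_deriv {N : ℕ} (τ : ℝ) {η : EE N → ℝ} (hη : ContDiff ℝ 1 η) (e x : EE N) :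
    HasFDerivAt (Th τ η e) (DTh τ (gradient η x) e) x := by
  have h1 := hg_iff.1 (hasGradientAt_of_contDiff hη x)
  have h2 := ((h1.const_mul τ).smul_const e)
  exact (hasFDerivAt_id x).add h2

lemma Th_C1 {N : ℕ} (τ : ℝ) {η : EE N → ℝ} (hη : ContDiff ℝ 1 η) (e : EE N) :
    ContDiff ℝ 1 (Th τ η e) := by
  unfold Th
  exact contDiff_id.add ((contDiff_const.mul hη).smul contDiff_const)

lemma eta_lip {N : ℕ} {η : EE N → ℝ} (hη : ContDiff ℝ 1 η) {H : ℝ}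
    (hH : ∀ x, ‖gradient η x‖ ≤ H) (x y : EE N) : |η x - η y| ≤ H * ‖x - y‖ := by
  have := Convex.norm_image_sub_le_of_norm_fderiv_le (𝕜 := ℝ) (f := η) (s := univ) (C := H)
    (x := y) (y := x) (fun z _ => hη.differentiable (by norm_num) z) ?_ convex_univ
    (mem_univ _) (mem_univ _)
  · simpa using this
  · intro z _
    have e : ‖gradient η z‖ = ‖fderiv ℝ η z‖ := by
      unfold gradient; rw [LinearIsometryEquiv.norm_map]
    rw [← e]; exact hH z

lemma Th_homeo {N : ℕ} {τ : ℝ} {η : EE N → ℝ} (hη : ContDiff ℝ 1 η) {e : EE N} (he : ‖e‖ = 1)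
    {H : ℝ} (hH : ∀ x, ‖gradient η x‖ ≤ H) (hτ : |τ| * H ≤ 1 / 2) :
    ∃ Φ : EE N ≃ₜ EE N, (∀ x, Φ x = Th τ η e x) ∧ ContDiff ℝ 1 Φ.symm := by
  have hne : e ≠ 0 := by rintro rfl; simp at he
  have : Nontrivial (EE N) := ⟨e, 0, hne⟩
  have ha : ApproximatesLinearOn (Th τ η e)
      ((ContinuousLinearEquiv.refl ℝ (EE N)) : EE N →L[ℝ] EE N) univ (1 / 2) := by
    intro x _ y _
    have e1 : Th τ η e x - Th τ η e y -
      ((ContinuousLinearEquiv.refl ℝ (EE N)) : EE N →L[ℝ] EE N) (x - y) =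
        (τ * (η x - η y)) • e := by
      simp only [Th, ContinuousLinearEquiv.coe_refl, ContinuousLinearMap.coe_id', id, mul_sub,
        sub_smul]
      abel
    rw [e1, norm_smul, he, mul_one, Real.norm_eq_abs, abs_mul]
    have := eta_lip hη hH x y
    calc |τ| * |η x - η y| ≤ |τ| * (H * ‖x - y‖) := by gcongr
      _ = (|τ| * H) * ‖x - y‖ := by ring
      _ ≤ 1 / 2 * ‖x - y‖ := by gcongr
      _ = _ := by simp
  have hc : Subsingleton (EE N) ∨ (1 / 2 : NNReal) <
      ‖((ContinuousLinearEquiv.refl ℝ (EE N)).symm : EE N →L[ℝ] EE N)‖₊⁻¹ := by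
    right
    have : ‖((ContinuousLinearEquiv.refl ℝ (EE N)).symm : EE N →L[ℝ] EE N)‖₊ = 1 := by
      rw [ContinuousLinearEquiv.refl_symm, ContinuousLinearEquiv.coe_refl]
      exact NNReal.eq ContinuousLinearMap.norm_id
    rw [this, inv_one]
    exact NNReal.coe_lt_coe.1 (by norm_num)
  have hJ : ∀ x, 1 + τ * ⟪gradient η x, e⟫ ≠ 0 := by
    intro x
    have h1 : |τ * ⟪gradient η x, e⟫| ≤ 1 / 2 := by
      rw [abs_mul]
      have := abs_real_inner_le_norm (gradient η x) e
      rw [he, mul_one] at this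
      calc |τ| * |⟪gradient η x, e⟫| ≤ |τ| * H := by gcongr; exact this.trans (hH x)
        _ ≤ _ := hτ
    have := neg_abs_le (τ * ⟪gradient η x, e⟫)
    intro h0; linarith
  refine ⟨ha.toHomeomorph _ hc, fun x => rfl, ?_⟩
  refine Homeomorph.contDiff_symm _ (f₀' := fun x => DThE τ (gradient η x) e (hJ x)) ?_ ?_
  · intro x
    exact Th_deriv τ hη e x
  · exact Th_C1 τ hη e

lemma had_ineq {N : ℕ} {p : ℝ} (hp : 1 < p) {Ω' : Set (EE N)} (hΩ' : IsOpen Ω')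
    {τ : ℝ} {η : EE N → ℝ} (hη : ContDiff ℝ 1 η) {e : EE N} (he : ‖e‖ = 1)
    {H : ℝ} (hH : ∀ x, ‖gradient η x‖ ≤ H) (hτ : |τ| * H ≤ 1 / 2)
    (φ : EE N → ℝ) (h1 : ContDiff ℝ 1 φ) (h2 : HasCompactSupport φ)
    (h3 : ∀ x ∈ tsupport φ, Th τ η e x ∈ Ω') :
    lam1 p Ω' * ∫ x, |φ x| ^ p * (1 + τ * ⟪gradient η x, e⟫) ≤
      ∫ x, (1 + τ * ⟪gradient η x, e⟫) ^ (1 - p) *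
        ‖gradient φ x + τ • (⟪gradient η x, e⟫ • gradient φ x -
          ⟪gradient φ x, e⟫ • gradient η x)‖ ^ p := by
  obtain ⟨Φ, hΦ, hΦs⟩ := Th_homeo hη he hH hτ
  have hJ : ∀ x, 0 < 1 + τ * ⟪gradient η x, e⟫ := by
    intro x
    have h1 : |τ * ⟪gradient η x, e⟫| ≤ 1 / 2 := by
      rw [abs_mul]
      have := abs_real_inner_le_norm (gradient η x) e
      rw [he, mul_one] at this
      calc |τ| * |⟪gradient η x, e⟫| ≤ |τ| * H := by gcongr; exact this.trans (hH x)
        _ ≤ _ := hτ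
    have := neg_abs_le (τ * ⟪gradient η x, e⟫)
    linarith
  have hTinj : Function.Injective (Th τ η e) := by
    intro x y hxy
    rw [← hΦ, ← hΦ] at hxy
    exact Φ.injective hxy
  have hTsurj : Set.range (Th τ η e) = univ := by
    rw [← funext hΦ]; exact Φ.range_coe
  have cov : ∀ g : EE N → ℝ, ∫ y, g y =
      ∫ x, (1 + τ * ⟪gradient η x, e⟫) * g (Th τ η e x) := by
    intro g
    have := integral_image_eq_integral_abs_det_fderiv_smul volume MeasurableSet.univ
      (f := Th τ η e) (f' := fun x => DTh τ (gradient η x) e)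
      (fun x _ => (Th_deriv τ hη e x).hasFDerivWithinAt) hTinj.injOn g
    rw [image_univ, hTsurj, setIntegral_univ, setIntegral_univ] at this
    rw [this]
    congr 1
    ext x
    rw [DTh_det, abs_of_pos (hJ x), smul_eq_mul]
  set v : EE N → ℝ := fun y => φ (Φ.symm y) with hv
  have v1 : ContDiff ℝ 1 v := h1.comp hΦs
  have v2 : HasCompactSupport v := h2.comp_homeomorph Φ.symm
  have v3 : tsupport v ⊆ Ω' := by
    have : tsupport v ⊆ Φ '' tsupport φ := by
      refine closure_minimal ?_ (h2.isCompact.image Φ.continuous).isClosed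
      intro y hy
      exact ⟨Φ.symm y, subset_tsupport _ hy, by simp⟩
    intro y hy
    obtain ⟨x, hx, rfl⟩ := this hy
    rw [hΦ]; exact h3 x hx
  have vT : ∀ x, v (Th τ η e x) = φ x := by
    intro x; rw [← hΦ]; simp [hv]
  have gT : ∀ x, gradient φ x = gradient v (Th τ η e x) +
      (τ * ⟪gradient v (Th τ η e x), e⟫) • gradient η x := by
    intro x
    have a1 : HasFDerivAt φ ((innerSL ℝ (gradient v (Th τ η e x))).comp
        (DTh τ (gradient η x) e)) x := by
      have b1 := hg_iff.1 (hasGradientAt_of_contDiff v1 (Th τ η e x))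
      have b2 := b1.comp x (Th_deriv τ hη e x)
      have : v ∘ Th τ η e = φ := funext vT
      rwa [this] at b2
    have a2 : HasGradientAt φ (gradient v (Th τ η e x) +
      (τ * ⟪gradient v (Th τ η e x), e⟫) • gradient η x) x := by
      rw [hg_iff]
      have : innerSL ℝ (gradient v (Th τ η e x) +
          (τ * ⟪gradient v (Th τ η e x), e⟫) • gradient η x) =
          (innerSL ℝ (gradient v (Th τ η e x))).comp (DTh τ (gradient η x) e) := by
        ext w
        simp only [innerSL_apply_apply, ContinuousLinearMap.comp_apply, DTh_apply,
          inner_add_left, inner_add_right, real_inner_smul_left, real_inner_smul_right]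
        ring
      rw [this]; exact a1
    exact a2.gradient
  have main := lam1_le_C1 hp hΩ' v v1 v2 v3
  rw [cov (fun y => |v y| ^ p), cov (fun y => ‖gradient v y‖ ^ p)] at main
  have e1 : (fun x => (1 + τ * ⟪gradient η x, e⟫) * |v (Th τ η e x)| ^ p) =
      fun x => |φ x| ^ p * (1 + τ * ⟪gradient η x, e⟫) := by
    ext x; rw [vT]; ring
  have e2 : (fun x => (1 + τ * ⟪gradient η x, e⟫) * ‖gradient v (Th τ η e x)‖ ^ p) =
      fun x => (1 + τ * ⟪gradient η x, e⟫) ^ (1 - p) *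
        ‖gradient φ x + τ • (⟪gradient η x, e⟫ • gradient φ x -
          ⟪gradient φ x, e⟫ • gradient η x)‖ ^ p := by
    ext x
    have e3 : gradient φ x + τ • (⟪gradient η x, e⟫ • gradient φ x -
          ⟪gradient φ x, e⟫ • gradient η x) =
        (1 + τ * ⟪gradient η x, e⟫) • gradient v (Th τ η e x) := by
      rw [gT x, inner_add_left, real_inner_smul_left]
      module
    rw [e3, norm_smul, Real.norm_of_nonneg (hJ x).le, Real.mul_rpow (hJ x).le (norm_nonneg _),
      ← mul_assoc, ← Real.rpow_add (hJ x)]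
    simp
  rwa [e1, e2] at main


lemma had_deriv {N : ℕ} {p : ℝ} (hp : 1 < p) {Ω : Set (EE N)} (hΩ : MeasurableSet Ω)
    (hc : IsCompact (closure Ω)) {ξ ζ : EE N → EE N} {β : EE N → ℝ}
    (hξ : ContinuousOn ξ (closure Ω)) (hζ : ContinuousOn ζ (closure Ω))
    (hβ : ContinuousOn β (closure Ω)) {H : ℝ} (hH0 : 0 < H) (hH : ∀ x ∈ closure Ω, |β x| ≤ H) :
    HasDerivAt (fun τ : ℝ => ∫ x in Ω, (1 + τ * β x) ^ (1 - p) * ‖ξ x + τ • ζ x‖ ^ p)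
      (∫ x in Ω, ((1 - p) * β x * ‖ξ x‖ ^ p + p * ⟪Afl p (ξ x), ζ x⟫)) 0 := by
  set ε := 1 / (2 * H) with hε
  have hε0 : 0 < ε := by positivity
  have hJ : ∀ τ ∈ Icc (-ε) ε, ∀ x ∈ closure Ω, 1 / 2 ≤ 1 + τ * β x := by
    intro τ hτ x hx
    have h1 : |τ * β x| ≤ 1 / 2 := by
      rw [abs_mul]
      calc |τ| * |β x| ≤ ε * H := mul_le_mul (abs_le.2 hτ) (hH x hx) (abs_nonneg _) hε0.le
        _ = 1 / 2 := by rw [hε]; field_simp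
    have := neg_abs_le (τ * β x)
    linarith
  set F' : ℝ → EE N → ℝ := fun τ x => (1 - p) * β x * (1 + τ * β x) ^ (-p) * ‖ξ x + τ • ζ x‖ ^ p +
    (1 + τ * β x) ^ (1 - p) * (p * ⟪Afl p (ξ x + τ • ζ x), ζ x⟫) with hF'
  have hcF' : ContinuousOn (fun q : ℝ × EE N => F' q.1 q.2) (Icc (-ε) ε ×ˢ closure Ω) := by
    have m2 : MapsTo Prod.snd (Icc (-ε) ε ×ˢ closure Ω) (closure Ω) := fun q hq => hq.2
    have c1 : ContinuousOn (fun q : ℝ × EE N => β q.2) (Icc (-ε) ε ×ˢ closure Ω) :=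
      hβ.comp continuousOn_snd m2
    have c2 : ContinuousOn (fun q : ℝ × EE N => ξ q.2) (Icc (-ε) ε ×ˢ closure Ω) :=
      hξ.comp continuousOn_snd m2
    have c3 : ContinuousOn (fun q : ℝ × EE N => ζ q.2) (Icc (-ε) ε ×ˢ closure Ω) :=
      hζ.comp continuousOn_snd m2
    have c4 : ContinuousOn (fun q : ℝ × EE N => 1 + q.1 * β q.2) (Icc (-ε) ε ×ˢ closure Ω) :=
      continuousOn_const.add (continuousOn_fst.mul c1)
    have c5 : ContinuousOn (fun q : ℝ × EE N => ξ q.2 + q.1 • ζ q.2) (Icc (-ε) ε ×ˢ closure Ω) :=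
      c2.add (continuousOn_fst.smul c3)
    have hn : ∀ q ∈ (Icc (-ε) ε ×ˢ closure Ω), 1 + q.1 * β q.2 ≠ 0 := by
      intro q hq
      have := hJ q.1 hq.1 q.2 hq.2
      intro h; linarith
    refine ContinuousOn.add ?_ ?_
    · exact ((continuousOn_const.mul c1).mul (c4.rpow_const fun q hq => Or.inl (hn q hq))).mul
        (c5.norm.rpow_const fun q hq => Or.inr (by linarith))
    · exact (c4.rpow_const fun q hq => Or.inl (hn q hq)).mul
        (continuousOn_const.mul (((continuous_Afl hp).comp_continuousOn c5).inner (𝕜 := ℝ) c3))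
  obtain ⟨C, hC⟩ := (isCompact_Icc.prod hc).exists_bound_of_continuousOn hcF'
  have h0 : (0 : ℝ) ∈ Icc (-ε) ε := ⟨by linarith, hε0.le⟩
  have hmeas : ∀ τ ∈ Icc (-ε) ε,
      ContinuousOn (fun x => (1 + τ * β x) ^ (1 - p) * ‖ξ x + τ • ζ x‖ ^ p) (closure Ω) := by
    intro τ hτ
    refine ContinuousOn.mul ?_ ?_
    · refine (continuousOn_const.add (continuousOn_const.mul hβ)).rpow_const fun x hx => Or.inl ?_
      have := hJ τ hτ x hx
      intro h
      have h' : 1 + τ * β x = 0 := h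
      linarith
    · exact (hξ.add (hζ.const_smul τ)).norm.rpow_const fun x hx => Or.inr (by linarith)
  have hfin : volume Ω < ⊤ := (measure_mono subset_closure).trans_lt hc.measure_lt_top
  have key := hasDerivAt_integral_of_dominated_loc_of_deriv_le (μ := volume.restrict Ω)
    (F := fun τ x => (1 + τ * β x) ^ (1 - p) * ‖ξ x + τ • ζ x‖ ^ p) (F' := F') (x₀ := 0)
    (s := Icc (-ε) ε) (bound := fun _ => C) (Icc_mem_nhds (by linarith) hε0) ?_ ?_ ?_ ?_ ?_ ?_
  · have := key.2
    have e : ∀ x, F' 0 x = (1 - p) * β x * ‖ξ x‖ ^ p + p * ⟪Afl p (ξ x), ζ x⟫ := by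
      intro x; simp [hF']
    simp only [e] at this
    exact this
  · filter_upwards [Icc_mem_nhds (by linarith : -ε < 0) hε0] with τ hτ
    exact ((hmeas τ hτ).mono subset_closure).aestronglyMeasurable hΩ
  · exact ((hmeas 0 h0).integrableOn_compact hc).mono_set subset_closure
  · have : ContinuousOn (F' 0) (closure Ω) := by
      have hh : ContinuousOn (fun x : EE N => ((0 : ℝ), x)) (closure Ω) := by fun_prop
      exact hcF'.comp hh (fun x hx => ⟨h0, hx⟩)
    exact (this.mono subset_closure).aestronglyMeasurable hΩ
  · refine (ae_restrict_iff' hΩ).2 (ae_of_all _ fun x hx τ hτ => ?_)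
    exact hC (τ, x) ⟨hτ, subset_closure hx⟩
  · exact integrableOn_const hfin.ne
  · refine (ae_restrict_iff' hΩ).2 (ae_of_all _ fun x hx τ hτ => ?_)
    have hJ' := hJ τ hτ x (subset_closure hx)
    have d1 : HasDerivAt (fun τ : ℝ => 1 + τ * β x) (β x) τ := by
      simpa using ((hasDerivAt_id τ).mul_const (β x)).const_add 1
    have d2 : HasDerivAt (fun τ : ℝ => (1 + τ * β x) ^ (1 - p))
        (β x * (1 - p) * (1 + τ * β x) ^ (1 - p - 1)) τ := d1.rpow_const (Or.inl (by linarith))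
    have d3 : HasDerivAt (fun τ : ℝ => ξ x + τ • ζ x) (ζ x) τ := by
      simpa using ((hasDerivAt_id τ).smul_const (ζ x)).const_add (ξ x)
    have d4 := (hasFDerivAt_norm_rpow (ξ x + τ • ζ x) hp).comp_hasDerivAt τ d3
    have d5 := d2.mul d4
    refine d5.congr_deriv ?_
    simp only [hF', Afl, real_inner_smul_left, smul_apply, innerSL_apply_apply, smul_eq_mul,
      Function.comp]
    rw [show 1 - p - 1 = -p by ring]
    ring

lemma norm_e1 {N : ℕ} (hN : 2 ≤ N) : ‖e1 N‖ = 1 := by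
  obtain ⟨n, rfl⟩ : ∃ n, N = n + 1 := ⟨N - 1, by omega⟩
  have : e1 (n + 1) = EuclideanSpace.single 0 (1 : ℝ) := by
    ext i
    by_cases h : i = 0
    · subst h; simp [e1]
    · have : (i : ℕ) ≠ 0 := fun h' => h (Fin.ext h')
      simp [e1, h]
  rw [this]; simp

lemma mem_Om {N : ℕ} {R₀ R₁ s : ℝ} (hR₀ : 0 < R₀) (x : EE N) :
    x ∈ Om N R₀ R₁ s ↔ ‖x‖ < R₁ ∧ R₀ < ‖x - s • e1 N‖ := by
  unfold Om
  rw [closure_ball _ hR₀.ne']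
  simp [dist_eq_norm]

lemma hadamard {N : ℕ} (hN : 2 ≤ N) {R₀ R₁ : ℝ} (hR₀ : 0 < R₀)
    {p : ℝ} {s : ℝ} {u : EE N → ℝ}
    (h : USol p (lam1 p (Om N R₀ R₁ s)) (Om N R₀ R₁ s) u)
    (hd : HasDerivAt (fun t : ℝ => lam1 p (Om N R₀ R₁ t)) 0 s)
    {η : EE N → ℝ} (hη : ContDiff ℝ 1 η)
    (hη1 : ∀ x, ‖x - s • e1 N‖ ≤ R₀ → η x = 1) (hη0 : ∀ x, R₁ ≤ ‖x‖ → η x = 0) :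
    ∫ x in Om N R₀ R₁ s, ((‖gradient u x‖ ^ p - lam1 p (Om N R₀ R₁ s) * u x ^ p) *
      ⟪gradient η x, e1 N⟫ - p * (⟪gradient u x, e1 N⟫ * ⟪Afl p (gradient u x), gradient η x⟫)) = 0 := by
  set Ω := Om N R₀ R₁ s with hΩdef
  set e := e1 N with hedef
  have he : ‖e‖ = 1 := norm_e1 hN
  have hp := h.hp
  set lam := lam1 p Ω with hlam
  -- bound on the gradient of η
  have hηc : HasCompactSupport η := by
    refine HasCompactSupport.intro (isCompact_closedBall (0 : EE N) R₁) fun x hx => hη0 x ?_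
    simp [dist_eq_norm] at hx; exact hx.le
  obtain ⟨H, hH0, hH⟩ : ∃ H > 0, ∀ x, ‖gradient η x‖ ≤ H := by
    obtain ⟨C, hC⟩ := (isCompact_closedBall (0 : EE N) R₁).exists_bound_of_continuousOn
      (gradient_continuous hη).continuousOn
    refine ⟨max C 1, by positivity, fun x => ?_⟩
    by_cases hx : x ∈ closedBall (0 : EE N) R₁
    · exact (hC x hx).trans (le_max_left _ _)
    · have : x ∉ tsupport η := by
        intro hx2
        have : tsupport η ⊆ closedBall (0 : EE N) R₁ := by
          refine closure_minimal ?_ isClosed_closedBall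
          intro y hy
          by_contra hy2
          simp [dist_eq_norm] at hy2
          exact hy (hη0 y hy2.le)
        exact hx (this hx2)
      rw [gradient_eq_zero_off this]; simp
  have hgc : Continuous (gradient η) := gradient_continuous hη
  set β : EE N → ℝ := fun x => ⟪gradient η x, e⟫ with hβ
  have hβc : Continuous β := hgc.inner continuous_const
  have hβH : ∀ x, |β x| ≤ H := by
    intro x
    have := abs_real_inner_le_norm (gradient η x) e
    rw [he, mul_one] at this
    exact this.trans (hH x)
  set ζ : EE N → EE N := fun x => β x • gradient u x - ⟪gradient u x, e⟫ • gradient η x with hζ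
  have hζc : ContinuousOn ζ (closure Ω) :=
    (hβc.continuousOn.smul h.cgrad).sub
      ((h.cgrad.inner (𝕜 := ℝ) continuousOn_const).smul hgc.continuousOn)
  set Nf : ℝ → ℝ := fun τ => ∫ x in Ω, (1 + τ * β x) ^ (1 - p) * ‖gradient u x + τ • ζ x‖ ^ p
    with hNf
  have hNd := had_deriv hp h.opn.measurableSet h.cpt h.cgrad hζc hβc.continuousOn hH0
    (fun x _ => hβH x)
  set Df : ℝ → ℝ := fun τ => ∫ x in Ω, u x ^ p * (1 + τ * β x) with hDf
  obtain ⟨M, hM0, hM⟩ := h.bound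
  have hup : ContinuousOn (fun x => u x ^ p) (closure Ω) :=
    h.cont.rpow_const fun _ _ => Or.inr (by linarith)
  have iup : IntegrableOn (fun x => u x ^ p) Ω :=
    (hup.integrableOn_compact h.cpt).mono_set subset_closure
  have iupb : IntegrableOn (fun x => u x ^ p * β x) Ω :=
    ((hup.mul hβc.continuousOn).integrableOn_compact h.cpt).mono_set subset_closure
  have hDlin : ∀ τ, Df τ = (∫ x in Ω, u x ^ p) + τ * ∫ x in Ω, u x ^ p * β x := by
    intro τ
    rw [← integral_const_mul, ← integral_add iup (iupb.const_mul τ)]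
    refine setIntegral_congr_fun h.opn.measurableSet fun x _ => ?_
    ring
  have hDd : HasDerivAt Df (∫ x in Ω, u x ^ p * β x) 0 := by
    have : Df = fun τ => (∫ x in Ω, u x ^ p) + τ * ∫ x in Ω, u x ^ p * β x := funext hDlin
    rw [this]
    simpa using ((hasDerivAt_id (0 : ℝ)).mul_const (∫ x in Ω, u x ^ p * β x)).const_add
      (∫ x in Ω, u x ^ p)
  set ε := 1 / (2 * H) with hε
  have hε0 : 0 < ε := by positivity
  have hτH : ∀ τ ∈ Icc (-ε) ε, |τ| * H ≤ 1 / 2 := by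
    intro τ hτ
    calc |τ| * H ≤ ε * H := mul_le_mul_of_nonneg_right (abs_le.2 hτ) hH0.le
      _ = 1 / 2 := by rw [hε]; field_simp
  have hJ : ∀ τ ∈ Icc (-ε) ε, ∀ x, 1 / 2 ≤ 1 + τ * β x ∧ 1 + τ * β x ≤ 3 / 2 := by
    intro τ hτ x
    have h1 : |τ * β x| ≤ 1 / 2 := by
      rw [abs_mul]
      exact (mul_le_mul_of_nonneg_left (hβH x) (abs_nonneg _)).trans (hτH τ hτ)
    have := abs_le.1 h1
    constructor <;> linarith
  -- main inequality
  have main : ∀ τ ∈ Icc (-ε) ε, lam1 p (Om N R₀ R₁ (s + τ)) * Df τ ≤ Nf τ := by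
    intro τ hτ
    obtain ⟨Φ, hΦ, -⟩ := Th_homeo hη he hH (hτH τ hτ)
    have hinj : Function.Injective (Th τ η e) := by
      intro x y hxy
      rw [← hΦ, ← hΦ] at hxy
      exact Φ.injective hxy
    have hmap : ∀ x ∈ Ω, Th τ η e x ∈ Om N R₀ R₁ (s + τ) := by
      intro x hx
      rw [mem_Om hR₀]
      have hx' := (mem_Om hR₀ x).1 hx
      constructor
      · by_contra hh
        push Not at hh
        have : Th τ η e (Th τ η e x) = Th τ η e x := by
          conv_lhs => rw [Th, hη0 _ hh]
          simp
        rw [hinj this] at hh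
        linarith [hx'.1]
      · by_contra hh
        push Not at hh
        have e3 : Th τ η e x - τ • e - s • e = Th τ η e x - (s + τ) • e1 N := by
          rw [← hedef]; module
        have e4 : Th τ η e (Th τ η e x - τ • e) = Th τ η e x := by
          conv_lhs => rw [Th, hη1 _ (by rw [e3]; exact hh)]
          simp
        have e5 := hinj e4
        have this : R₀ < ‖x - s • e‖ := hx'.2
        rw [e5] at e3
        rw [e3] at this
        linarith
    set J : EE N → ℝ := fun x => 1 + τ * β x with hJdef
    have hJc : Continuous J := continuous_const.add (continuous_const.mul hβc)
    have step : ∀ n : ℕ, lam1 p (Om N R₀ R₁ (s + τ)) *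
        ∫ x in Ω, hcut (1 / ((n : ℝ) + 1)) (u x) ^ p * J x ≤
        ∫ x in Ω, J x ^ (1 - p) *
          ‖hcutD (1 / ((n : ℝ) + 1)) (u x) • (gradient u x + τ • ζ x)‖ ^ p := by
      intro n
      have hδ : 0 < 1 / ((n : ℝ) + 1) := by positivity
      set δ := 1 / ((n : ℝ) + 1)
      obtain ⟨a, b, c, d⟩ := h.hcut_test hδ
      have c' := c.trans (h.superlevel hδ).2
      have := had_ineq hp (Om_open N R₀ R₁ (s + τ)) hη he hH (hτH τ hτ) _ a b
        (fun x hx => hmap x (c' hx))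
      rw [← setIntegral_test (Ω := Ω), ← setIntegral_test (Ω := Ω)] at this
      · refine le_trans (le_of_eq ?_) (this.trans (le_of_eq ?_))
        · congr 1
          refine setIntegral_congr_fun h.opn.measurableSet fun x hx => ?_
          simp only [indicator_of_mem hx]
          rw [abs_of_nonneg (hcut_facts hδ _).1]
        · refine setIntegral_congr_fun h.opn.measurableSet fun x hx => ?_
          simp only [d x hx, hJdef, hβ, hζ]
          congr 3
          rw [real_inner_smul_left]
          module
      · intro x hx
        rw [gradient_eq_zero_off (fun h' => hx (c' h'))]
        simp [Real.zero_rpow (by linarith : p ≠ 0)]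
      · intro x hx
        simp [indicator_of_notMem hx, Real.zero_rpow (by linarith : p ≠ 0)]
    have hJ0 : ∀ x, 0 < J x := fun x => by have := (hJ τ hτ x).1; simp only [hJdef]; linarith
    have t1 : Tendsto (fun n : ℕ => lam1 p (Om N R₀ R₁ (s + τ)) *
        ∫ x in Ω, hcut (1 / ((n : ℝ) + 1)) (u x) ^ p * J x) atTop
        (𝓝 (lam1 p (Om N R₀ R₁ (s + τ)) * Df τ)) := by
      refine Tendsto.const_mul _ ?_
      refine tendsto_setInt h.opn.measurableSet h.vol (M ^ p * (3 / 2))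
        (Eventually.of_forall fun n => ?_) (Eventually.of_forall fun n => ?_) ?_
      · exact (((hcut_C1 (by positivity)).continuous.comp_continuousOn h.contOn).rpow_const
          fun _ _ => Or.inr (by linarith)).mul hJc.continuousOn
      · intro x hx
        obtain ⟨f1, f2, -, -, -, -⟩ := hcut_facts (by positivity : 0 < 1 / ((n : ℝ) + 1)) (u x)
        have hM' := (hM x (subset_closure hx)).2
        rw [abs_of_nonneg (h.pos x hx).le] at f2
        rw [abs_of_nonneg (mul_nonneg (by positivity) (hJ0 x).le)]
        exact mul_le_mul (Real.rpow_le_rpow f1 (f2.trans hM') (by linarith)) (hJ τ hτ x).2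
          (hJ0 x).le (by positivity)
      · intro x hx
        exact ((tendsto_hcut (h.pos x hx)).1.rpow_const (Or.inr (by linarith))).mul_const _
    have t2 : Tendsto (fun n : ℕ => ∫ x in Ω, J x ^ (1 - p) *
          ‖hcutD (1 / ((n : ℝ) + 1)) (u x) • (gradient u x + τ • ζ x)‖ ^ p) atTop (𝓝 (Nf τ)) := by
      have hcc : ContinuousOn (fun x => J x ^ (1 - p) * ‖gradient u x + τ • ζ x‖ ^ p)
          (closure Ω) :=
        (hJc.continuousOn.rpow_const fun x _ => Or.inl (hJ0 x).ne').mul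
          ((h.cgrad.add (hζc.const_smul τ)).norm.rpow_const fun x hx => Or.inr (by linarith))
      obtain ⟨C, hC⟩ := h.cpt.exists_bound_of_continuousOn hcc
      refine tendsto_setInt h.opn.measurableSet h.vol C
        (Eventually.of_forall fun n => ?_) (Eventually.of_forall fun n => ?_) ?_
      · exact (hJc.continuousOn.rpow_const fun x _ => Or.inl (hJ0 x).ne').mul
          ((((hcutD_cont _).comp_continuousOn h.contOn).smul
            (h.cgradOn.add ((hζc.mono subset_closure).const_smul τ))).norm.rpow_const
            fun x hx => Or.inr (by linarith))
      · intro x hx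
        obtain ⟨-, -, f3, f4, -, -⟩ := hcut_facts (by positivity : 0 < 1 / ((n : ℝ) + 1)) (u x)
        have hC' := hC x (subset_closure hx)
        have q0 : 0 ≤ J x ^ (1 - p) := Real.rpow_nonneg (hJ0 x).le _
        rw [Real.norm_of_nonneg (mul_nonneg q0 (by positivity))] at hC'
        rw [abs_of_nonneg (mul_nonneg q0 (by positivity))]
        refine le_trans ?_ hC'
        refine mul_le_mul_of_nonneg_left ?_ q0
        refine Real.rpow_le_rpow (norm_nonneg _) ?_ (by linarith)
        rw [norm_smul, Real.norm_of_nonneg f3]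
        exact mul_le_of_le_one_left (norm_nonneg _) f4
      · intro x hx
        refine tendsto_const_nhds.congr' ?_
        filter_upwards [(tendsto_hcut (h.pos x hx)).2] with n hn
        rw [hn, one_smul]
    exact le_of_tendsto_of_tendsto' t1 t2 step
  -- derivative of the difference
  have hds : HasDerivAt (fun τ : ℝ => lam1 p (Om N R₀ R₁ (s + τ))) 0 0 := by
    have h1 : HasDerivAt (fun τ : ℝ => s + τ) 1 0 := (hasDerivAt_id (0 : ℝ)).const_add s
    have h2 : HasDerivAt (fun t : ℝ => lam1 p (Om N R₀ R₁ t)) 0 (s + 0) := by simpa using hd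
    exact (h2.comp 0 h1).congr_deriv (by simp)
  have hfd := hNd.sub (hds.mul hDd)
  have hD0 : Df 0 = ∫ x in Ω, u x ^ p := by rw [hDlin]; simp
  have hN0 : Nf 0 = ∫ x in Ω, ‖gradient u x‖ ^ p := by simp [hNf]
  have hmin : IsLocalMin (fun τ => Nf τ - lam1 p (Om N R₀ R₁ (s + τ)) * Df τ) 0 := by
    filter_upwards [Icc_mem_nhds (by linarith : -ε < 0) hε0] with τ hτ
    have := main τ hτ
    have e0 : Nf 0 - lam1 p (Om N R₀ R₁ (s + 0)) * Df 0 = 0 := by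
      rw [hD0, hN0, h.energy, add_zero]; ring
    rw [e0]; linarith
  have hz := hmin.hasDerivAt_eq_zero hfd
  simp only [zero_mul, zero_add, add_zero] at hz
  rw [← hΩdef, ← hlam, ← integral_const_mul, ← integral_sub] at hz
  · rw [← hz]
    refine setIntegral_congr_fun h.opn.measurableSet fun x hx => ?_
    simp only [hζ, inner_sub_right, real_inner_smul_right, inner_Afl_self hp, hβ]
    ring
  · have : ContinuousOn (fun x => (1 - p) * β x * ‖gradient u x‖ ^ p +
        p * ⟪Afl p (gradient u x), ζ x⟫) (closure Ω) :=
      ((continuousOn_const.mul hβc.continuousOn).mul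
        (h.cgrad.norm.rpow_const fun _ _ => Or.inr (by linarith))).add
        (continuousOn_const.mul
          (((continuous_Afl hp).comp_continuousOn h.cgrad).inner (𝕜 := ℝ) hζc))
    exact (this.integrableOn_compact h.cpt).mono_set subset_closure
  · exact iupb.const_mul lam


noncomputable def Pic {N : ℕ} (p a b : ℝ) (α β : EE N) : ℝ :=
  p * ⟪Afl p α - Afl p β, a ^ p • α - b ^ p • β⟫ - (p - 1) * ((a ^ p - b ^ p) * (‖α‖ ^ p - ‖β‖ ^ p))

lemma Pic_nonneg {N : ℕ} {p a b : ℝ} (hp : 1 < p) (ha : 0 < a) (hb : 0 < b) (α β : EE N) :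
    0 ≤ Pic p a b α β ∧ (Pic p a b α β = 0 → α = β) := by
  obtain ⟨h1, h1'⟩ := picone_basic hp α β
  obtain ⟨h2, -⟩ := picone_basic hp β α
  have e : Pic p a b α β = a ^ p * (‖α‖ ^ p + (p - 1) * ‖β‖ ^ p - p * ⟪Afl p β, α⟫) +
      b ^ p * (‖β‖ ^ p + (p - 1) * ‖α‖ ^ p - p * ⟪Afl p α, β⟫) := by
    unfold Pic
    simp only [inner_sub_left, inner_sub_right, real_inner_smul_right, inner_Afl_self hp]
    ring
  have hap : 0 < a ^ p := Real.rpow_pos_of_pos ha p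
  have hbp : 0 < b ^ p := Real.rpow_pos_of_pos hb p
  have m1 := mul_nonneg hap.le (sub_nonneg.2 h1)
  have m2 := mul_nonneg hbp.le (sub_nonneg.2 h2)
  rw [e]
  refine ⟨by linarith, fun h => h1' ?_⟩
  have : a ^ p * (‖α‖ ^ p + (p - 1) * ‖β‖ ^ p - p * ⟪Afl p β, α⟫) = 0 := by linarith
  rcases mul_eq_zero.1 this with h | h
  · exact absurd h hap.ne'
  · linarith

/-- generic test function for the comparison -/
lemma cmp_test0 {N : ℕ} {p : ℝ} {D K : Set (EE N)} (hD : IsOpen D) (hK : IsCompact K) (hKD : K ⊆ D)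
    {u w v : EE N → ℝ} (hu : ContDiffOn ℝ 1 u D) (hw : ContDiffOn ℝ 1 w D) (hv : ContDiffOn ℝ 1 v D)
    {ε δ : ℝ} (hε : 0 < ε) (hδ : 0 < δ) (pu : ∀ x ∈ D, 0 < u x) (pw : ∀ x ∈ D, 0 < w x)
    (pv : ∀ x ∈ D, 0 < v x)
    (hK2 : ∀ x ∈ D, x ∉ K → (u x + ε) ^ p - (w x + ε) ^ p ≤ δ) :
    ∃ φ : EE N → ℝ, ContDiff ℝ 1 φ ∧ HasCompactSupport φ ∧ tsupport φ ⊆ K ∧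
      (∀ x ∈ D, φ x = hcut δ ((u x + ε) ^ p - (w x + ε) ^ p) * (v x + ε) ^ (1 - p)) ∧
      (∀ x ∈ D, gradient φ x = hcut δ ((u x + ε) ^ p - (w x + ε) ^ p) •
        ((((1 - p) * (v x + ε) ^ (1 - p - 1))) • gradient v x) + (v x + ε) ^ (1 - p) •
        (hcutD δ ((u x + ε) ^ p - (w x + ε) ^ p) • ((p * (u x + ε) ^ (p - 1)) • gradient u x -
          (p * (w x + ε) ^ (p - 1)) • gradient w x))) := by
  set f : EE N → ℝ := fun x => hcut δ ((u x + ε) ^ p - (w x + ε) ^ p) * (v x + ε) ^ (1 - p) with hf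
  have rp : ∀ {v : EE N → ℝ} (q : ℝ), ContDiffOn ℝ 1 v D → (∀ x ∈ D, 0 < v x) →
      ContDiffOn ℝ 1 (fun x => (v x + ε) ^ q) D := by
    intro v q hv pv
    refine (hv.add contDiffOn_const).rpow_const_of_ne fun x hx => ?_
    have := pv x hx
    have h2 : 0 < v x + ε := by linarith
    exact h2.ne'
  have hfC : ContDiffOn ℝ 1 f D :=
    ((hcut_C1 hδ).comp_contDiffOn ((rp p hu pu).sub (rp p hw pw))).mul (rp (1 - p) hv pv)
  have hE : ∀ x ∈ D, D.indicator f =ᶠ[𝓝 x] f := by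
    intro x hx
    filter_upwards [hD.mem_nhds hx] with y hy using indicator_of_mem hy _
  obtain ⟨a, b, c⟩ := test_C1 (φ := D.indicator f) hD hK hKD
    (hfC.congr fun x hx => indicator_of_mem hx _)
    (by
      intro x hx
      by_cases hxo : x ∈ D
      · rw [indicator_of_mem hxo, hf]
        simp only [hcut_zero hδ (hK2 x hxo hx), zero_mul]
      · exact indicator_of_notMem hxo _)
  refine ⟨D.indicator f, a, b, c, fun x hx => indicator_of_mem hx _, fun x hx => ?_⟩
  rw [(hE x hx).gradient_eq]
  have rg : ∀ {v : EE N → ℝ} (q : ℝ), ContDiffOn ℝ 1 v D → (∀ x ∈ D, 0 < v x) →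
      HasGradientAt (fun x => (v x + ε) ^ q) ((q * (v x + ε) ^ (q - 1)) • gradient v x) x := by
    intro v q hv pv
    have := pv x hx
    exact hg_comp (h := fun t => t ^ q) (Real.hasDerivAt_rpow_const (Or.inl (by linarith)))
      (hg_add_const (hasGradientAt_of_contDiffOn hD hv hx) ε)
  exact (hg_mul (hg_comp (hcut_deriv hδ _) (hg_sub (rg p hu pu) (rg p hw pw)))
    (rg (1 - p) hv pv)).gradient

lemma cmp_alg {N : ℕ} {p a b : ℝ} (hp : 1 < p) (ha : 0 < a) (hb : 0 < b) (ξ ζ : EE N) (h h' : ℝ) :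
    ⟪Afl p ξ, h • (((1 - p) * a ^ (1 - p - 1)) • ξ) + a ^ (1 - p) • (h' • ((p * a ^ (p - 1)) • ξ -
          (p * b ^ (p - 1)) • ζ))⟫ =
    p * h' * ⟪Afl p (a⁻¹ • ξ), a ^ p • (a⁻¹ • ξ) - b ^ p • (b⁻¹ • ζ)⟫ +
      (1 - p) * h * ‖a⁻¹ • ξ‖ ^ p := by
  have e1 : a⁻¹ ^ p * a = a⁻¹ ^ (p - 1) := by
    rw [Real.rpow_sub_one (by positivity)]; field_simp
  have q1 : a ^ (1 - p - 1) = a⁻¹ ^ p := by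
    rw [Real.inv_rpow ha.le, ← Real.rpow_neg ha.le]; congr 1; ring
  have q2 : a ^ (1 - p) = a⁻¹ ^ (p - 1) := by
    rw [Real.inv_rpow ha.le, ← Real.rpow_neg ha.le]; congr 1; ring
  have q3 : a ^ (p - 1) = a ^ p * a⁻¹ := by rw [Real.rpow_sub_one ha.ne']; rfl
  have q4 : b ^ (p - 1) = b ^ p * b⁻¹ := by rw [Real.rpow_sub_one hb.ne']; rfl
  have q5 : ‖a⁻¹ • ξ‖ ^ p = a⁻¹ ^ p * ‖ξ‖ ^ p := by
    rw [norm_smul, Real.norm_of_nonneg (by positivity), Real.mul_rpow (by positivity) (norm_nonneg _)]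
  rw [Afl_smul (by positivity), q1, q2, q3, q4, q5]
  simp only [inner_add_right, inner_sub_right, real_inner_smul_right, real_inner_smul_left,
    inner_Afl_self hp]
  ring

lemma cmp_step {N : ℕ} {p lam : ℝ} {Ω Ω' D : Set (EE N)} {u w : EE N → ℝ}
    (h : USol p lam Ω u) (h' : USol p lam Ω' w) (hD : IsOpen D) (hD1 : D ⊆ Ω) (hD2 : D ⊆ Ω')
    (hfr : ∀ x ∈ frontier D, u x ≤ w x) {M : ℝ} (hM0 : 0 < M)
    (hM : ∀ x ∈ D, ‖gradient u x‖ ≤ M ∧ ‖gradient w x‖ ≤ M) {ε δ : ℝ} (hε : 0 < ε) (hδ : 0 < δ) :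
    IntegrableOn (fun x => hcutD δ ((u x + ε) ^ p - (w x + ε) ^ p) *
      Pic p (u x + ε) (w x + ε) ((u x + ε)⁻¹ • gradient u x) ((w x + ε)⁻¹ • gradient w x)) D ∧
    ∫ x in D, hcutD δ ((u x + ε) ^ p - (w x + ε) ^ p) *
      Pic p (u x + ε) (w x + ε) ((u x + ε)⁻¹ • gradient u x) ((w x + ε)⁻¹ • gradient w x) ≤
    lam * (∫ x in D, ((u x / (u x + ε)) ^ (p - 1) - (w x / (w x + ε)) ^ (p - 1)) *
      hcut δ ((u x + ε) ^ p - (w x + ε) ^ p)) +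
      2 * (p - 1) * δ * (M / ε) ^ p * (volume D).toReal := by
  have hp := h.hp
  have hcl1 : closure D ⊆ closure Ω := closure_mono hD1
  have hcl2 : closure D ⊆ closure Ω' := closure_mono hD2
  have hvol : volume D < ⊤ := (measure_mono hD1).trans_lt h.vol
  have pu : ∀ x ∈ D, 0 < u x := fun x hx => h.pos x (hD1 hx)
  have pw : ∀ x ∈ D, 0 < w x := fun x hx => h'.pos x (hD2 hx)
  have hu := h.contDiffOn.mono hD1
  have hw := h'.contDiffOn.mono hD2
  set τ : EE N → ℝ := fun x => (u x + ε) ^ p - (w x + ε) ^ p with hτ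
  have cτ : ContinuousOn τ (closure D) := by
    refine (((h.cont.mono hcl1).add continuousOn_const).rpow_const fun _ _ => Or.inr
      (by linarith)).sub (((h'.cont.mono hcl2).add continuousOn_const).rpow_const fun _ _ => Or.inr
      (by linarith))
  set K := {x ∈ closure D | δ ≤ τ x} with hK
  have hKc : IsCompact K := by
    have : IsClosed K := cτ.preimage_isClosed_of_isClosed isClosed_closure isClosed_Ici
    exact (h.cpt.of_isClosed_subset isClosed_closure hcl1).of_isClosed_subset this (fun x hx => hx.1)
  have hKD : K ⊆ D := by
    rintro x ⟨h1, h2⟩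
    by_contra hx
    have := hfr x (by rw [hD.frontier_eq]; exact ⟨h1, hx⟩)
    have h3 := h.nonneg (hcl1 h1)
    have : (u x + ε) ^ p ≤ (w x + ε) ^ p :=
      Real.rpow_le_rpow (by linarith) (by linarith) (by linarith)
    simp only [hτ] at h2
    linarith
  have hK2 : ∀ x ∈ D, x ∉ K → (u x + ε) ^ p - (w x + ε) ^ p ≤ δ := by
    intro x hx hxK
    by_contra hh
    push Not at hh
    exact hxK ⟨subset_closure hx, hh.le⟩
  obtain ⟨φ, a1, a2, a3, a4, a5⟩ := cmp_test0 hD hKc hKD hu hw hu hε hδ pu pw pu hK2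
  obtain ⟨ψ, b1, b2, b3, b4, b5⟩ := cmp_test0 hD hKc hKD hu hw hw hε hδ pu pw pw hK2
  have w1 := h.weak φ a1 a2 (a3.trans (hKD.trans hD1))
  have w2 := h'.weak ψ b1 b2 (b3.trans (hKD.trans hD2))
  have z1 : ∀ x, x ∉ K → φ x = 0 := fun x hx => image_eq_zero_of_notMem_tsupport fun h => hx (a3 h)
  have z2 : ∀ x, x ∉ K → ψ x = 0 := fun x hx => image_eq_zero_of_notMem_tsupport fun h => hx (b3 h)
  have z3 : ∀ x, x ∉ K → gradient φ x = 0 := fun x hx => gradient_eq_zero_off fun h => hx (a3 h)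
  have z4 : ∀ x, x ∉ K → gradient ψ x = 0 := fun x hx => gradient_eq_zero_off fun h => hx (b3 h)
  have cu : ContinuousOn u K := h.contOn.mono (hKD.trans hD1)
  have cw : ContinuousOn w K := h'.contOn.mono (hKD.trans hD2)
  have cgu : ContinuousOn (gradient u) K := h.cgradOn.mono (hKD.trans hD1)
  have cgw : ContinuousOn (gradient w) K := h'.cgradOn.mono (hKD.trans hD2)
  have i1 : Integrable (fun x => ⟪Afl p (gradient u x), gradient φ x⟫) :=
    integrable_supp hKc (((continuous_Afl hp).comp_continuousOn cgu).inner (𝕜 := ℝ)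
      (gradient_continuous a1).continuousOn) (fun x hx => by simp [z3 x hx])
  have i2 : Integrable (fun x => ⟪Afl p (gradient w x), gradient ψ x⟫) :=
    integrable_supp hKc (((continuous_Afl hp).comp_continuousOn cgw).inner (𝕜 := ℝ)
      (gradient_continuous b1).continuousOn) (fun x hx => by simp [z4 x hx])
  have i3 : Integrable (fun x => (lam * u x ^ (p - 1)) * φ x) :=
    integrable_supp hKc ((continuousOn_const.mul (cu.rpow_const fun _ _ => Or.inr (by linarith))).mul
      a1.continuous.continuousOn) (fun x hx => by simp [z1 x hx])
  have i4 : Integrable (fun x => (lam * w x ^ (p - 1)) * ψ x) :=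
    integrable_supp hKc ((continuousOn_const.mul (cw.rpow_const fun _ _ => Or.inr (by linarith))).mul
      b1.continuous.continuousOn) (fun x hx => by simp [z2 x hx])
  have e1 : ∫ x in D, (⟪Afl p (gradient u x), gradient φ x⟫ - ⟪Afl p (gradient w x), gradient ψ x⟫)
      = ∫ x in D, ((lam * u x ^ (p - 1)) * φ x - (lam * w x ^ (p - 1)) * ψ x) := by
    rw [setIntegral_test, setIntegral_test, integral_sub i1 i2, integral_sub i3 i4, w1, w2]
    · intro x hx; simp [z1 x fun h => hx (hKD h), z2 x fun h => hx (hKD h)]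
    · intro x hx; simp [z3 x fun h => hx (hKD h), z4 x fun h => hx (hKD h)]
  have e2 : ∫ x in D, ((lam * u x ^ (p - 1)) * φ x - (lam * w x ^ (p - 1)) * ψ x) =
      lam * (∫ x in D, ((u x / (u x + ε)) ^ (p - 1) - (w x / (w x + ε)) ^ (p - 1)) *
      hcut δ ((u x + ε) ^ p - (w x + ε) ^ p)) := by
    rw [← integral_const_mul]
    refine setIntegral_congr_fun hD.measurableSet fun x hx => ?_
    have h1 := pu x hx
    have h2 := pw x hx
    simp only [a4 x hx, b4 x hx]
    rw [Real.div_rpow h1.le (by linarith), Real.div_rpow h2.le (by linarith),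
      show 1 - p = -(p - 1) by ring, Real.rpow_neg (by linarith), Real.rpow_neg (by linarith)]
    ring
  rw [← e2, ← e1]
  have e3 : 2 * (p - 1) * δ * (M / ε) ^ p * (volume D).toReal =
      ∫ x in D, 2 * (p - 1) * δ * (M / ε) ^ p := by
    rw [setIntegral_const, smul_eq_mul, mul_comm]; rfl
  have i12 : IntegrableOn (fun x => ⟪Afl p (gradient u x), gradient φ x⟫ -
      ⟪Afl p (gradient w x), gradient ψ x⟫) D := (i1.sub i2).integrableOn
  rw [e3, ← integral_add i12 (integrableOn_const hvol.ne)]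
  set α : EE N → EE N := fun x => (u x + ε)⁻¹ • gradient u x with hα
  set β : EE N → EE N := fun x => (w x + ε)⁻¹ • gradient w x with hβ
  have hexp : ∀ x ∈ D, ⟪Afl p (gradient u x), gradient φ x⟫ - ⟪Afl p (gradient w x), gradient ψ x⟫ =
      hcutD δ (τ x) * Pic p (u x + ε) (w x + ε) (α x) (β x) +
      (p - 1) * ((hcutD δ (τ x) * τ x - hcut δ (τ x)) * (‖α x‖ ^ p - ‖β x‖ ^ p)) := by
    intro x hx
    have h1 := pu x hx
    have h2 := pw x hx
    have h1' : 0 < u x + ε := by linarith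
    have h2' : 0 < w x + ε := by linarith
    rw [a5 x hx, b5 x hx, cmp_alg hp h1' h2']
    have : hcutD δ ((u x + ε) ^ p - (w x + ε) ^ p) • ((p * (u x + ε) ^ (p - 1)) • gradient u x -
          (p * (w x + ε) ^ (p - 1)) • gradient w x) =
        (-hcutD δ ((u x + ε) ^ p - (w x + ε) ^ p)) • ((p * (w x + ε) ^ (p - 1)) • gradient w x -
          (p * (u x + ε) ^ (p - 1)) • gradient u x) := by module
    rw [this, cmp_alg hp h2' h1']
    simp only [Pic, hα, hβ, hτ, inner_sub_left, inner_sub_right]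
    ring
  have cPic : ContinuousOn (fun x => hcutD δ (τ x) * Pic p (u x + ε) (w x + ε) (α x) (β x)) K := by
    have c1 : ContinuousOn (fun x => u x + ε) K := cu.add continuousOn_const
    have c2 : ContinuousOn (fun x => w x + ε) K := cw.add continuousOn_const
    have c3 : ContinuousOn α K := (c1.inv₀ fun x hx => by
      have := pu x (hKD hx)
      have h2 : 0 < u x + ε := by linarith
      exact h2.ne').smul cgu
    have c4 : ContinuousOn β K := (c2.inv₀ fun x hx => by
      have := pw x (hKD hx)
      have h2 : 0 < w x + ε := by linarith
      exact h2.ne').smul cgw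
    have c5 := c1.rpow_const (p := p) fun _ _ => Or.inr (by linarith)
    have c6 := c2.rpow_const (p := p) fun _ _ => Or.inr (by linarith)
    have c7 := c3.norm.rpow_const (p := p) fun _ _ => Or.inr (by linarith)
    have c8 := c4.norm.rpow_const (p := p) fun _ _ => Or.inr (by linarith)
    have cA := continuous_Afl (N := N) hp
    refine ((hcutD_cont δ).comp_continuousOn (c5.sub c6)).mul ?_
    unfold Pic
    exact (continuousOn_const.mul (((cA.comp_continuousOn c3).sub (cA.comp_continuousOn c4)).inner
      (𝕜 := ℝ) ((c5.smul c3).sub (c6.smul c4)))).sub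
      (continuousOn_const.mul ((c5.sub c6).mul (c7.sub c8)))
  have iPic : IntegrableOn (fun x => hcutD δ (τ x) * Pic p (u x + ε) (w x + ε) (α x) (β x)) D := by
    refine IntegrableOn.of_forall_sdiff_eq_zero (s := K) (cPic.integrableOn_compact hKc)
      hD.measurableSet ?_
    rintro x ⟨h1, h2⟩
    have : hcutD δ (τ x) = 0 := hcutD_zero hδ (hK2 x h1 h2)
    rw [this, zero_mul]
  refine ⟨iPic, setIntegral_mono_on iPic ?_ hD.measurableSet ?_⟩
  · exact i12.add (integrableOn_const hvol.ne)
  · intro x hx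
    have h1 := pu x hx
    have h2 := pw x hx
    rw [hexp x hx]
    obtain ⟨-, -, -, -, f5, f6⟩ := hcut_facts hδ (τ x)
    have nb : ‖β x‖ ^ p ≤ (M / ε) ^ p := by
      refine Real.rpow_le_rpow (norm_nonneg _) ?_ (by linarith)
      simp only [hβ]
      rw [norm_smul, Real.norm_of_nonneg (inv_nonneg.2 (by linarith)), inv_mul_eq_div]
      exact div_le_div₀ hM0.le (hM x hx).2 hε (by linarith)
    have na : 0 ≤ ‖α x‖ ^ p := by positivity
    have nM : 0 ≤ (M / ε) ^ p := by positivity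
    have k1 : -(2 * δ * (M / ε) ^ p) ≤
        (hcutD δ (τ x) * τ x - hcut δ (τ x)) * (‖α x‖ ^ p - ‖β x‖ ^ p) := by
      have := mul_le_mul_of_nonneg_left (show -((M / ε) ^ p) ≤ ‖α x‖ ^ p - ‖β x‖ ^ p by linarith) f5
      have := mul_le_mul_of_nonneg_right f6 nM
      linarith
    have := mul_le_mul_of_nonneg_left k1 (by linarith : 0 ≤ p - 1)
    linarith


lemma cmp_grad {N : ℕ} {p lam : ℝ} {Ω Ω' D : Set (EE N)} {u w : EE N → ℝ}
    (h : USol p lam Ω u) (h' : USol p lam Ω' w) (hD : IsOpen D) (hD1 : D ⊆ Ω) (hD2 : D ⊆ Ω')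
    (hfr : ∀ x ∈ frontier D, u x ≤ w x) {x₀ : EE N} (hx₀ : x₀ ∈ D) (hlt : w x₀ < u x₀) :
    (u x₀)⁻¹ • gradient u x₀ = (w x₀)⁻¹ • gradient w x₀ := by
  have hp := h.hp
  obtain ⟨M₁, hM₁, hM₁'⟩ := h.bound
  obtain ⟨M₂, hM₂, hM₂'⟩ := h'.bound
  set M := max M₁ M₂ with hM
  have hM0 : 0 < M := lt_of_lt_of_le hM₁ (le_max_left _ _)
  have bu : ∀ x ∈ D, ‖gradient u x‖ ≤ M ∧ u x ≤ M := fun x hx =>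
    ⟨(hM₁' x (subset_closure (hD1 hx))).1.trans (le_max_left _ _),
      (hM₁' x (subset_closure (hD1 hx))).2.trans (le_max_left _ _)⟩
  have bw : ∀ x ∈ D, ‖gradient w x‖ ≤ M ∧ w x ≤ M := fun x hx =>
    ⟨(hM₂' x (subset_closure (hD2 hx))).1.trans (le_max_right _ _),
      (hM₂' x (subset_closure (hD2 hx))).2.trans (le_max_right _ _)⟩
  have pu : ∀ x ∈ D, 0 < u x := fun x hx => h.pos x (hD1 hx)
  have pw : ∀ x ∈ D, 0 < w x := fun x hx => h'.pos x (hD2 hx)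
  have hvol : volume D < ⊤ := (measure_mono hD1).trans_lt h.vol
  by_contra hne
  set Q : ℝ × EE N → ℝ := fun q => Pic p (u q.2 + q.1) (w q.2 + q.1)
    ((u q.2 + q.1)⁻¹ • gradient u q.2) ((w q.2 + q.1)⁻¹ • gradient w q.2) with hQ
  set T : ℝ × EE N → ℝ := fun q => (u q.2 + q.1) ^ p - (w q.2 + q.1) ^ p with hT
  have hQ0 : 0 < Q (0, x₀) := by
    have := Pic_nonneg hp (pu x₀ hx₀) (pw x₀ hx₀) ((u x₀)⁻¹ • gradient u x₀)
      ((w x₀)⁻¹ • gradient w x₀)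
    simp only [hQ, add_zero]
    exact lt_of_le_of_ne this.1 fun hh => hne (this.2 hh.symm)
  have hT0 : 0 < T (0, x₀) := by
    simp only [hT, add_zero]
    exact sub_pos.2 (Real.rpow_lt_rpow (pw x₀ hx₀).le hlt (by linarith))
  have c1 : ContinuousAt (fun q : ℝ × EE N => u q.2 + q.1) (0, x₀) := by
    have : ContinuousAt u x₀ := (h.contOn.continuousAt (h.opn.mem_nhds (hD1 hx₀)))
    exact (this.comp (x := ((0 : ℝ), x₀)) continuousAt_snd).add continuousAt_fst
  have c2 : ContinuousAt (fun q : ℝ × EE N => w q.2 + q.1) (0, x₀) := by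
    have : ContinuousAt w x₀ := (h'.contOn.continuousAt (h'.opn.mem_nhds (hD2 hx₀)))
    exact (this.comp (x := ((0 : ℝ), x₀)) continuousAt_snd).add continuousAt_fst
  have g1 : ContinuousAt (fun q : ℝ × EE N => gradient u q.2) (0, x₀) :=
    ContinuousAt.comp (g := gradient u) (f := Prod.snd) (x := ((0 : ℝ), x₀))
      (h.cgradOn.continuousAt (h.opn.mem_nhds (hD1 hx₀))) continuousAt_snd
  have g2 : ContinuousAt (fun q : ℝ × EE N => gradient w q.2) (0, x₀) :=
    ContinuousAt.comp (g := gradient w) (f := Prod.snd) (x := ((0 : ℝ), x₀))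
      (h'.cgradOn.continuousAt (h'.opn.mem_nhds (hD2 hx₀))) continuousAt_snd
  have c3 : ContinuousAt (fun q : ℝ × EE N => (u q.2 + q.1)⁻¹ • gradient u q.2) (0, x₀) :=
    (c1.inv₀ (by simpa using (pu x₀ hx₀).ne')).smul g1
  have c4 : ContinuousAt (fun q : ℝ × EE N => (w q.2 + q.1)⁻¹ • gradient w q.2) (0, x₀) :=
    (c2.inv₀ (by simpa using (pw x₀ hx₀).ne')).smul g2
  have c5 := c1.rpow_const (p := p) (Or.inr (by linarith))
  have c6 := c2.rpow_const (p := p) (Or.inr (by linarith))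
  have c7 := c3.norm.rpow_const (p := p) (Or.inr (by linarith))
  have c8 := c4.norm.rpow_const (p := p) (Or.inr (by linarith))
  have cA := continuous_Afl (N := N) hp
  have cT : ContinuousAt T (0, x₀) := c5.sub c6
  have cQ : ContinuousAt Q (0, x₀) := by
    have a1 : ContinuousAt (fun q : ℝ × EE N => Afl p ((u q.2 + q.1)⁻¹ • gradient u q.2)) (0, x₀) :=
      cA.continuousAt.comp (x := ((0 : ℝ), x₀)) c3
    have a2 : ContinuousAt (fun q : ℝ × EE N => Afl p ((w q.2 + q.1)⁻¹ • gradient w q.2)) (0, x₀) :=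
      cA.continuousAt.comp (x := ((0 : ℝ), x₀)) c4
    exact (continuousAt_const.mul ((a1.sub a2).inner (𝕜 := ℝ) ((c5.smul c3).sub (c6.smul c4)))).sub
      (continuousAt_const.mul ((c5.sub c6).mul (c7.sub c8)))
  have ev : ∀ᶠ q in 𝓝 ((0 : ℝ), x₀), Q (0, x₀) / 2 < Q q ∧ T (0, x₀) / 2 < T q ∧ q.2 ∈ D :=
    ((cQ.eventually (lt_mem_nhds (by linarith))).and ((cT.eventually (lt_mem_nhds (by linarith))).and
      (continuousAt_snd.eventually (hD.mem_nhds hx₀))))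
  obtain ⟨r, hr, hball⟩ := Metric.eventually_nhds_iff_ball.1 ev
  set ε : ℕ → ℝ := fun n => 1 / ((n : ℝ) + 1) with hε
  have hε0 : ∀ n, 0 < ε n := fun n => by simp only [hε]; positivity
  have hε1 : ∀ n, ε n ≤ 1 := fun n => by
    simp only [hε]
    rw [div_le_one (by positivity)]
    have : (0 : ℝ) ≤ n := by positivity
    linarith
  have tε : Tendsto ε atTop (𝓝 0) := tendsto_one_div_add_atTop_nhds_zero_nat
  set δ : ℕ → ℝ := fun n => ε n ^ (p + 1) with hδ
  have hδ0 : ∀ n, 0 < δ n := fun n => Real.rpow_pos_of_pos (hε0 n) _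
  have tδ : Tendsto δ atTop (𝓝 0) := by
    have := tε.rpow_const (p := p + 1) (Or.inr (by linarith))
    rwa [Real.zero_rpow (by linarith)] at this
  have stp := fun n => cmp_step h h' hD hD1 hD2 hfr hM0 (fun x hx => ⟨(bu x hx).1, (bw x hx).1⟩)
    (hε0 n) (hδ0 n)
  have frac : ∀ {v : EE N → ℝ}, (∀ x ∈ D, 0 < v x) → ∀ n, ∀ x ∈ D,
      0 ≤ (v x / (v x + ε n)) ^ (p - 1) ∧ (v x / (v x + ε n)) ^ (p - 1) ≤ 1 := by
    intro v pv n x hx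
    have := pv x hx
    have h2 := hε0 n
    have h3 : 0 ≤ v x / (v x + ε n) := by positivity
    refine ⟨Real.rpow_nonneg h3 _, Real.rpow_le_one h3 ?_ (by linarith)⟩
    rw [div_le_one (by positivity)]; linarith
  have rng : ∀ n, ∀ x ∈ D, |hcut (δ n) ((u x + ε n) ^ p - (w x + ε n) ^ p)| ≤ (M + 1) ^ p := by
    intro n x hx
    obtain ⟨f1, f2, -⟩ := hcut_facts (hδ0 n) ((u x + ε n) ^ p - (w x + ε n) ^ p)
    rw [abs_of_nonneg f1]
    refine f2.trans ?_
    have l1 : (u x + ε n) ^ p ≤ (M + 1) ^ p := Real.rpow_le_rpow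
      (add_nonneg (pu x hx).le (hε0 n).le) (add_le_add (bu x hx).2 (hε1 n)) (by linarith)
    have l2 : (w x + ε n) ^ p ≤ (M + 1) ^ p := Real.rpow_le_rpow
      (add_nonneg (pw x hx).le (hε0 n).le) (add_le_add (bw x hx).2 (hε1 n)) (by linarith)
    have l3 : 0 ≤ (u x + ε n) ^ p := Real.rpow_nonneg (add_nonneg (pu x hx).le (hε0 n).le) _
    have l4 : 0 ≤ (w x + ε n) ^ p := Real.rpow_nonneg (add_nonneg (pw x hx).le (hε0 n).le) _
    rw [abs_le]; constructor <;> linarith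
  have frt : ∀ {v : EE N → ℝ}, (∀ x ∈ D, 0 < v x) → ∀ x ∈ D,
      Tendsto (fun n => (v x / (v x + ε n)) ^ (p - 1)) atTop (𝓝 1) := by
    intro v pv x hx
    have hv := pv x hx
    have t : Tendsto (fun n => v x / (v x + ε n)) atTop (𝓝 1) := by
      have := (tendsto_const_nhds (x := v x)).div ((tendsto_const_nhds (x := v x)).add tε)
        (by simpa using hv.ne')
      rwa [add_zero, div_self hv.ne'] at this
    have := t.rpow_const (p := p - 1) (Or.inl one_ne_zero)
    rwa [Real.one_rpow] at this
  have fC : ∀ {v : EE N → ℝ} n, ContinuousOn v D → (∀ x ∈ D, 0 < v x) →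
      ContinuousOn (fun x => (v x / (v x + ε n)) ^ (p - 1)) D ∧
      ContinuousOn (fun x => (v x + ε n) ^ p) D := by
    intro v n hv pv
    constructor
    · refine (hv.div (hv.add continuousOn_const) fun x hx => ?_).rpow_const fun _ _ =>
        Or.inr (by linarith)
      exact (add_pos (pv x hx) (hε0 n)).ne'
    · exact (hv.add continuousOn_const).rpow_const fun _ _ => Or.inr (by linarith)
  have t1 : Tendsto (fun n => ∫ x in D, ((u x / (u x + ε n)) ^ (p - 1) -
      (w x / (w x + ε n)) ^ (p - 1)) * hcut (δ n) ((u x + ε n) ^ p - (w x + ε n) ^ p)) atTop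
      (𝓝 (∫ x in D, 0)) := by
    refine tendsto_setInt hD.measurableSet hvol (1 * (M + 1) ^ p) (Eventually.of_forall fun n => ?_)
      (Eventually.of_forall fun n x hx => ?_) fun x hx => ?_
    · obtain ⟨a1, a2⟩ := fC n (h.contOn.mono hD1) pu
      obtain ⟨b1, b2⟩ := fC n (h'.contOn.mono hD2) pw
      exact (a1.sub b1).mul ((hcut_C1 (hδ0 n)).continuous.comp_continuousOn (a2.sub b2))
    · rw [abs_mul]
      refine mul_le_mul ?_ (rng n x hx) (abs_nonneg _) zero_le_one
      have a1 := frac pu n x hx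
      have a2 := frac pw n x hx
      rw [abs_le]; constructor <;> linarith [a1.1, a1.2, a2.1, a2.2]
    · have tz := ((frt pu x hx).sub (frt pw x hx)).abs.mul_const ((M + 1) ^ p)
      simp only [sub_self, abs_zero, zero_mul] at tz
      refine squeeze_zero_norm (fun n => ?_) tz
      rw [Real.norm_eq_abs, abs_mul]
      exact mul_le_mul_of_nonneg_left (rng n x hx) (abs_nonneg _)
  have t2 : Tendsto (fun n => 2 * (p - 1) * δ n * (M / ε n) ^ p * (volume D).toReal) atTop (𝓝 0) := by
    have e : ∀ n, 2 * (p - 1) * δ n * (M / ε n) ^ p * (volume D).toReal =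
        (2 * (p - 1) * M ^ p * (volume D).toReal) * ε n := by
      intro n
      have hh := hε0 n
      simp only [hδ]
      rw [Real.div_rpow hM0.le hh.le, Real.rpow_add_one hh.ne']
      have : 0 < ε n ^ p := Real.rpow_pos_of_pos hh _
      field_simp
    simp only [e]
    simpa using tε.const_mul (2 * (p - 1) * M ^ p * (volume D).toReal)
  have t3 := (t1.const_mul lam).add t2
  simp only [integral_zero, mul_zero, add_zero] at t3
  have hvb : 0 < (volume (ball x₀ r)).toReal :=
    ENNReal.toReal_pos (measure_ball_pos volume x₀ hr).ne' measure_ball_lt_top.ne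
  have fin : ∀ᶠ n in atTop, Q (0, x₀) / 2 * (volume (ball x₀ r)).toReal ≤
      lam * (∫ x in D, ((u x / (u x + ε n)) ^ (p - 1) -
      (w x / (w x + ε n)) ^ (p - 1)) * hcut (δ n) ((u x + ε n) ^ p - (w x + ε n) ^ p)) +
      2 * (p - 1) * δ n * (M / ε n) ^ p * (volume D).toReal := by
    filter_upwards [tε.eventually (gt_mem_nhds hr), tδ.eventually (gt_mem_nhds
      (by linarith : 0 < T (0, x₀) / 4))] with n hn1 hn2
    refine le_trans ?_ (stp n).2
    have hb : ∀ x ∈ ball x₀ r, Q (0, x₀) / 2 < Q (ε n, x) ∧ T (0, x₀) / 2 < T (ε n, x) ∧ x ∈ D := by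
      intro x hx
      refine hball (ε n, x) ?_
      rw [mem_ball, Prod.dist_eq]
      refine max_lt ?_ hx
      simp [abs_of_pos (hε0 n), hn1]
    have hsub : ball x₀ r ⊆ D := fun x hx => (hb x hx).2.2
    have s1 : Q (0, x₀) / 2 * (volume (ball x₀ r)).toReal = ∫ x in ball x₀ r, Q (0, x₀) / 2 := by
      rw [setIntegral_const, smul_eq_mul, mul_comm]; rfl
    rw [s1]
    refine le_trans (setIntegral_mono_on (integrableOn_const measure_ball_lt_top.ne)
      ((stp n).1.mono_set hsub) measurableSet_ball ?_) (setIntegral_mono_set (stp n).1 ?_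
        hsub.eventuallyLE)
    · intro x hx
      obtain ⟨q1, q2, -⟩ := hb x hx
      rw [hcutD_large (hδ0 n), one_mul]
      · exact q1.le
      · simp only [hT] at q2
        linarith
    · refine (ae_restrict_iff' hD.measurableSet).2 (ae_of_all _ fun x hx => ?_)
      exact mul_nonneg (hcut_facts (hδ0 n) _).2.2.1
        (Pic_nonneg hp (add_pos (pu x hx) (hε0 n)) (add_pos (pw x hx) (hε0 n)) _ _).1
  have := ge_of_tendsto t3 fin
  have := mul_pos (by linarith : 0 < Q (0, x₀) / 2) hvb
  linarith


/-- Unified geometric data (inner sphere `κ = 1`, outer sphere `κ = -1`). -/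
structure Geo {N : ℕ} (Ω : Set (EE N)) (c : EE N) (κ R L : ℝ) : Prop where
  hN : 2 ≤ N
  kap : κ = 1 ∨ κ = -1
  R0 : 0 < R
  L0 : 0 < L
  rL : 0 < R + κ * L
  P : ∀ x ∈ Ω, ∀ y, ‖y - c‖ = ‖x - c‖ → ⟪y - c, e1 N⟫ ≤ ⟪x - c, e1 N⟫ → y ∈ Ω
  Q : ∀ x, 0 < κ * (‖x - c‖ - R) → κ * (‖x - c‖ - R) < L → x ∈ Ω
  out : ∀ x ∈ Ω, 0 < κ * (‖x - c‖ - R)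
  fr : ∀ x, ‖x - c‖ = R → x ∈ frontier Ω
  frL : c + (R + κ * L) • e1 N ∈ frontier Ω
  inL : c - (R + κ * L) • e1 N ∈ Ω

lemma exists_perp {N : ℕ} (hN : 2 ≤ N) : ∃ n : EE N, ‖n‖ = 1 ∧ ⟪n, e1 N⟫ = 0 := by
  refine ⟨EuclideanSpace.single ⟨1, by omega⟩ 1, by simp, ?_⟩
  rw [EuclideanSpace.inner_single_left]
  simp [e1]

lemma arc {N : ℕ} (hN : 2 ≤ N) (v : EE N) (hv : ‖v‖ = 1) :
    ∃ n : EE N, ∃ α ∈ Icc 0 Real.pi, ‖n‖ = 1 ∧ ⟪n, e1 N⟫ = 0 ∧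
      v = Real.cos α • e1 N + Real.sin α • n := by
  have he := norm_e1 hN
  set t := ⟪v, e1 N⟫ with ht
  have hab := abs_real_inner_le_norm v (e1 N)
  rw [hv, he, one_mul, ← ht, abs_le] at hab
  have hcos : Real.cos (Real.arccos t) = t := Real.cos_arccos hab.1 hab.2
  set v' := v - t • e1 N with hv'
  have hperp : ⟪v', e1 N⟫ = 0 := by
    rw [hv', inner_sub_left, real_inner_smul_left, real_inner_self_eq_norm_sq, he, ← ht]; ring
  have hn2 : ‖v'‖ ^ 2 = 1 - t ^ 2 := by
    rw [hv', @norm_sub_sq_real, real_inner_smul_right, norm_smul, hv, he, ← ht]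
    rw [mul_pow, Real.norm_eq_abs, sq_abs]; ring
  have hsin : Real.sin (Real.arccos t) = ‖v'‖ := by
    rw [Real.sin_arccos, ← hn2, Real.sqrt_sq (norm_nonneg _)]
  by_cases h0 : v' = 0
  · obtain ⟨n, h1, h2⟩ := exists_perp hN
    refine ⟨n, Real.arccos t, ⟨Real.arccos_nonneg _, Real.arccos_le_pi _⟩, h1, h2, ?_⟩
    rw [hcos, hsin, h0, norm_zero, zero_smul, add_zero]
    exact sub_eq_zero.1 (hv' ▸ h0)
  · have h0' : ‖v'‖ ≠ 0 := by simpa using h0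
    refine ⟨‖v'‖⁻¹ • v', Real.arccos t, ⟨Real.arccos_nonneg _, Real.arccos_le_pi _⟩, ?_, ?_, ?_⟩
    · rw [norm_smul, norm_inv, norm_norm, inv_mul_cancel₀ h0']
    · rw [real_inner_smul_left, hperp, mul_zero]
    · rw [hcos, hsin, smul_smul, mul_inv_cancel₀ h0', one_smul, hv']; abel

lemma norm_arc {N : ℕ} (hN : 2 ≤ N) {n : EE N} (h1 : ‖n‖ = 1) (h2 : ⟪n, e1 N⟫ = 0) (θ : ℝ) :
    ‖Real.cos θ • e1 N + Real.sin θ • n‖ = 1 ∧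
      ⟪Real.cos θ • e1 N + Real.sin θ • n, e1 N⟫ = Real.cos θ := by
  have he := norm_e1 hN
  constructor
  · have : ‖Real.cos θ • e1 N + Real.sin θ • n‖ ^ 2 = 1 := by
      rw [@norm_add_sq_real, real_inner_smul_left, real_inner_smul_right, real_inner_comm, h2,
        norm_smul, norm_smul, he, h1, mul_one, mul_one, Real.norm_eq_abs, Real.norm_eq_abs, sq_abs,
        sq_abs]
      have := Real.sin_sq_add_cos_sq θ
      linarith
    nlinarith [norm_nonneg (Real.cos θ • e1 N + Real.sin θ • n)]
  · rw [inner_add_left, real_inner_smul_left, real_inner_smul_left, h2,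
      real_inner_self_eq_norm_sq, he]; ring

section Cmp
variable {N : ℕ} {p lam : ℝ} {Ω : Set (EE N)} {u : EE N → ℝ} {c : EE N} {κ R L : ℝ}

lemma Geo.sig_mem (g : Geo Ω c κ R L) {e : EE N} (he : ‖e‖ = 1) (hee : 0 ≤ ⟪e, e1 N⟫)
    {x : EE N} (hx : x ∈ Ω) (hxe : 0 ≤ ⟪x - c, e⟫) : sig c e x ∈ Ω := by
  refine g.P x hx _ (norm_sig_sub _ _ _) ?_
  have : sig c e x - c = (x - c) - (2 * ⟪x - c, e⟫) • e := by rw [sig_apply he]; abel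
  rw [this, inner_sub_left, real_inner_smul_left]
  have := mul_nonneg hxe hee
  linarith

lemma cmpr (g : Geo Ω c κ R L) (h : USol p lam Ω u) {e : EE N} (he : ‖e‖ = 1)
    (hee : 0 < ⟪e, e1 N⟫) {x : EE N} (hx : x ∈ Ω) (hxe : 0 ≤ ⟪x - c, e⟫) :
    u x ≤ u (sig c e x) := by
  rcases hxe.eq_or_lt with hxe | hxe
  · rw [sig_fix he hxe.symm]
  set D := Ω ∩ {x | 0 < ⟪x - c, e⟫} with hDdef
  have hci : Continuous (fun x : EE N => ⟪x - c, e⟫) := by fun_prop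
  have hD : IsOpen D := h.opn.inter (isOpen_lt continuous_const hci)
  set w : EE N → ℝ := fun x => u (sig c e x) with hw
  have h' := h.sig c e
  have hD1 : D ⊆ Ω := inter_subset_left
  have hD2 : D ⊆ sig c e ⁻¹' Ω := fun y hy => g.sig_mem he hee.le hy.1 (le_of_lt hy.2)
  have hfr : ∀ x ∈ frontier D, u x ≤ w x := by
    intro y hy
    rw [hD.frontier_eq] at hy
    obtain ⟨hy1, hy2⟩ := hy
    have k1 : y ∈ closure Ω := closure_mono hD1 hy1
    have k2 : y ∈ closure (sig c e ⁻¹' Ω) := closure_mono hD2 hy1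
    have k3 : 0 ≤ ⟪y - c, e⟫ := by
      have : closure D ⊆ {x | 0 ≤ ⟪x - c, e⟫} :=
        closure_minimal (fun z hz => (show (0 : ℝ) ≤ ⟪z - c, e⟫ from le_of_lt hz.2)) (isClosed_le continuous_const hci)
      exact this hy1
    by_cases hyo : y ∈ Ω
    · have : ⟪y - c, e⟫ = 0 := by
        rcases k3.eq_or_lt with k | k
        · exact k.symm
        · exact absurd ⟨hyo, k⟩ hy2
      simp only [hw]
      rw [sig_fix he this]
    · rw [h.zer y (by rw [h.opn.frontier_eq]; exact ⟨k1, hyo⟩)]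
      exact h'.nonneg k2
  have key := fun y (hy : y ∈ D) (hlt : w y < u y) => cmp_grad h h' hD hD1 hD2 hfr hy hlt
  by_contra hcon
  push Not at hcon
  -- the path
  set ρ := ‖x - c‖ with hρ
  have hρ0 : 0 < ρ := by
    rw [hρ, norm_pos_iff]
    intro h0
    rw [h0, inner_zero_left] at hxe
    exact lt_irrefl _ hxe
  obtain ⟨n, α, hα, n1, n2, hv⟩ := arc g.hN (ρ⁻¹ • (x - c)) (by
    rw [norm_smul, norm_inv, Real.norm_of_nonneg hρ0.le, ← hρ, inv_mul_cancel₀ hρ0.ne'])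
  set γ : ℝ → EE N := fun θ => c + ρ • (Real.cos θ • e1 N + Real.sin θ • n) with hγ
  have hγα : γ α = x := by
    simp only [hγ]; rw [← hv, smul_smul, mul_inv_cancel₀ hρ0.ne', one_smul]; abel
  have hγc : ∀ θ, γ θ - c = ρ • (Real.cos θ • e1 N + Real.sin θ • n) := fun θ => by simp [hγ]
  have hγn : ∀ θ, ‖γ θ - c‖ = ρ := fun θ => by
    rw [hγc, norm_smul, (norm_arc g.hN n1 n2 θ).1, mul_one, Real.norm_of_nonneg hρ0.le]
  have hγi : ∀ θ, ⟪γ θ - c, e1 N⟫ = ρ * Real.cos θ := fun θ => by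
    rw [hγc, real_inner_smul_left, (norm_arc g.hN n1 n2 θ).2]
  have hγΩ : ∀ θ ∈ Icc α Real.pi, γ θ ∈ Ω := by
    intro θ hθ
    refine g.P x hx _ (hγn θ) ?_
    rw [← hγα, hγi, hγi]
    refine mul_le_mul_of_nonneg_left ?_ hρ0.le
    exact Real.cos_le_cos_of_nonneg_of_le_pi hα.1 hθ.2 hθ.1
  have hγC : Continuous γ := by fun_prop
  have hγd : ∀ θ, ∃ v, HasDerivAt γ v θ := fun θ =>
    ⟨_, ((((Real.hasDerivAt_cos θ).smul_const (e1 N)).add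
      ((Real.hasDerivAt_sin θ).smul_const n)).const_smul ρ).const_add c⟩
  set G : ℝ → ℝ := fun θ => ⟪γ θ - c, e⟫ with hG
  have hGC : Continuous G := hci.comp hγC
  have hGα : 0 < G α := by simp only [hG, hγα]; exact hxe
  have hGπ : G Real.pi < 0 := by
    simp only [hG, hγc]
    simp only [Real.cos_pi, Real.sin_pi, zero_smul, add_zero, real_inner_smul_left]
    rw [real_inner_comm]
    nlinarith
  obtain ⟨θ₁, ⟨⟨hθ1, hθ2⟩, hθ3⟩, hθ4⟩ : ∃ θ₁, IsLeast (Icc α Real.pi ∩ {θ | G θ ≤ 0}) θ₁ :=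
    (isCompact_Icc.inter_right (isClosed_le hGC continuous_const)).exists_isLeast
      ⟨Real.pi, ⟨hα.2, le_rfl⟩, hGπ.le⟩
  have hθ3' : G θ₁ ≤ 0 := hθ3
  have hGz : G θ₁ = 0 := by
    by_contra hne
    have : (0 : ℝ) ∈ G '' Icc α θ₁ := intermediate_value_Icc' hθ1 hGC.continuousOn ⟨hθ3', hGα.le⟩
    obtain ⟨θ', k1, k2⟩ := this
    have := hθ4 ⟨⟨k1.1, k1.2.trans hθ2⟩, le_of_eq k2⟩
    have e : θ' = θ₁ := le_antisymm k1.2 this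
    exact hne (e ▸ k2)
  have hGp : ∀ θ ∈ Ico α θ₁, 0 < G θ := by
    intro θ hθ
    by_contra hh
    push Not at hh
    exact absurd (hθ4 ⟨⟨hθ.1, hθ.2.le.trans hθ2⟩, hh⟩) (not_le.2 hθ.2)
  set f : ℝ → ℝ := fun θ => Real.log (u (γ θ)) - Real.log (w (γ θ)) with hf
  have hΩ1 : ∀ θ ∈ Icc α θ₁, γ θ ∈ Ω ∧ sig c e (γ θ) ∈ Ω := by
    intro θ hθ
    have k := hγΩ θ ⟨hθ.1, hθ.2.trans hθ2⟩
    refine ⟨k, g.sig_mem he hee.le k ?_⟩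
    rcases hθ.2.eq_or_lt with q | q
    · rw [q]; exact hGz.ge
    · exact (hGp θ ⟨hθ.1, q⟩).le
  have hfC : ContinuousOn (fun θ => (max (f θ - 0) 0) ^ 2) (Icc α θ₁) := by
    have a1 : ContinuousOn (fun θ => Real.log (u (γ θ))) (Icc α θ₁) :=
      (h.contOn.comp hγC.continuousOn fun θ hθ => (hΩ1 θ hθ).1).log
        fun θ hθ => (h.pos _ (hΩ1 θ hθ).1).ne'
    have a2 : ContinuousOn (fun θ => Real.log (w (γ θ))) (Icc α θ₁) :=
      (h.contOn.comp ((sig_cont c e).comp hγC).continuousOn fun θ hθ => (hΩ1 θ hθ).2).log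
        fun θ hθ => (h.pos _ (hΩ1 θ hθ).2).ne'
    have a3 : ContinuousOn (fun θ => f θ - 0) (Icc α θ₁) := (a1.sub a2).sub continuousOn_const
    exact (ContinuousOn.sup a3 continuousOn_const).pow 2
  have hfd : ∀ θ ∈ Ico α θ₁, HasDerivWithinAt (fun θ => (max (f θ - 0) 0) ^ 2) 0 (Ici θ) θ := by
    intro θ hθ
    obtain ⟨v, hvd⟩ := hγd θ
    obtain ⟨k1, k2⟩ := hΩ1 θ ⟨hθ.1, hθ.2.le⟩
    have hDθ : γ θ ∈ D := ⟨k1, hGp θ hθ⟩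
    have pu := h.pos _ k1
    have pw : 0 < w (γ θ) := h.pos _ k2
    have d1 : HasDerivAt (fun θ => u (γ θ)) ⟪gradient u (γ θ), v⟫ θ := by
      have := (hg_iff.1 (h.hgrad (subset_closure k1))).comp_hasDerivAt θ hvd
      exact this
    have d2 : HasDerivAt (fun θ => w (γ θ)) ⟪gradient w (γ θ), v⟫ θ := by
      have := (hg_iff.1 (h'.hgrad (subset_closure (hD2 hDθ)))).comp_hasDerivAt θ hvd
      exact this
    have d3 : HasDerivAt f (⟪gradient u (γ θ), v⟫ / u (γ θ) - ⟪gradient w (γ θ), v⟫ / w (γ θ)) θ :=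
      (d1.log pu.ne').sub (d2.log pw.ne')
    have d4 := (hasDerivAt_maxsq 0 (f θ)).comp θ d3
    refine (d4.congr_deriv ?_).hasDerivWithinAt
    by_cases hfp : 0 < f θ
    · have hlt : w (γ θ) < u (γ θ) := by
        simp only [hf] at hfp
        exact (Real.log_lt_log_iff pw pu).1 (by linarith)
      have := congrArg (fun z => ⟪z, v⟫) (key _ hDθ hlt)
      simp only [real_inner_smul_left] at this
      rw [div_eq_inv_mul, div_eq_inv_mul, this]; ring
    · rw [max_eq_right (by linarith)]; ring
  have hcst := constant_of_has_deriv_right_zero hfC hfd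
  have e1 := hcst θ₁ ⟨hθ1, le_rfl⟩
  have fz : f θ₁ = 0 := by
    simp only [hf, hw]
    rw [sig_fix he hGz, sub_self]
  have fα : 0 < f α := by
    simp only [hf, hγα]
    have k := h.pos _ (g.sig_mem he hee.le hx hxe.le)
    exact sub_pos.2 (Real.log_lt_log k hcon)
  simp only [fz, sub_zero, max_self] at e1
  rw [max_eq_left fα.le] at e1
  have : 0 < f α ^ 2 := by positivity
  norm_num at e1
  linarith

lemma mon (g : Geo Ω c κ R L) (h : USol p lam Ω u) {x y : EE N} (hx : x ∈ Ω)
    (hxy : ‖y - c‖ = ‖x - c‖) (hlt : ⟪y - c, e1 N⟫ < ⟪x - c, e1 N⟫) : u x ≤ u y := by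
  have hne : x - y ≠ 0 := by
    intro h0
    rw [sub_eq_zero.1 h0] at hlt
    exact lt_irrefl _ hlt
  have hd : 0 < ‖x - y‖ := norm_pos_iff.2 hne
  set e := ‖x - y‖⁻¹ • (x - y) with he
  have he1 : ‖e‖ = 1 := by rw [he, norm_smul, norm_inv, norm_norm, inv_mul_cancel₀ hd.ne']
  have hee : 0 < ⟪e, e1 N⟫ := by
    rw [he, real_inner_smul_left]
    have : x - y = (x - c) - (y - c) := by abel
    refine mul_pos (by positivity) ?_
    rw [this, inner_sub_left]; linarith
  have h2 : 2 * ⟪x - c, x - y⟫ = ‖x - y‖ ^ 2 := by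
    have e0 : x - y = (x - c) - (y - c) := by abel
    rw [e0, @norm_sub_sq_real, inner_sub_right, real_inner_self_eq_norm_sq, hxy]; ring
  have hin : 2 * ⟪x - c, e⟫ = ‖x - y‖ := by
    rw [he, real_inner_smul_right]
    field_simp
    linarith
  have hs : sig c e x = y := by
    rw [sig_apply he1, hin, he, smul_smul, mul_inv_cancel₀ hd.ne', one_smul]; abel
  have := cmpr g h he1 hee hx (by linarith)
  rwa [hs] at this

end Cmp


/-- the radial density of `∇ η_k` -/
noncomputable def thK {N : ℕ} (c : EE N) (κ R k : ℝ) (x : EE N) : ℝ :=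
  k * ScD (k * (κ * (‖x - c‖ ^ 2 - R ^ 2)))

lemma thK_cont {N : ℕ} (c : EE N) (κ R k : ℝ) : Continuous (thK c κ R k) := by
  unfold thK
  exact continuous_const.mul (ScD_cont.comp (by fun_prop))

lemma thK_nonneg {N : ℕ} (c : EE N) (κ R : ℝ) {k : ℝ} (hk : 0 ≤ k) (x : EE N) :
    0 ≤ thK c κ R k x := mul_nonneg hk (Sc_facts _).2.2.1

lemma thK_le {N : ℕ} (c : EE N) (κ R : ℝ) {k : ℝ} (hk : 0 ≤ k) (x : EE N) :
    thK c κ R k x ≤ 2 * k := by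
  have := mul_le_mul_of_nonneg_left (Sc_facts (k * (κ * (‖x - c‖ ^ 2 - R ^ 2)))).2.2.2 hk
  unfold thK; linarith

lemma thK_ne {N : ℕ} {c : EE N} {κ R k : ℝ} {x : EE N} (h : thK c κ R k x ≠ 0) :
    1 < k * (κ * (‖x - c‖ ^ 2 - R ^ 2)) ∧ k * (κ * (‖x - c‖ ^ 2 - R ^ 2)) < 2 := by
  constructor
  · by_contra hh
    push Not at hh
    exact h (by unfold thK; rw [(Sc_zero hh).2, mul_zero])
  · by_contra hh
    push Not at hh
    exact h (by unfold thK; rw [(Sc_one hh).2, mul_zero])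

lemma etaK_grad' {N : ℕ} (c : EE N) (κ R k : ℝ) (x : EE N) :
    gradient (etaK c κ R k) x = (2 * κ * thK c κ R k x) • (x - c) :=
  (etaK_grad c κ R k x).gradient

lemma shell_vol {N : ℕ} (c : EE N) {R : ℝ} (hR : 0 < R) : ∃ C > 0, ∃ k₀ : ℕ, ∀ k : ℕ, k₀ ≤ k →
    (k : ℝ) * (volume {x : EE N | |‖x - c‖ ^ 2 - R ^ 2| ≤ 2 / k}).toReal ≤ C := by
  set V := (volume (ball (0 : EE N) 1)).toReal with hV
  have hV0 : 0 ≤ V := ENNReal.toReal_nonneg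
  obtain ⟨k₀, hk₀⟩ := exists_nat_gt (2 / R ^ 2)
  refine ⟨V * (4 / R * N * (2 * R) ^ (N - 1)) + 1, by positivity, k₀, fun k hk => ?_⟩
  have hkR : 2 / R ^ 2 < k := lt_of_lt_of_le hk₀ (by exact_mod_cast hk)
  have hk0 : (0 : ℝ) < k := lt_trans (by positivity) hkR
  have h2k : 2 / (k : ℝ) < R ^ 2 := by
    rw [div_lt_iff₀ (by positivity)] at hkR
    rw [div_lt_iff₀ hk0]; linarith
  have h2k0 : 0 < 2 / (k : ℝ) := by positivity
  set t₂ := √(R ^ 2 + 2 / k) with ht2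
  set t₁ := √(R ^ 2 - 2 / k) with ht1
  have s2 : t₂ ^ 2 = R ^ 2 + 2 / k := Real.sq_sqrt (by positivity)
  have s1 : t₁ ^ 2 = R ^ 2 - 2 / k := Real.sq_sqrt (by linarith)
  have p2 : 0 ≤ t₂ := Real.sqrt_nonneg _
  have p1 : 0 ≤ t₁ := Real.sqrt_nonneg _
  have p1' : 0 < t₁ := Real.sqrt_pos.2 (by linarith)
  have h12 : t₁ ≤ t₂ := Real.sqrt_le_sqrt (by linarith)
  have hR2 : R ≤ t₂ := by
    rw [ht2]; exact Real.le_sqrt_of_sq_le (by linarith)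
  have h22 : t₂ ≤ 2 * R := by
    rw [ht2]; exact Real.sqrt_le_iff.2 ⟨by positivity, by nlinarith⟩
  have hsub : {x : EE N | |‖x - c‖ ^ 2 - R ^ 2| ≤ 2 / k} ⊆ closedBall c t₂ \ ball c t₁ := by
    intro x hx
    have hx' : |‖x - c‖ ^ 2 - R ^ 2| ≤ 2 / k := hx
    rw [abs_le] at hx'
    refine ⟨?_, ?_⟩
    · rw [mem_closedBall, dist_eq_norm]
      exact Real.le_sqrt_of_sq_le (by linarith)
    · rw [mem_ball, dist_eq_norm, not_lt]
      exact Real.sqrt_le_iff.2 ⟨norm_nonneg _, by linarith⟩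
  have hm : (volume (closedBall c t₂ \ ball c t₁)).toReal = (t₂ ^ N - t₁ ^ N) * V := by
    rw [measure_sdiff (ball_subset_closedBall.trans (closedBall_subset_closedBall h12))
      measurableSet_ball.nullMeasurableSet measure_ball_lt_top.ne,
      ENNReal.toReal_sub_of_le (measure_mono (ball_subset_closedBall.trans
        (closedBall_subset_closedBall h12))) measure_closedBall_lt_top.ne,
      Measure.addHaar_closedBall _ _ p2, Measure.addHaar_ball_of_pos _ _ p1', ENNReal.toReal_mul,
      ENNReal.toReal_mul, ENNReal.toReal_ofReal (by positivity), ENNReal.toReal_ofReal (by positivity),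
      finrank_euclideanSpace_fin]
    ring
  have hle : (volume {x : EE N | |‖x - c‖ ^ 2 - R ^ 2| ≤ 2 / k}).toReal ≤ (t₂ ^ N - t₁ ^ N) * V := by
    rw [← hm]
    exact ENNReal.toReal_mono ((measure_mono sdiff_subset).trans_lt
      measure_closedBall_lt_top).ne (measure_mono hsub)
  have hpow : t₂ ^ N - t₁ ^ N ≤ (t₂ - t₁) * N * (2 * R) ^ (N - 1) := by
    have := abs_pow_sub_pow_le t₂ t₁ N
    rw [abs_of_nonneg (sub_nonneg.2 h12), abs_of_nonneg p2, abs_of_nonneg p1, max_eq_left h12] at this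
    refine (le_abs_self _).trans (this.trans ?_)
    refine mul_le_mul_of_nonneg_left (pow_le_pow_left₀ p2 h22 _) ?_
    exact mul_nonneg (sub_nonneg.2 h12) (Nat.cast_nonneg _)
  have hdiff : t₂ - t₁ ≤ (4 / k) / R := by
    rw [le_div_iff₀ hR]
    have : (t₂ - t₁) * (t₂ + t₁) = 4 / k := by
      have : (t₂ - t₁) * (t₂ + t₁) = t₂ ^ 2 - t₁ ^ 2 := by ring
      rw [this, s1, s2]; ring
    nlinarith [sub_nonneg.2 h12]
  calc (k : ℝ) * (volume {x : EE N | |‖x - c‖ ^ 2 - R ^ 2| ≤ 2 / k}).toReal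
      ≤ k * (((4 / k) / R * N * (2 * R) ^ (N - 1)) * V) := by
        refine mul_le_mul_of_nonneg_left (hle.trans (mul_le_mul_of_nonneg_right (hpow.trans ?_) hV0))
          hk0.le
        gcongr
    _ = V * (4 / R * N * (2 * R) ^ (N - 1)) := by field_simp
    _ ≤ _ := by linarith

lemma kap_abs {κ : ℝ} (hκ : κ = 1 ∨ κ = -1) (t : ℝ) : |κ * t| = |t| := by
  rcases hκ with rfl | rfl <;> simp

lemma shell_tendsto {N : ℕ} (c : EE N) {κ R : ℝ} (hκ : κ = 1 ∨ κ = -1) (hR : 0 < R)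
    {K : Set (EE N)} (hK : IsCompact K) {h : EE N → ℝ} (hc : ContinuousOn h K)
    (h0 : ∀ x ∈ K, ‖x - c‖ = R → h x = 0) :
    Tendsto (fun k : ℕ => ∫ x in K, thK c κ R k x * |h x|) atTop (𝓝 0) := by
  obtain ⟨C, hC, k₀, hk₀⟩ := shell_vol c hR
  have hnn : ∀ k : ℕ, 0 ≤ ∫ x in K, thK c κ R k x * |h x| := fun k =>
    setIntegral_nonneg hK.measurableSet fun x _ =>
      mul_nonneg (thK_nonneg c κ R (Nat.cast_nonneg k) x) (abs_nonneg _)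
  rw [Metric.tendsto_atTop]
  intro ε hε
  set ε' := ε / (2 * C + 1) / 2 with hε'
  have hε'0 : 0 < ε' := by positivity
  obtain ⟨k₁, hk₁⟩ : ∃ k₁ : ℕ, ∀ k : ℕ, k₁ ≤ k → ∀ x ∈ K, |‖x - c‖ ^ 2 - R ^ 2| ≤ 2 / k →
      |h x| ≤ ε' := by
    set B := {x ∈ K | ε' ≤ |h x|} with hB
    have hBc : IsCompact B := by
      have : IsClosed B := (hc.abs).preimage_isClosed_of_isClosed hK.isClosed isClosed_Ici
      exact hK.of_isClosed_subset this fun x hx => hx.1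
    by_cases hne : B.Nonempty
    · obtain ⟨x₁, hx₁, hmin⟩ := hBc.exists_isMinOn hne
        (f := fun x => |‖x - c‖ ^ 2 - R ^ 2|) (by fun_prop)
      have hm : 0 < |‖x₁ - c‖ ^ 2 - R ^ 2| := by
        rw [abs_pos]
        intro hz
        have : ‖x₁ - c‖ = R := by
          have h1 : ‖x₁ - c‖ ^ 2 = R ^ 2 := by linarith
          exact (sq_eq_sq₀ (norm_nonneg _) hR.le).1 h1
        have h2 := h0 x₁ hx₁.1 this
        have h3 := hx₁.2
        rw [h2, abs_zero] at h3
        linarith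
      obtain ⟨k₁, hk₁⟩ := exists_nat_gt (2 / |‖x₁ - c‖ ^ 2 - R ^ 2|)
      refine ⟨k₁, fun k hk x hx hxk => ?_⟩
      by_contra hh
      push Not at hh
      have h1 := hmin (show x ∈ B from ⟨hx, hh.le⟩)
      have h1' : |‖x₁ - c‖ ^ 2 - R ^ 2| ≤ |‖x - c‖ ^ 2 - R ^ 2| := h1
      have hkk : 2 / |‖x₁ - c‖ ^ 2 - R ^ 2| < k := lt_of_lt_of_le hk₁ (by exact_mod_cast hk)
      have hk0 : (0 : ℝ) < k := lt_trans (by positivity) hkk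
      rw [div_lt_iff₀ hm] at hkk
      have := h1'.trans hxk
      rw [le_div_iff₀ hk0] at this
      linarith
    · refine ⟨0, fun k _ x hx _ => ?_⟩
      by_contra hh
      push Not at hh
      exact hne ⟨x, hx, hh.le⟩
  refine ⟨max (max k₀ k₁) 1, fun k hk => ?_⟩
  have hkk0 : k₀ ≤ k := (le_max_left _ _).trans ((le_max_left _ _).trans hk)
  have hkk1 : k₁ ≤ k := (le_max_right _ _).trans ((le_max_left _ _).trans hk)
  have hk1 : 1 ≤ k := (le_max_right _ _).trans hk
  have hk0 : (0 : ℝ) < k := by exact_mod_cast hk1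
  rw [dist_zero_right, Real.norm_of_nonneg (hnn k)]
  set Sh := {x : EE N | |‖x - c‖ ^ 2 - R ^ 2| ≤ 2 / k} with hSh
  have hShm : MeasurableSet Sh := (isClosed_le (by fun_prop) continuous_const).measurableSet
  have hoff : ∀ x, x ∉ Sh → thK c κ R k x = 0 := by
    intro x hx
    by_contra hne
    obtain ⟨a1, a2⟩ := thK_ne hne
    refine hx ?_
    show |‖x - c‖ ^ 2 - R ^ 2| ≤ 2 / k
    have hpos : 0 < κ * (‖x - c‖ ^ 2 - R ^ 2) := by
      by_contra hh
      push Not at hh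
      have := mul_nonpos_of_nonneg_of_nonpos hk0.le hh
      linarith
    rw [← kap_abs hκ, abs_of_pos hpos, le_div_iff₀ hk0]
    linarith
  have hfin : volume (K ∩ Sh) < ⊤ := (measure_mono inter_subset_left).trans_lt hK.measure_lt_top
  have hfin2 : volume Sh < ⊤ := by
    refine (measure_mono (t := closedBall c (R + 2 / k + 1)) ?_).trans_lt measure_closedBall_lt_top
    intro x hx
    have hx' : |‖x - c‖ ^ 2 - R ^ 2| ≤ 2 / k := hx
    rw [mem_closedBall, dist_eq_norm]
    have := (abs_le.1 hx').2
    have h2k : 0 < 2 / (k : ℝ) := by positivity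
    by_contra hh
    push Not at hh
    nlinarith [norm_nonneg (x - c)]
  have e1 : ∫ x in K, thK c κ R k x * |h x| = ∫ x in K ∩ Sh, thK c κ R k x * |h x| := by
    refine setIntegral_eq_of_subset_of_forall_sdiff_eq_zero hK.measurableSet inter_subset_left ?_
    intro x hx
    rw [hoff x fun hs => hx.2 ⟨hx.1, hs⟩, zero_mul]
  have e2 : ∫ x in K ∩ Sh, thK c κ R k x * |h x| ≤ (2 * k * ε') * (volume (K ∩ Sh)).toReal := by
    refine (le_abs_self _).trans ?_
    refine norm_setIntegral_le_of_norm_le_const (f := fun x => thK c κ R k x * |h x|) hfin ?_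
    intro x hx
    rw [norm_mul, Real.norm_of_nonneg (thK_nonneg c κ R hk0.le x), Real.norm_eq_abs, abs_abs]
    exact mul_le_mul (thK_le c κ R hk0.le x) (hk₁ k hkk1 x hx.1 hx.2) (abs_nonneg _) (by positivity)
  have e3 : (volume (K ∩ Sh)).toReal ≤ (volume Sh).toReal :=
    ENNReal.toReal_mono hfin2.ne (measure_mono inter_subset_right)
  have e4 := hk₀ k hkk0
  rw [e1]
  calc ∫ x in K ∩ Sh, thK c κ R k x * |h x| ≤ (2 * k * ε') * (volume (K ∩ Sh)).toReal := e2
    _ ≤ (2 * k * ε') * (volume Sh).toReal := mul_le_mul_of_nonneg_left e3 (by positivity)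
    _ = 2 * ε' * (k * (volume Sh).toReal) := by ring
    _ ≤ 2 * ε' * C := mul_le_mul_of_nonneg_left e4 (by positivity)
    _ < ε := by
      rw [hε']
      have : 2 * (ε / (2 * C + 1) / 2) * C = ε * (C / (2 * C + 1)) := by field_simp
      rw [this]
      have : C / (2 * C + 1) < 1 := by rw [div_lt_one (by positivity)]; linarith
      nlinarith


lemma deriv_nonneg_right {f : ℝ → ℝ} {f' : ℝ} (hf : HasDerivAt f f' 0) (h0 : f 0 = 0)
    (h : ∀ᶠ t in 𝓝[>] (0 : ℝ), 0 ≤ f t) : 0 ≤ f' := by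
  have h1 : Tendsto (slope f 0) (𝓝[>] 0) (𝓝 f') :=
    (hasDerivAt_iff_tendsto_slope.1 hf).mono_left
      (nhdsWithin_mono (0 : ℝ) (fun t (ht : t ∈ Ioi (0 : ℝ)) => ne_of_gt (mem_Ioi.1 ht)))
  refine ge_of_tendsto h1 ?_
  filter_upwards [h, self_mem_nhdsWithin] with t ht htp
  have htp' : 0 < t := htp
  rw [slope_def_field, h0, sub_zero, sub_zero]
  positivity

lemma line_deriv {N : ℕ} {u : EE N → ℝ} {x d g : EE N} (hu : HasGradientAt u g x) :
    HasDerivAt (fun t : ℝ => u (x + t • d)) ⟪g, d⟫ 0 := by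
  have h1 : HasFDerivAt u (innerSL ℝ g) (x + (0 : ℝ) • d) := by
    rw [zero_smul, add_zero]; exact hg_iff.1 hu
  have h2 : HasDerivAt (fun t : ℝ => x + t • d) d 0 := by
    have := ((hasDerivAt_id (0 : ℝ)).smul_const d).const_add x
    exact this.congr_deriv (by simp)
  exact (h1.comp_hasDerivAt (0 : ℝ) h2).congr_deriv (by simp)

section bd
variable {N : ℕ} {Ω : Set (EE N)} {c : EE N} {κ R L p lam : ℝ} {u : EE N → ℝ}

lemma Geo.kap_sq (g : Geo Ω c κ R L) : κ * κ = 1 := by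
  rcases g.kap with h | h <;> rw [h] <;> norm_num

lemma kap_pos_sq {κ t R : ℝ} (ht : 0 ≤ t) (hR : 0 < R) :
    0 < κ * (t ^ 2 - R ^ 2) ↔ 0 < κ * (t - R) := by
  have : κ * (t ^ 2 - R ^ 2) = κ * (t - R) * (t + R) := by ring
  rw [this]
  constructor
  · intro h
    exact pos_of_mul_pos_left h (by positivity)
  · intro h
    positivity

lemma Geo.near (g : Geo Ω c κ R L) {x d : EE N} (hx : ‖x - c‖ = R) (hd : 0 < κ * ⟪d, x - c⟫) :
    ∀ᶠ t in 𝓝[>] (0 : ℝ), x + t • d ∈ Ω := by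
  have h1 : ∀ᶠ t in 𝓝 (0 : ℝ), 0 < 2 * (κ * ⟪d, x - c⟫) + t * (κ * ‖d‖ ^ 2) := by
    have : ContinuousAt (fun t : ℝ => 2 * (κ * ⟪d, x - c⟫) + t * (κ * ‖d‖ ^ 2)) 0 := by fun_prop
    refine this.eventually (lt_mem_nhds ?_)
    linarith
  have h2 : ∀ᶠ t in 𝓝 (0 : ℝ), κ * (‖x + t • d - c‖ - R) < L := by
    have : ContinuousAt (fun t : ℝ => κ * (‖x + t • d - c‖ - R)) 0 := by fun_prop
    refine this.eventually (gt_mem_nhds ?_)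
    show κ * (‖x + (0 : ℝ) • d - c‖ - R) < L
    rw [zero_smul, add_zero, hx, sub_self, mul_zero]
    exact g.L0
  filter_upwards [h1.filter_mono nhdsWithin_le_nhds, h2.filter_mono nhdsWithin_le_nhds,
    self_mem_nhdsWithin] with t a1 a2 a3
  have a3' : 0 < t := a3
  refine g.Q _ ?_ a2
  rw [← kap_pos_sq (norm_nonneg _) g.R0]
  have : x + t • d - c = (x - c) + t • d := by abel
  rw [this, norm_add_sq_real, hx, real_inner_smul_right, norm_smul, Real.norm_of_nonneg a3'.le,
    real_inner_comm]
  have : κ * (R ^ 2 + 2 * (t * ⟪d, x - c⟫) + (t * ‖d‖) ^ 2 - R ^ 2) =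
    t * (2 * (κ * ⟪d, x - c⟫) + t * (κ * ‖d‖ ^ 2)) := by ring
  rw [this]
  positivity

lemma Geo.mem_cl (g : Geo Ω c κ R L) {x : EE N} (hx : ‖x - c‖ = R) : x ∈ closure Ω :=
  frontier_subset_closure (g.fr x hx)

lemma Geo.bgrad (g : Geo Ω c κ R L) (h : USol p lam Ω u) {x : EE N} (hx : ‖x - c‖ = R) :
    gradient u x = (κ * ‖gradient u x‖ / R) • (x - c) := by
  have hgr := h.hgrad (g.mem_cl hx)
  have hR := g.R0
  have hu0 : u x = 0 := h.zer x (g.fr x hx)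
  have k1 : ∀ d : EE N, 0 < κ * ⟪d, x - c⟫ → 0 ≤ ⟪gradient u x, d⟫ := by
    intro d hd
    refine deriv_nonneg_right (line_deriv hgr) (by simpa using hu0) ?_
    filter_upwards [g.near hx hd] with t ht
    exact (h.pos _ ht).le
  have hxx : ⟪x - c, x - c⟫ = R ^ 2 := by rw [real_inner_self_eq_norm_sq, hx]
  have k2 : ∀ d : EE N, ⟪d, x - c⟫ = 0 → 0 ≤ ⟪gradient u x, d⟫ := by
    intro d hd
    have h3 : Tendsto (fun ε : ℝ => ⟪gradient u x, d + ε • (κ • (x - c))⟫) (𝓝[>] 0)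
        (𝓝 ⟪gradient u x, d + (0 : ℝ) • (κ • (x - c))⟫) := by
      have : Continuous (fun ε : ℝ => ⟪gradient u x, d + ε • (κ • (x - c))⟫) := by fun_prop
      exact (this.tendsto 0).mono_left nhdsWithin_le_nhds
    rw [zero_smul, add_zero] at h3
    refine ge_of_tendsto h3 ?_
    filter_upwards [self_mem_nhdsWithin] with ε hε
    have hε' : 0 < ε := hε
    refine k1 _ ?_
    rw [inner_add_left, hd, real_inner_smul_left, real_inner_smul_left, hxx]
    have : κ * (0 + ε * (κ * R ^ 2)) = ε * R ^ 2 * (κ * κ) := by ring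
    rw [this, g.kap_sq]
    positivity
  set γ := ⟪gradient u x, x - c⟫ / R ^ 2 with hγ
  have hγ1 : ⟪gradient u x, x - c⟫ = γ * R ^ 2 := by rw [hγ]; field_simp
  have k3 : gradient u x = γ • (x - c) := by
    have hd : ⟪γ • (x - c) - gradient u x, x - c⟫ = 0 := by
      rw [inner_sub_left, real_inner_smul_left, hxx, hγ1, sub_self]
    have h4 := k2 _ hd
    have h5 : ⟪γ • (x - c) - gradient u x, γ • (x - c) - gradient u x⟫ =
        - ⟪gradient u x, γ • (x - c) - gradient u x⟫ := by
      conv_lhs => rw [inner_sub_left, real_inner_smul_left, real_inner_comm, hd]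
      ring
    rw [real_inner_self_eq_norm_sq] at h5
    have h6 : ‖γ • (x - c) - gradient u x‖ = 0 := by
      have := sq_nonneg ‖γ • (x - c) - gradient u x‖
      exact pow_eq_zero_iff (two_ne_zero) |>.1 (by linarith)
    exact (sub_eq_zero.1 (norm_eq_zero.1 h6)).symm
  have k4 : 0 ≤ κ * γ := by
    have := k1 (κ • (x - c)) (by
      rw [real_inner_smul_left, hxx, ← mul_assoc, g.kap_sq]; positivity)
    rw [k3, real_inner_smul_left, real_inner_smul_right, hxx] at this
    have h7 : γ * (κ * R ^ 2) = (κ * γ) * R ^ 2 := by ring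
    rw [h7] at this
    exact nonneg_of_mul_nonneg_left this (by positivity)
  have k5 : ‖gradient u x‖ = κ * γ * R := by
    rw [k3, norm_smul, hx, Real.norm_eq_abs, ← kap_abs g.kap, abs_of_nonneg k4]
  rw [k5]
  have : κ * (κ * γ * R) / R = (κ * κ) * γ := by field_simp
  rw [this, g.kap_sq, one_mul, ← k3]

lemma Geo.bgrad_inner (g : Geo Ω c κ R L) (h : USol p lam Ω u) {x : EE N} (hx : ‖x - c‖ = R) :
    κ * ⟪gradient u x, x - c⟫ = R * ‖gradient u x‖ := by
  have hR := g.R0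
  conv_lhs => rw [g.bgrad h hx]
  rw [real_inner_smul_left, real_inner_self_eq_norm_sq, hx]
  have : κ * (κ * ‖gradient u x‖ / R * R ^ 2) = (κ * κ) * (R * ‖gradient u x‖) := by field_simp
  rw [this, g.kap_sq, one_mul]

lemma Geo.bmon (g : Geo Ω c κ R L) (h : USol p lam Ω u) {x y : EE N} (hx : ‖x - c‖ = R)
    (hy : ‖y - c‖ = R) (hxy : ⟪y - c, e1 N⟫ < ⟪x - c, e1 N⟫) :
    ‖gradient u x‖ ≤ ‖gradient u y‖ := by
  have hR := g.R0
  have d1 := line_deriv (d := κ • (x - c)) (h.hgrad (g.mem_cl hx))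
  have d2 := line_deriv (d := κ • (y - c)) (h.hgrad (g.mem_cl hy))
  have hk : ∀ z : EE N, ‖z - c‖ = R → 0 < κ * ⟪κ • (z - c), z - c⟫ := by
    intro z hz
    rw [real_inner_smul_left, ← mul_assoc, g.kap_sq, real_inner_self_eq_norm_sq, hz]; positivity
  have key := deriv_nonneg_right (d2.sub d1) (by
      simp [h.zer x (g.fr x hx), h.zer y (g.fr y hy)]) (by
    have hs : ∀ᶠ t in 𝓝[>] (0 : ℝ), 0 < 1 + t * κ := by
      have : ContinuousAt (fun t : ℝ => 1 + t * κ) 0 := by fun_prop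
      exact (this.eventually (lt_mem_nhds (by simp))).filter_mono nhdsWithin_le_nhds
    filter_upwards [g.near hx (hk x hx), hs] with t ht hts
    have e : ∀ z : EE N, z + t • κ • (z - c) - c = (1 + t * κ) • (z - c) := by
      intro z; rw [smul_smul, add_smul, one_smul]; abel
    have := mon g h ht (y := y + t • κ • (y - c)) (by rw [e, e, norm_smul, norm_smul, hx, hy])
      (by rw [e, e, real_inner_smul_left, real_inner_smul_left]; exact mul_lt_mul_of_pos_left hxy hts)
    simpa using this)
  rw [real_inner_smul_right, real_inner_smul_right, g.bgrad_inner h hx, g.bgrad_inner h hy] at key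
  have : R * ‖gradient u x‖ ≤ R * ‖gradient u y‖ := by linarith
  exact le_of_mul_le_mul_left this hR

end bd


/-- The integral of a directional derivative of a test function vanishes. -/
lemma div_zero_test {N : ℕ} {φ : EE N → ℝ} (h1 : ContDiff ℝ 1 φ) (hc : HasCompactSupport φ)
    (d : EE N) : ∫ x, ⟪gradient φ x, d⟫ = 0 := by
  have hf : ∀ x, fderiv ℝ φ x d = ⟪gradient φ x, d⟫ := by
    intro x
    rw [(hg_iff.1 (hasGradientAt_of_contDiff h1 x)).fderiv]; simp
  have hi : Integrable (fun x => fderiv ℝ φ x d) := by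
    have hcont : Continuous (fun x => fderiv ℝ φ x d) := by
      have := (h1.continuous_fderiv (by norm_num))
      fun_prop
    refine integrable_supp hc.isCompact hcont.continuousOn ?_
    intro x hx
    rw [hf, gradient_eq_zero_off hx, inner_zero_left]
  have := integral_mul_fderiv_eq_neg_fderiv_mul_of_integrable (μ := (volume : Measure (EE N)))
    (f := fun _ : EE N => (1 : ℝ)) (g := φ) (v := d) (by simp) (by simpa using hi)
    (by simpa using h1.continuous.integrable_of_hasCompactSupport hc) (fun x _ => by fun_prop)
    (fun x _ => (h1.differentiable (by norm_num)) x)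
  simp only [one_mul, fderiv_fun_const, Pi.zero_apply, zero_apply, zero_mul, integral_zero,
    neg_zero] at this
  rw [← this]
  exact integral_congr_ae (Filter.Eventually.of_forall fun x => (hf x).symm)

/-- A C¹ bump. -/
noncomputable def bb {N : ℕ} (y : EE N) (ρ : ℝ) (x : EE N) : ℝ :=
  (max (ρ ^ 2 - ‖x - y‖ ^ 2) 0) ^ 2

lemma bb_grad {N : ℕ} (y : EE N) (ρ : ℝ) (x : EE N) :
    HasGradientAt (bb y ρ) ((-4 * max (ρ ^ 2 - ‖x - y‖ ^ 2) 0) • (x - y)) x := by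
  have h1 : HasDerivAt (fun t : ℝ => (max (ρ ^ 2 - t) 0) ^ 2)
      (-(2 * max (ρ ^ 2 - ‖x - y‖ ^ 2) 0)) (‖x - y‖ ^ 2) := by
    have h2 := hasDerivAt_maxsq 0 (ρ ^ 2 - ‖x - y‖ ^ 2)
    simp only [sub_zero] at h2
    have h3 : HasDerivAt (fun t : ℝ => ρ ^ 2 - t) (-1) (‖x - y‖ ^ 2) := by
      exact ((hasDerivAt_id _).const_sub _)
    exact (h2.comp (‖x - y‖ ^ 2) h3).congr_deriv (by ring)
  have h4 := hg_comp (f := fun x => ‖x - y‖ ^ 2) h1 (hg_normsq y x)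
  have e : (-(2 * max (ρ ^ 2 - ‖x - y‖ ^ 2) 0)) • (2 : ℝ) • (x - y) =
      (-4 * max (ρ ^ 2 - ‖x - y‖ ^ 2) 0) • (x - y) := by
    rw [smul_smul]; congr 1; ring
  rw [e] at h4
  exact h4

lemma bb_C1 {N : ℕ} (y : EE N) (ρ : ℝ) : ContDiff ℝ 1 (bb y ρ) := by
  have h1 : ContDiff ℝ 1 (fun t : ℝ => (max (t - 0) 0) ^ 2) :=
    contDiff_of_deriv (fun t => hasDerivAt_maxsq 0 t) (by fun_prop)
  have h2 : ContDiff ℝ 1 (fun x : EE N => ρ ^ 2 - ‖x - y‖ ^ 2) :=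
    contDiff_const.sub ((contDiff_id.sub contDiff_const).norm_sq ℝ)
  have := h1.comp h2
  simp only [Function.comp_def, sub_zero] at this
  exact this

lemma bb_nonneg {N : ℕ} (y : EE N) (ρ : ℝ) (x : EE N) : 0 ≤ bb y ρ x := sq_nonneg _

lemma bb_off {N : ℕ} {y : EE N} {ρ : ℝ} (hρ : 0 ≤ ρ) {x : EE N} (hx : x ∉ ball y ρ) :
    bb y ρ x = 0 := by
  rw [mem_ball, dist_eq_norm, not_lt] at hx
  have : ρ ^ 2 ≤ ‖x - y‖ ^ 2 := pow_le_pow_left₀ hρ hx 2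
  rw [bb, max_eq_right (by linarith)]; norm_num

lemma Sc_mono : Monotone Sc :=
  monotone_of_deriv_nonneg (fun t => (Sc_deriv t).differentiableAt) fun t => by
    rw [(Sc_deriv t).deriv]; exact (Sc_facts t).2.2.1

lemma etaK_mono {N : ℕ} (c : EE N) {κ R k l : ℝ} (hl : 0 ≤ l) (hkl : l ≤ k) (x : EE N) :
    etaK c κ R l x ≤ etaK c κ R k x := by
  unfold etaK
  rcases le_total 0 (κ * (‖x - c‖ ^ 2 - R ^ 2)) with h | h
  · exact Sc_mono (mul_le_mul_of_nonneg_right hkl h)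
  · rw [(Sc_zero _).1, (Sc_zero _).1]
    · have := mul_nonpos_of_nonneg_of_nonpos (hl.trans hkl) h
      linarith
    · have := mul_nonpos_of_nonneg_of_nonpos hl h
      linarith

/-- centre and radius of the adapted bump at `c + R e₁` -/
noncomputable def yc {N : ℕ} (c : EE N) (κ R m : ℝ) : EE N := c + (R - m * κ) • e1 N

noncomputable def rc (R m : ℝ) : ℝ := √(2 * R * m - m ^ 2)

lemma rc_sq {R m : ℝ} (hm : 0 < m) (hmR : m < R) : rc R m ^ 2 = 2 * R * m - m ^ 2 :=
  Real.sq_sqrt (by nlinarith)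

lemma bb_dir {N : ℕ} (hN : 2 ≤ N) {c : EE N} {κ R m : ℝ} (hκ : κ = 1 ∨ κ = -1) (hm : 0 < m)
    (hmR : m < R) {x : EE N} (hx : 0 ≤ κ * (‖x - c‖ ^ 2 - R ^ 2))
    (hxy : ‖x - yc c κ R m‖ ^ 2 < rc R m ^ 2) : 0 < κ * ⟪x - yc c κ R m, e1 N⟫ := by
  rw [rc_sq hm hmR] at hxy
  have he := norm_e1 hN
  set v := x - yc c κ R m with hv
  have e : x - c = v + (R - m * κ) • e1 N := by rw [hv, yc]; abel
  rw [e, norm_add_sq_real, real_inner_smul_right, norm_smul, he, mul_one, Real.norm_eq_abs,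
    sq_abs] at hx
  rcases hκ with rfl | rfl
  · have : 0 < (R - m) * ⟪v, e1 N⟫ := by nlinarith
    have := pos_of_mul_pos_right this (by linarith)
    linarith
  · have h1 : 0 < (R + m) * (-⟪v, e1 N⟫) := by nlinarith [sq_nonneg ‖v‖, sq_nonneg m, mul_pos hm (hm.trans hmR)]
    have := pos_of_mul_pos_right h1 (by linarith)
    linarith

lemma ball_yc {N : ℕ} (hN : 2 ≤ N) {c : EE N} {κ R : ℝ} (hκ : κ = 1 ∨ κ = -1) (hR : 0 < R)
    {r : ℝ} (hr : 0 < r) : ∃ m, 0 < m ∧ m < R ∧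
      closedBall (yc c κ R m) (rc R m) ⊆ ball (c + R • e1 N) r ∧
      c + R • e1 N ∈ ball (yc c κ R m) (rc R m) := by
  have he := norm_e1 hN
  have hκ1 : |κ| = 1 := by rcases hκ with rfl | rfl <;> simp
  have hd : ∀ m, 0 < m → dist (yc c κ R m) (c + R • e1 N) = m := by
    intro m hm
    have : yc c κ R m - (c + R • e1 N) = (-(m * κ)) • e1 N := by
      rw [yc, sub_smul, neg_smul]; abel
    rw [dist_eq_norm, this, norm_smul, he, mul_one, Real.norm_eq_abs, abs_neg, abs_mul, hκ1, mul_one,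
      abs_of_pos hm]
  have hlim : Tendsto (fun m : ℝ => m + rc R m) (𝓝 0) (𝓝 (0 + rc R 0)) := by
    have : Continuous (fun m : ℝ => m + rc R m) := by unfold rc; fun_prop
    exact this.tendsto 0
  have h0 : (0 : ℝ) + rc R 0 = 0 := by simp [rc]
  rw [h0] at hlim
  have h1 : ∀ᶠ m in 𝓝[>] (0 : ℝ), m + rc R m < r :=
    (hlim.eventually (gt_mem_nhds hr)).filter_mono nhdsWithin_le_nhds
  have h2 : ∀ᶠ m in 𝓝[>] (0 : ℝ), m < R :=
    (eventually_lt_nhds hR).filter_mono nhdsWithin_le_nhds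
  obtain ⟨m, a1, a2, a3⟩ := (h1.and (h2.and self_mem_nhdsWithin)).exists
  have a3' : 0 < m := a3
  refine ⟨m, a3', a2, ?_, ?_⟩
  · intro x hx
    rw [mem_closedBall] at hx
    rw [mem_ball]
    have := dist_triangle x (yc c κ R m) (c + R • e1 N)
    rw [hd m a3'] at this
    linarith
  · rw [mem_ball, dist_comm, hd m a3', rc]
    exact Real.lt_sqrt_of_sq_lt (by nlinarith)

lemma flux {N : ℕ} (hN : 2 ≤ N) {c : EE N} {κ R m : ℝ} (hκ : κ = 1 ∨ κ = -1) (hm : 0 < m)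
    (hmR : m < R) (hx0 : c + R • e1 N ∈ ball (yc c κ R m) (rc R m)) :
    ∃ c₀ > 0, ∃ k₀ : ℕ, ∀ k : ℕ, k₀ ≤ k →
      c₀ ≤ ∫ x, thK c κ R k x * (bb (yc c κ R m) (rc R m) x * ⟪x - c, e1 N⟫) := by
  have he := norm_e1 hN
  have hR : 0 < R := hm.trans hmR
  have hκκ : κ * κ = 1 := by rcases hκ with rfl | rfl <;> norm_num
  set y := yc c κ R m with hy
  set ρ := rc R m with hρ
  have hρ0 : 0 ≤ ρ := Real.sqrt_nonneg _
  set f : EE N → ℝ := fun x => 2 * max (ρ ^ 2 - ‖x - y‖ ^ 2) 0 * (κ * ⟪x - y, e1 N⟫) with hf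
  have hfc : Continuous f := by rw [hf]; fun_prop
  have hoffm : ∀ x, x ∉ closedBall y ρ → max (ρ ^ 2 - ‖x - y‖ ^ 2) 0 = 0 := by
    intro x hx
    rw [mem_closedBall, dist_eq_norm, not_le] at hx
    exact max_eq_right (by nlinarith)
  have hf0 : ∀ x, x ∉ closedBall y ρ → f x = 0 := by
    intro x hx
    simp only [hf, hoffm x hx, mul_zero, zero_mul]
  have hfpos : ∀ x, 0 ≤ κ * (‖x - c‖ ^ 2 - R ^ 2) → 0 ≤ f x ∧ (x ∈ ball y ρ → 0 < f x) := by
    intro x hx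
    have hin : x ∈ ball y ρ → 0 < f x := by
      intro hb
      rw [mem_ball, dist_eq_norm] at hb
      have hb2 : ‖x - y‖ ^ 2 < ρ ^ 2 := pow_lt_pow_left₀ hb (norm_nonneg _) two_ne_zero
      have := bb_dir hN hκ hm hmR hx hb2
      have h3 : 0 < max (ρ ^ 2 - ‖x - y‖ ^ 2) 0 := lt_max_of_lt_left (by linarith)
      simp only [hf]
      positivity
    refine ⟨?_, hin⟩
    by_cases hb : x ∈ ball y ρ
    · exact (hin hb).le
    · rw [mem_ball, dist_eq_norm, not_lt] at hb
      have : max (ρ ^ 2 - ‖x - y‖ ^ 2) 0 = 0 := max_eq_right (by nlinarith)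
      simp only [hf, this, mul_zero, zero_mul, le_refl]
  have heta0 : ∀ k : ℕ, ∀ x, etaK c κ R k x ≠ 0 → 0 ≤ κ * (‖x - c‖ ^ 2 - R ^ 2) := by
    intro k x hx
    by_contra hh
    push Not at hh
    refine hx ?_
    unfold etaK
    refine (Sc_zero ?_).1
    have := mul_nonpos_of_nonneg_of_nonpos (Nat.cast_nonneg (α := ℝ) k) hh.le
    linarith
  have hnn : ∀ k : ℕ, ∀ x, 0 ≤ etaK c κ R k x * f x := by
    intro k x
    by_cases h0 : etaK c κ R k x = 0
    · rw [h0, zero_mul]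
    · exact mul_nonneg (Sc_facts _).1 (hfpos x (heta0 k x h0)).1
  have hIntg : ∀ k : ℕ, Integrable (fun x => etaK c κ R k x * f x) := fun k =>
    integrable_supp (isCompact_closedBall y ρ)
      ((etaK_C1 c κ R k).continuous.mul hfc).continuousOn fun x hx => by rw [hf0 x hx, mul_zero]
  -- the identity
  have hid : ∀ k : ℕ, ∫ x, thK c κ R k x * (bb y ρ x * ⟪x - c, e1 N⟫) =
      ∫ x, etaK c κ R k x * f x := by
    intro k
    have hC1 : ContDiff ℝ 1 (fun x => etaK c κ R k x * bb y ρ x) := (etaK_C1 c κ R k).mul (bb_C1 y ρ)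
    have hbo : ∀ x, x ∉ closedBall y ρ → bb y ρ x = 0 := fun x hx =>
      bb_off hρ0 fun hh => hx (ball_subset_closedBall hh)
    have hcs : HasCompactSupport (fun x => etaK c κ R k x * bb y ρ x) :=
      HasCompactSupport.intro (isCompact_closedBall y ρ) fun x hx => by rw [hbo x hx, mul_zero]
    have h0 := div_zero_test hC1 hcs (κ • e1 N)
    have hg : ∀ x, ⟪gradient (fun x => etaK c κ R k x * bb y ρ x) x, κ • e1 N⟫ =
        2 * (thK c κ R k x * (bb y ρ x * ⟪x - c, e1 N⟫)) - 2 * (etaK c κ R k x * f x) := by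
      intro x
      rw [(hg_mul (etaK_grad c κ R k x) (bb_grad y ρ x)).gradient, inner_add_left,
        real_inner_smul_left, real_inner_smul_left, real_inner_smul_left, real_inner_smul_left,
        real_inner_smul_right, real_inner_smul_right]
      simp only [hf, thK]
      linear_combination (2 * (k * ScD (k * (κ * (‖x - c‖ ^ 2 - R ^ 2)))) * bb y ρ x *
        ⟪x - c, e1 N⟫) * hκκ
    have i1 : Integrable (fun x => 2 * (thK c κ R k x * (bb y ρ x * ⟪x - c, e1 N⟫))) := by
      have hcc : Continuous (fun x => 2 * (thK c κ R k x * (bb y ρ x * ⟪x - c, e1 N⟫))) := by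
        have := thK_cont c κ R k
        have := (bb_C1 y ρ).continuous
        fun_prop
      exact integrable_supp (isCompact_closedBall y ρ) hcc.continuousOn fun x hx => by
        rw [hbo x hx, zero_mul, mul_zero, mul_zero]
    rw [integral_congr_ae (Filter.Eventually.of_forall hg),
      integral_sub i1 ((hIntg k).const_mul 2), integral_const_mul, integral_const_mul] at h0
    linarith
  -- positivity at a point
  obtain ⟨x₁, hx1, hx1b⟩ : ∃ x₁ : EE N, 0 < κ * (‖x₁ - c‖ ^ 2 - R ^ 2) ∧ x₁ ∈ ball y ρ := by
    have hcont : Continuous (fun t : ℝ => c + (R + t * κ) • e1 N) := by fun_prop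
    have h1 : ∀ᶠ t in 𝓝 (0 : ℝ), c + (R + t * κ) • e1 N ∈ ball y ρ := by
      refine hcont.continuousAt.eventually (isOpen_ball.mem_nhds ?_)
      show c + (R + 0 * κ) • e1 N ∈ ball y ρ
      rw [zero_mul, add_zero]; exact hx0
    have h2 : ∀ᶠ t in 𝓝 (0 : ℝ), t < R := eventually_lt_nhds hR
    obtain ⟨t, ⟨b1, b2⟩, b3⟩ := (((h1.and h2).filter_mono nhdsWithin_le_nhds).and
      (self_mem_nhdsWithin (a := (0 : ℝ)) (s := Ioi 0))).exists
    have b3' : 0 < t := b3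
    refine ⟨_, ?_, b1⟩
    rw [add_sub_cancel_left, norm_smul, he, mul_one, Real.norm_eq_abs, sq_abs]
    rcases hκ with rfl | rfl <;> nlinarith
  obtain ⟨k₀, hk₀⟩ := exists_nat_gt (2 / (κ * (‖x₁ - c‖ ^ 2 - R ^ 2)))
  refine ⟨∫ x, etaK c κ R k₀ x * f x, ?_, k₀, fun k hk => ?_⟩
  · refine Continuous.integral_pos_of_hasCompactSupport_nonneg_nonzero (x := x₁)
      ((etaK_C1 c κ R k₀).continuous.mul hfc) (HasCompactSupport.intro (isCompact_closedBall y ρ)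
        fun x hx => by rw [hf0 x hx, mul_zero]) (hnn k₀) ?_
    have : etaK c κ R k₀ x₁ = 1 := by
      unfold etaK
      refine (Sc_one ?_).1
      rw [div_lt_iff₀ hx1] at hk₀
      exact hk₀.le
    rw [this, one_mul]
    exact ((hfpos x₁ hx1.le).2 hx1b).ne'
  · rw [hid k]
    refine integral_mono (hIntg k₀) (hIntg k) fun x => ?_
    have hmn := etaK_mono c (κ := κ) (R := R) (Nat.cast_nonneg (α := ℝ) k₀)
      (by exact_mod_cast hk : (k₀ : ℝ) ≤ k) x
    by_cases h0 : etaK c κ R k x = 0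
    · have h00 : etaK c κ R k₀ x = 0 := le_antisymm (h0 ▸ hmn) (Sc_facts _).1
      simp only [h0, h00, le_refl]
    · exact mul_le_mul_of_nonneg_right hmn (hfpos x (heta0 k x h0)).1


/-- closed one-sided shell -/
def shl {N : ℕ} (c : EE N) (κ R δ : ℝ) : Set (EE N) :=
  {x | 0 ≤ κ * (‖x - c‖ ^ 2 - R ^ 2) ∧ κ * (‖x - c‖ ^ 2 - R ^ 2) ≤ δ}

lemma shl_compact {N : ℕ} (c : EE N) {κ R δ : ℝ} (hκ : κ = 1 ∨ κ = -1) :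
    IsCompact (shl c κ R δ) := by
  have hf : Continuous (fun x : EE N => κ * (‖x - c‖ ^ 2 - R ^ 2)) := by fun_prop
  have hcl : IsClosed (shl c κ R δ) :=
    (isClosed_le continuous_const hf).inter (isClosed_le hf continuous_const)
  refine (isCompact_closedBall c (1 + R ^ 2 + |δ|)).of_isClosed_subset hcl ?_
  intro x hx
  obtain ⟨h1, h2⟩ := hx
  rw [mem_closedBall, dist_eq_norm]
  have hd := le_abs_self δ
  have hd0 := abs_nonneg δ
  by_contra hh
  push Not at hh
  have : 1 + R ^ 2 + |δ| < ‖x - c‖ ^ 2 := by nlinarith [sq_nonneg R]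
  rcases hκ with rfl | rfl <;> linarith

lemma thK_shl {N : ℕ} {c : EE N} {κ R δ : ℝ} (hδ : 0 < δ) {k : ℕ} (hk : 2 / δ ≤ k) {x : EE N}
    (hx : x ∉ shl c κ R δ) : thK c κ R k x = 0 := by
  by_contra hne
  obtain ⟨a1, a2⟩ := thK_ne hne
  have hk0 : (0 : ℝ) < k := lt_of_lt_of_le (by positivity) hk
  refine hx ⟨?_, ?_⟩
  · by_contra hh
    push Not at hh
    have := mul_nonpos_of_nonneg_of_nonpos hk0.le hh.le
    linarith
  · rw [div_le_iff₀ hδ] at hk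
    by_contra hh
    push Not at hh
    have := mul_lt_mul_of_pos_left hh hk0
    linarith

section fl
variable {N : ℕ} {Ω : Set (EE N)} {c : EE N} {κ R L p lam : ℝ} {u : EE N → ℝ}

lemma Geo.shl_sub (g : Geo Ω c κ R L) : shl c κ R (R * L / 2) ⊆ closure Ω := by
  intro x hx
  obtain ⟨h1, h2⟩ := hx
  have hR := g.R0
  have hL := g.L0
  rcases h1.eq_or_lt with h | h
  · refine g.mem_cl ?_
    have : ‖x - c‖ ^ 2 = R ^ 2 := by
      rcases g.kap with rfl | rfl <;> linarith
    exact (sq_eq_sq₀ (norm_nonneg _) hR.le).1 this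
  · refine subset_closure (g.Q x ((kap_pos_sq (norm_nonneg _) hR).1 h) ?_)
    have h3 := (kap_pos_sq (norm_nonneg _) hR).1 h
    have h4 : κ * (‖x - c‖ ^ 2 - R ^ 2) = κ * (‖x - c‖ - R) * (‖x - c‖ + R) := by ring
    rw [h4] at h2
    have h5 : κ * (‖x - c‖ - R) * R ≤ R * L / 2 := by
      nlinarith [norm_nonneg (x - c)]
    nlinarith

/-- the Hadamard density -/
noncomputable def GH {N : ℕ} (p lam : ℝ) (c : EE N) (u : EE N → ℝ) (x : EE N) : ℝ :=
  (‖gradient u x‖ ^ p - lam * u x ^ p) * ⟪x - c, e1 N⟫ -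
    p * (⟪gradient u x, e1 N⟫ * ⟪Afl p (gradient u x), x - c⟫)

lemma GH_cont (h : USol p lam Ω u) : ContinuousOn (GH p lam c u) (closure Ω) := by
  have h1 := h.cgrad
  have h2 := h.cont
  have hp := h.hp
  have h3 : ContinuousOn (fun x => Afl p (gradient u x)) (closure Ω) :=
    (continuous_Afl hp).comp_continuousOn h1
  have h4 : ContinuousOn (fun x => ‖gradient u x‖ ^ p) (closure Ω) :=
    h1.norm.rpow_const fun x _ => Or.inr (by linarith)
  have h5 : ContinuousOn (fun x => u x ^ p) (closure Ω) :=
    h2.rpow_const fun x _ => Or.inr (by linarith)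
  unfold GH
  refine ((h4.sub (continuousOn_const.mul h5)).mul (by fun_prop)).sub
    (continuousOn_const.mul ((h1.inner continuousOn_const).mul (h3.inner (by fun_prop))))

lemma GH_bd (g : Geo Ω c κ R L) (h : USol p lam Ω u) {x : EE N} (hx : ‖x - c‖ = R) :
    GH p lam c u x = -((p - 1) * ⟪x - c, e1 N⟫ * ‖gradient u x‖ ^ p) := by
  have hR := g.R0
  have hp := h.hp
  have hb := g.bgrad h hx
  unfold GH
  rw [h.zer x (g.fr x hx), Real.zero_rpow (by linarith)]
  set ν := ‖gradient u x‖ with hν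
  have h1 : ⟪gradient u x, e1 N⟫ = κ * ν / R * ⟪x - c, e1 N⟫ := by
    rw [hb, real_inner_smul_left]
  have h2 : ⟪Afl p (gradient u x), x - c⟫ * ν = κ * R * ν ^ p := by
    have h3 := inner_Afl_self hp (gradient u x)
    have h3' : ⟪Afl p (gradient u x), (κ * ν / R) • (x - c)⟫ = ν ^ p := by rw [← hb]; exact h3
    rw [real_inner_smul_right] at h3'
    replace h3 := h3'
    have h4 : κ * ν / R * ⟪Afl p (gradient u x), x - c⟫ * (κ * R) =
      (κ * κ) * (⟪Afl p (gradient u x), x - c⟫ * ν) := by field_simp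
    rw [h3, g.kap_sq, one_mul] at h4
    linarith
  rw [h1]
  have h5 : κ * ν / R * ⟪x - c, e1 N⟫ * ⟪Afl p (gradient u x), x - c⟫ =
      κ / R * ⟪x - c, e1 N⟫ * (⟪Afl p (gradient u x), x - c⟫ * ν) := by ring
  rw [h5, h2]
  have h6 : κ / R * ⟪x - c, e1 N⟫ * (κ * R * ν ^ p) = (κ * κ) * (⟪x - c, e1 N⟫ * ν ^ p) := by
    field_simp
  rw [h6, g.kap_sq]
  ring

lemma bflat (g : Geo Ω c κ R L) (h : USol p lam Ω u)
    (H : ∃ k₀ : ℕ, ∀ k : ℕ, k₀ ≤ k → ∫ x, thK c κ R k x * GH p lam c u x = 0) :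
    ‖gradient u (c - R • e1 N)‖ ≤ ‖gradient u (c + R • e1 N)‖ := by
  have he := norm_e1 g.hN
  have hR := g.R0
  have hL := g.L0
  have hp := h.hp
  by_contra hlt
  push Not at hlt
  set K := shl c κ R (R * L / 2) with hK
  have hKc : IsCompact K := shl_compact c g.kap
  have hKcl : K ⊆ closure Ω := g.shl_sub
  have hKs : ∀ x ∈ K, sig c (e1 N) x ∈ K := by
    intro x hx
    simp only [hK, shl, Set.mem_ofPred_eq, norm_sig_sub] at hx ⊢
    exact hx
  set G := GH p lam c u with hG
  have hGc : ContinuousOn G K := (GH_cont h).mono hKcl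
  set G2 : EE N → ℝ := fun x => G x + G (sig c (e1 N) x) with hG2
  have hG2c : ContinuousOn G2 K :=
    hGc.add (hGc.comp (sig_cont c (e1 N)).continuousOn hKs)
  have hG2S : ∀ x, ‖x - c‖ = R → G2 x = (p - 1) * ⟪x - c, e1 N⟫ *
      (‖gradient u (sig c (e1 N) x)‖ ^ p - ‖gradient u x‖ ^ p) := by
    intro x hx
    simp only [hG2, hG]
    rw [GH_bd g h hx, GH_bd g h (x := sig c (e1 N) x) (by rw [norm_sig_sub, hx]), inner_sig he]
    ring
  have hG2nn : ∀ x, ‖x - c‖ = R → 0 ≤ G2 x := by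
    intro x hx
    rw [hG2S x hx]
    have hx' : ‖sig c (e1 N) x - c‖ = R := by rw [norm_sig_sub, hx]
    have hi := inner_sig (c := c) he x
    rcases lt_trichotomy 0 ⟪x - c, e1 N⟫ with h1 | h1 | h1
    · have := g.bmon h hx hx' (by linarith)
      have := Real.rpow_le_rpow (norm_nonneg _) this (by linarith : 0 ≤ p)
      exact mul_nonneg (mul_nonneg (by linarith) h1.le) (by linarith)
    · rw [← h1, mul_zero, zero_mul]
    · have := g.bmon h hx' hx (by linarith)
      have := Real.rpow_le_rpow (norm_nonneg _) this (by linarith : 0 ≤ p)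
      exact mul_nonneg_of_nonpos_of_nonpos (mul_nonpos_of_nonneg_of_nonpos (by linarith) h1.le)
        (by linarith)
  set x0 := c + R • e1 N with hx0
  have hx0c : ‖x0 - c‖ = R := by
    rw [hx0, add_sub_cancel_left, norm_smul, he, mul_one, Real.norm_of_nonneg hR.le]
  have hx01 : ⟪x0 - c, e1 N⟫ = R := by
    rw [hx0, add_sub_cancel_left, real_inner_smul_left, real_inner_self_eq_norm_sq, he]; ring
  have hsx0 : sig c (e1 N) x0 = c - R • e1 N := by
    rw [sig_apply he, hx01, hx0, mul_smul, two_smul]; abel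
  have hx0K : x0 ∈ K := by
    simp only [hK, shl, Set.mem_ofPred_eq, hx0c, sub_self, mul_zero, le_refl, true_and]
    positivity
  have hG20 : 0 < G2 x0 := by
    rw [hG2S x0 hx0c, hx01, hsx0]
    have := Real.rpow_lt_rpow (norm_nonneg _) hlt (by linarith : 0 < p)
    exact mul_pos (mul_pos (by linarith) hR) (by linarith)
  -- a neighbourhood where G2 is large
  obtain ⟨r, hr, hrG⟩ : ∃ r > 0, ∀ x ∈ K, x ∈ ball x0 r → G2 x0 / 2 ≤ G2 x := by
    have := (hG2c x0 hx0K).eventually (lt_mem_nhds (half_lt_self hG20))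
    rw [eventually_nhdsWithin_iff, Metric.eventually_nhds_iff_ball] at this
    obtain ⟨r, hr, hh⟩ := this
    exact ⟨r, hr, fun x hx hxb => (hh x hxb hx).le⟩
  obtain ⟨m, hm, hmR, hsub, hxin⟩ := ball_yc g.hN (c := c) g.kap hR hr
  obtain ⟨c₀, hc₀, k₁, hk₁⟩ := flux g.hN g.kap hm hmR hxin
  obtain ⟨k₂, hk₂⟩ := H
  set y := yc c κ R m with hy
  set ρ := rc R m with hρ
  have hρ0 : 0 ≤ ρ := Real.sqrt_nonneg _
  set q : EE N → ℝ := fun x => bb y ρ x * ⟪x - c, e1 N⟫ with hq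
  have hqc : Continuous q := by
    have := (bb_C1 y ρ).continuous
    rw [hq]; fun_prop
  obtain ⟨M, hM⟩ := (hKc.bddAbove_image hqc.continuousOn)
  have hM' : ∀ x ∈ K, q x ≤ |M| + 1 := fun x hx =>
    (hM (mem_image_of_mem q hx)).trans (by linarith [le_abs_self M])
  set δ := G2 x0 / 2 / (|M| + 1) with hδ
  have hM0 : 0 < |M| + 1 := by positivity
  have hδ0 : 0 < δ := by positivity
  set hh : EE N → ℝ := fun x => min (G2 x - δ * q x) 0 with hhh
  have hhc : ContinuousOn hh K :=
    ContinuousOn.inf (hG2c.sub (continuousOn_const.mul hqc.continuousOn)) continuousOn_const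
  have hh0 : ∀ x ∈ K, ‖x - c‖ = R → hh x = 0 := by
    intro x hx hxR
    refine min_eq_right ?_
    by_cases hb : x ∈ ball y ρ
    · have h1 := hrG x hx (hsub (ball_subset_closedBall hb))
      have h2 : δ * q x ≤ G2 x0 / 2 := by
        calc δ * q x ≤ δ * (|M| + 1) := mul_le_mul_of_nonneg_left (hM' x hx) hδ0.le
          _ = G2 x0 / 2 := by rw [hδ]; field_simp
      linarith
    · simp only [hq, bb_off hρ0 hb, zero_mul, mul_zero, sub_zero]
      exact hG2nn x hxR
  have hlim := shell_tendsto c g.kap hR hKc hhc hh0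
  have hev : ∀ᶠ k : ℕ in atTop, ∫ x in K, thK c κ R k x * |hh x| < δ * c₀ :=
    hlim.eventually (gt_mem_nhds (by positivity))
  obtain ⟨k₃, hk₃⟩ := exists_nat_ge (2 / (R * L / 2))
  obtain ⟨k, hk, hkk1, hkk2, hkk3⟩ := (hev.and ((eventually_ge_atTop k₁).and
    ((eventually_ge_atTop k₂).and (eventually_ge_atTop k₃)))).exists
  have hkδ : 2 / (R * L / 2) ≤ k := hk₃.trans (by exact_mod_cast hkk3)
  have hoff : ∀ x, x ∉ K → thK c κ R k x = 0 := fun x hx => thK_shl (by positivity) hkδ hx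
  have hthc : ContinuousOn (thK c κ R k) K := (thK_cont c κ R k).continuousOn
  have iG : Integrable (fun x => thK c κ R k x * G x) :=
    integrable_supp hKc (hthc.mul hGc) fun x hx => by rw [hoff x hx, zero_mul]
  have iG' : Integrable (fun x => thK c κ R k x * G (sig c (e1 N) x)) :=
    integrable_supp hKc (hthc.mul (hGc.comp (sig_cont c (e1 N)).continuousOn hKs)) fun x hx => by
      rw [hoff x hx, zero_mul]
  have z1 : ∫ x, thK c κ R k x * G x = 0 := hk₂ k hkk2
  have z2 : ∫ x, thK c κ R k x * G (sig c (e1 N) x) = 0 := by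
    rw [← z1, ← integral_sig c (e1 N) (fun x => thK c κ R k x * G x)]
    refine integral_congr_ae (Filter.Eventually.of_forall fun x => ?_)
    simp only [thK, norm_sig_sub]
  have iq : Integrable (fun x => thK c κ R k x * q x) :=
    integrable_supp hKc (hthc.mul hqc.continuousOn) fun x hx => by rw [hoff x hx, zero_mul]
  have ih : Integrable (fun x => thK c κ R k x * |hh x|) :=
    integrable_supp hKc (hthc.mul hhc.abs) fun x hx => by rw [hoff x hx, zero_mul]
  have hset : ∫ x in K, thK c κ R k x * |hh x| = ∫ x, thK c κ R k x * |hh x| :=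
    setIntegral_test fun x hx => by rw [hoff x hx, zero_mul]
  have hineq : ∫ x, δ * (thK c κ R k x * q x) ≤
      ∫ x, (thK c κ R k x * G x + thK c κ R k x * G (sig c (e1 N) x)) + thK c κ R k x * |hh x| := by
    refine integral_mono (iq.const_mul δ) ((iG.add iG').add ih) fun x => ?_
    have hth := thK_nonneg c κ R (Nat.cast_nonneg (α := ℝ) k) x
    have h1 : δ * q x ≤ G2 x + |hh x| := by
      have h2 := neg_abs_le (hh x)
      have h3 : hh x ≤ G2 x - δ * q x := min_le_left _ _
      linarith
    have h4 := mul_le_mul_of_nonneg_left h1 hth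
    simp only [hG2] at h4
    simp only
    linarith
  rw [integral_const_mul] at hineq
  have hsplit : ∫ x, (thK c κ R k x * G x + thK c κ R k x * G (sig c (e1 N) x)) +
      thK c κ R k x * |hh x| = 0 + ∫ x, thK c κ R k x * |hh x| := by
    have iGG : Integrable (fun x => thK c κ R k x * G x + thK c κ R k x * G (sig c (e1 N) x)) :=
      iG.add iG'
    rw [integral_add iGG ih, integral_add iG iG', z1, z2, add_zero]
  rw [hsplit, zero_add, ← hset] at hineq
  have := mul_le_mul_of_nonneg_left (hk₁ k hkk1) hδ0.le
  linarith

end fl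


section flS
variable {N : ℕ} {Ω : Set (EE N)} {c : EE N} {κ R L p lam : ℝ} {u : EE N → ℝ}

lemma inner_lt_top {N : ℕ} (hN : 2 ≤ N) {R : ℝ} {v : EE N} (hv : ‖v‖ = R)
    (hne : v ≠ R • e1 N) : ⟪v, e1 N⟫ < R := by
  have he := norm_e1 hN
  have h1 := real_inner_le_norm v (e1 N)
  rw [hv, he, mul_one] at h1
  refine lt_of_le_of_ne h1 fun heq => hne ?_
  have h2 : ⟪v, e1 N⟫ = ‖v‖ * ‖e1 N‖ := by rw [heq, hv, he, mul_one]
  rw [inner_eq_norm_mul_iff_real, he, hv, one_smul] at h2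
  exact h2

lemma flatS (g : Geo Ω c κ R L) (h : USol p lam Ω u)
    (hf : ‖gradient u (c - R • e1 N)‖ ≤ ‖gradient u (c + R • e1 N)‖) {x : EE N}
    (hx : ‖x - c‖ = R) : ‖gradient u x‖ = ‖gradient u (c + R • e1 N)‖ := by
  have he := norm_e1 g.hN
  have hR := g.R0
  have n1 : ‖c + R • e1 N - c‖ = R := by
    rw [add_sub_cancel_left, norm_smul, he, mul_one, Real.norm_of_nonneg hR.le]
  have n2 : ‖c - R • e1 N - c‖ = R := by
    rw [sub_sub_cancel_left, norm_neg, norm_smul, he, mul_one, Real.norm_of_nonneg hR.le]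
  have i1 : ⟪c + R • e1 N - c, e1 N⟫ = R := by
    rw [add_sub_cancel_left, real_inner_smul_left, real_inner_self_eq_norm_sq, he]; ring
  have i2 : ⟪c - R • e1 N - c, e1 N⟫ = -R := by
    rw [sub_sub_cancel_left, inner_neg_left, real_inner_smul_left, real_inner_self_eq_norm_sq, he]; ring
  by_cases h1 : x - c = R • e1 N
  · have : x = c + R • e1 N := by rw [← h1]; abel
    rw [this]
  have a1 := g.bmon h n1 hx (by rw [i1]; exact inner_lt_top g.hN hx h1)
  by_cases h2 : -(x - c) = R • e1 N
  · have : x = c - R • e1 N := by rw [← h2]; abel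
    rw [this] at a1 ⊢
    exact le_antisymm hf a1
  have a2 := g.bmon h hx n2 (by
    rw [i2]
    have := inner_lt_top g.hN (v := -(x - c)) (by rw [norm_neg, hx]) h2
    rw [inner_neg_left] at this
    linarith)
  exact le_antisymm (a2.trans hf) a1

lemma Geo.thK_mem (g : Geo Ω c κ R L) {k : ℕ} (hk : 2 / (R * L / 2) ≤ k) {x : EE N}
    (hx : x ∉ Ω) : thK c κ R k x = 0 := by
  have hR := g.R0
  have hL := g.L0
  by_contra hne
  obtain ⟨a1, a2⟩ := thK_ne hne
  have hs : x ∈ shl c κ R (R * L / 2) := by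
    by_contra hh
    exact hne (thK_shl (by positivity) hk hh)
  have hk0 : (0 : ℝ) < k := lt_of_lt_of_le (by positivity) hk
  have hpos : 0 < κ * (‖x - c‖ ^ 2 - R ^ 2) := by
    by_contra hh
    push Not at hh
    have := mul_nonpos_of_nonneg_of_nonpos hk0.le hh
    linarith
  have h3 := (kap_pos_sq (norm_nonneg _) hR).1 hpos
  refine hx (g.Q x h3 ?_)
  have h2 := hs.2
  have h4 : κ * (‖x - c‖ ^ 2 - R ^ 2) = κ * (‖x - c‖ - R) * (‖x - c‖ + R) := by ring
  rw [h4] at h2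
  have h5 : κ * (‖x - c‖ - R) * R ≤ R * L / 2 := by
    nlinarith [norm_nonneg (x - c)]
  nlinarith

end flS

section om
variable {N : ℕ} {R₀ R₁ s : ℝ}

lemma fr_inner (hR₀ : 0 < R₀) (hs : 0 < s) (hs' : s < R₁ - R₀) (hN : 2 ≤ N) {x : EE N}
    (hx : ‖x - s • e1 N‖ = R₀) : x ∈ frontier (Om N R₀ R₁ s) := by
  have he := norm_e1 hN
  rw [(Om_open N R₀ R₁ s).frontier_eq]
  refine ⟨?_, fun hh => ?_⟩
  · have hc : Continuous (fun t : ℝ => x + t • (x - s • e1 N)) := by fun_prop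
    have hlim : Tendsto (fun t : ℝ => x + t • (x - s • e1 N)) (𝓝[>] 0) (𝓝 x) := by
      have := hc.tendsto 0
      rw [zero_smul, add_zero] at this
      exact this.mono_left nhdsWithin_le_nhds
    refine mem_closure_of_tendsto hlim ?_
    have hn : ‖x‖ < R₁ := by
      have : x = (x - s • e1 N) + s • e1 N := by abel
      rw [this]
      refine (norm_add_le _ _).trans_lt ?_
      rw [hx, norm_smul, he, mul_one, Real.norm_of_nonneg hs.le]; linarith
    have h2 : ∀ᶠ t in 𝓝[>] (0 : ℝ), ‖x + t • (x - s • e1 N)‖ < R₁ :=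
      hlim.norm.eventually (gt_mem_nhds hn)
    filter_upwards [h2, self_mem_nhdsWithin] with t h2 ht
    have ht' : 0 < t := ht
    rw [mem_Om hR₀]
    refine ⟨h2, ?_⟩
    have : x + t • (x - s • e1 N) - s • e1 N = (1 + t) • (x - s • e1 N) := by
      rw [add_smul, one_smul]; abel
    rw [this, norm_smul, hx, Real.norm_of_nonneg (by positivity)]
    nlinarith
  · rw [mem_Om hR₀, hx] at hh
    exact lt_irrefl _ hh.2

lemma fr_outer (hR₀ : 0 < R₀) (hs : 0 < s) (hs' : s < R₁ - R₀) (hN : 2 ≤ N) {x : EE N}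
    (hx : ‖x‖ = R₁) : x ∈ frontier (Om N R₀ R₁ s) := by
  have he := norm_e1 hN
  rw [(Om_open N R₀ R₁ s).frontier_eq]
  refine ⟨?_, fun hh => ?_⟩
  · have hc : Continuous (fun t : ℝ => (1 - t) • x) := by fun_prop
    have hlim : Tendsto (fun t : ℝ => (1 - t) • x) (𝓝[>] 0) (𝓝 x) := by
      have := hc.tendsto 0
      rw [sub_zero, one_smul] at this
      exact this.mono_left nhdsWithin_le_nhds
    refine mem_closure_of_tendsto hlim ?_
    have hn : R₀ < ‖x - s • e1 N‖ := by
      have := norm_sub_norm_le x (s • e1 N)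
      rw [hx, norm_smul, he, mul_one, Real.norm_of_nonneg hs.le] at this
      linarith
    have h2 : ∀ᶠ t in 𝓝[>] (0 : ℝ), R₀ < ‖(1 - t) • x - s • e1 N‖ :=
      (hlim.sub_const _).norm.eventually (lt_mem_nhds hn)
    have h3 : ∀ᶠ t in 𝓝[>] (0 : ℝ), t < 1 :=
      (eventually_lt_nhds one_pos).filter_mono nhdsWithin_le_nhds
    filter_upwards [h2, h3, self_mem_nhdsWithin] with t h2 h3 ht
    have ht' : 0 < t := ht
    rw [mem_Om hR₀]
    refine ⟨?_, h2⟩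
    rw [norm_smul, hx, Real.norm_of_nonneg (by linarith)]
    nlinarith
  · rw [mem_Om hR₀, hx] at hh
    exact lt_irrefl _ hh.1

lemma geo_inner (hN : 2 ≤ N) (hR₀ : 0 < R₀) (hs : 0 < s) (hs' : s < R₁ - R₀) :
    Geo (Om N R₀ R₁ s) (s • e1 N) 1 R₀ (R₁ - R₀ - s) := by
  have he := norm_e1 hN
  have hse : ‖s • e1 N‖ = s := by rw [norm_smul, he, mul_one, Real.norm_of_nonneg hs.le]
  refine ⟨hN, Or.inl rfl, hR₀, by linarith, by linarith, ?_, ?_, ?_, ?_, ?_, ?_⟩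
  · intro x hx y hxy hin
    rw [mem_Om hR₀] at hx ⊢
    refine ⟨lt_of_le_of_lt ?_ hx.1, by rw [hxy]; exact hx.2⟩
    have e : ∀ z : EE N, ‖z‖ ^ 2 = ‖z - s • e1 N‖ ^ 2 + 2 * (s * ⟪z - s • e1 N, e1 N⟫) + s ^ 2 := by
      intro z
      have : z = (z - s • e1 N) + s • e1 N := by abel
      conv_lhs => rw [this, norm_add_sq_real, real_inner_smul_right, hse]
    have h1 := e x
    have h2 := e y
    rw [hxy] at h2
    have : ‖y‖ ^ 2 ≤ ‖x‖ ^ 2 := by rw [h1, h2]; nlinarith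
    exact (sq_le_sq₀ (norm_nonneg _) (norm_nonneg _)).1 this
  · intro x h1 h2
    rw [mem_Om hR₀]
    refine ⟨?_, by linarith⟩
    have := norm_sub_norm_le x (s • e1 N)
    rw [hse] at this
    linarith
  · intro x hx
    rw [mem_Om hR₀] at hx
    linarith [hx.2]
  · intro x hx
    exact fr_inner hR₀ hs hs' hN hx
  · refine fr_outer hR₀ hs hs' hN ?_
    rw [← add_smul, norm_smul, he, mul_one, Real.norm_of_nonneg (by linarith)]; ring
  · rw [mem_Om hR₀]
    constructor
    · rw [← sub_smul, norm_smul, he, mul_one, Real.norm_eq_abs, abs_lt]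
      constructor <;> linarith
    · rw [sub_sub_cancel_left, norm_neg, norm_smul, he, mul_one, Real.norm_of_nonneg (by linarith)]
      linarith

lemma geo_outer (hN : 2 ≤ N) (hR₀ : 0 < R₀) (hs : 0 < s) (hs' : s < R₁ - R₀) :
    Geo (Om N R₀ R₁ s) (0 : EE N) (-1) R₁ (R₁ - R₀ - s) := by
  have he := norm_e1 hN
  have hse : ‖s • e1 N‖ = s := by rw [norm_smul, he, mul_one, Real.norm_of_nonneg hs.le]
  have hcoef : R₁ + -1 * (R₁ - R₀ - s) = R₀ + s := by ring
  refine ⟨hN, Or.inr rfl, by linarith, by linarith, by linarith, ?_, ?_, ?_, ?_, ?_, ?_⟩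
  · intro x hx y hxy hin
    rw [sub_zero, sub_zero] at hxy hin
    rw [mem_Om hR₀] at hx ⊢
    refine ⟨by rw [hxy]; exact hx.1, lt_of_lt_of_le hx.2 ?_⟩
    have e : ∀ z : EE N, ‖z - s • e1 N‖ ^ 2 = ‖z‖ ^ 2 - 2 * (s * ⟪z, e1 N⟫) + s ^ 2 := by
      intro z
      rw [@norm_sub_sq_real, real_inner_smul_right, hse]
    have h1 := e x
    have h2 := e y
    rw [hxy] at h2
    have : ‖x - s • e1 N‖ ^ 2 ≤ ‖y - s • e1 N‖ ^ 2 := by rw [h1, h2]; nlinarith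
    exact (sq_le_sq₀ (norm_nonneg _) (norm_nonneg _)).1 this
  · intro x h1 h2
    rw [sub_zero] at h1 h2
    rw [mem_Om hR₀]
    refine ⟨by linarith, ?_⟩
    have := norm_sub_norm_le x (s • e1 N)
    rw [hse] at this
    linarith
  · intro x hx
    rw [mem_Om hR₀] at hx
    rw [sub_zero]
    linarith [hx.1]
  · intro x hx
    rw [sub_zero] at hx
    exact fr_outer hR₀ hs hs' hN hx
  · rw [hcoef]
    refine fr_inner hR₀ hs hs' hN ?_
    rw [zero_add, ← sub_smul, norm_smul, he, mul_one, Real.norm_of_nonneg (by linarith)]; ring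
  · rw [hcoef, mem_Om hR₀, zero_sub]
    constructor
    · rw [norm_neg, norm_smul, he, mul_one, Real.norm_of_nonneg (by linarith)]
      linarith
    · rw [← neg_smul, ← sub_smul, norm_smul, he, mul_one, Real.norm_eq_abs, abs_of_nonpos (by linarith)]
      linarith

lemma had_H (hR₀ : 0 < R₀) {p : ℝ} {u : EE N → ℝ}
    (h : USol p (lam1 p (Om N R₀ R₁ s)) (Om N R₀ R₁ s) u)
    (hd : HasDerivAt (fun t : ℝ => lam1 p (Om N R₀ R₁ t)) 0 s) {c : EE N} {κ R L : ℝ}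
    (g : Geo (Om N R₀ R₁ s) c κ R L) (a b : ℝ) (hb : b ≠ 0) {k₁ : ℕ}
    (h1 : ∀ k : ℕ, k₁ ≤ k → ∀ x, ‖x - s • e1 N‖ ≤ R₀ → a + b * etaK c κ R k x = 1)
    (h0 : ∀ k : ℕ, k₁ ≤ k → ∀ x, R₁ ≤ ‖x‖ → a + b * etaK c κ R k x = 0) :
    ∃ k₀ : ℕ, ∀ k : ℕ, k₀ ≤ k →
      ∫ x, thK c κ R k x * GH p (lam1 p (Om N R₀ R₁ s)) c u x = 0 := by
  obtain ⟨k₃, hk₃⟩ := exists_nat_ge (2 / (R * L / 2))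
  refine ⟨max k₁ k₃, fun k hk => ?_⟩
  have hkδ : 2 / (R * L / 2) ≤ k := hk₃.trans (by exact_mod_cast (le_max_right _ _).trans hk)
  have hη : ContDiff ℝ 1 (fun x => a + b * etaK c κ R k x) :=
    contDiff_const.add (contDiff_const.mul (etaK_C1 c κ R k))
  have hgr : ∀ x, gradient (fun x => a + b * etaK c κ R k x) x =
      (2 * b * κ * thK c κ R k x) • (x - c) := by
    intro x
    have := hg_add_const (hg_comp ((hasDerivAt_id (etaK c κ R k x)).const_mul b)
      (etaK_grad c κ R k x)) a
    have e : (fun y => b * id (etaK c κ R k y) + a) = (fun x => a + b * etaK c κ R k x) := by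
      funext y; simp only [id]; ring
    rw [e] at this
    rw [this.gradient, smul_smul, thK]
    congr 1; ring
  have key := hadamard g.hN hR₀ h hd hη (h1 k ((le_max_left _ _).trans hk))
    (h0 k ((le_max_left _ _).trans hk))
  have e2 : ∀ x, ((‖gradient u x‖ ^ p - lam1 p (Om N R₀ R₁ s) * u x ^ p) *
      ⟪gradient (fun x => a + b * etaK c κ R k x) x, e1 N⟫ - p * (⟪gradient u x, e1 N⟫ *
        ⟪Afl p (gradient u x), gradient (fun x => a + b * etaK c κ R k x) x⟫)) =
      (2 * b * κ) * (thK c κ R k x * GH p (lam1 p (Om N R₀ R₁ s)) c u x) := by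
    intro x
    rw [hgr, real_inner_smul_left, real_inner_smul_right, GH]
    ring
  rw [setIntegral_congr_fun (Om_open N R₀ R₁ s).measurableSet (fun x _ => e2 x),
    integral_const_mul] at key
  have hκ0 : κ ≠ 0 := by rcases g.kap with h | h <;> rw [h] <;> norm_num
  have := (mul_eq_zero.1 key).resolve_left (by positivity)
  rw [setIntegral_test] at this
  · exact this
  · intro x hx
    rw [g.thK_mem hkδ hx, zero_mul]

lemma H_inner (hN : 2 ≤ N) (hR₀ : 0 < R₀) (hs : 0 < s) (hs' : s < R₁ - R₀) {p : ℝ} {u : EE N → ℝ}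
    (h : USol p (lam1 p (Om N R₀ R₁ s)) (Om N R₀ R₁ s) u)
    (hd : HasDerivAt (fun t : ℝ => lam1 p (Om N R₀ R₁ t)) 0 s) :
    ∃ k₀ : ℕ, ∀ k : ℕ, k₀ ≤ k →
      ∫ x, thK (s • e1 N) 1 R₀ k x * GH p (lam1 p (Om N R₀ R₁ s)) (s • e1 N) u x = 0 := by
  have he := norm_e1 hN
  have hse : ‖s • e1 N‖ = s := by rw [norm_smul, he, mul_one, Real.norm_of_nonneg hs.le]
  obtain ⟨k₁, hk₁⟩ := exists_nat_ge (2 / ((R₁ - s) ^ 2 - R₀ ^ 2))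
  have hpos : 0 < (R₁ - s) ^ 2 - R₀ ^ 2 := by nlinarith
  refine had_H hR₀ h hd (geo_inner hN hR₀ hs hs') 1 (-1) (by norm_num) (k₁ := k₁) ?_ ?_
  · intro k _ x hx
    have : etaK (s • e1 N) 1 R₀ k x = 0 := by
      refine (Sc_zero ?_).1
      have : 1 * (‖x - s • e1 N‖ ^ 2 - R₀ ^ 2) ≤ 0 := by nlinarith [norm_nonneg (x - s • e1 N)]
      linarith [mul_nonpos_of_nonneg_of_nonpos (Nat.cast_nonneg (α := ℝ) k) this]
    rw [this]; ring
  · intro k hk x hx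
    have : etaK (s • e1 N) 1 R₀ k x = 1 := by
      refine (Sc_one ?_).1
      have h2 := norm_sub_norm_le x (s • e1 N)
      rw [hse] at h2
      have h3 : (R₁ - s) ^ 2 - R₀ ^ 2 ≤ 1 * (‖x - s • e1 N‖ ^ 2 - R₀ ^ 2) := by nlinarith
      have hkk : 2 / ((R₁ - s) ^ 2 - R₀ ^ 2) ≤ k := hk₁.trans (by exact_mod_cast hk)
      rw [div_le_iff₀ hpos] at hkk
      exact hkk.trans (mul_le_mul_of_nonneg_left h3 (Nat.cast_nonneg k))
    rw [this]; ring

lemma H_outer (hN : 2 ≤ N) (hR₀ : 0 < R₀) (hs : 0 < s) (hs' : s < R₁ - R₀) {p : ℝ} {u : EE N → ℝ}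
    (h : USol p (lam1 p (Om N R₀ R₁ s)) (Om N R₀ R₁ s) u)
    (hd : HasDerivAt (fun t : ℝ => lam1 p (Om N R₀ R₁ t)) 0 s) :
    ∃ k₀ : ℕ, ∀ k : ℕ, k₀ ≤ k →
      ∫ x, thK (0 : EE N) (-1) R₁ k x * GH p (lam1 p (Om N R₀ R₁ s)) 0 u x = 0 := by
  have he := norm_e1 hN
  have hse : ‖s • e1 N‖ = s := by rw [norm_smul, he, mul_one, Real.norm_of_nonneg hs.le]
  obtain ⟨k₁, hk₁⟩ := exists_nat_ge (2 / (R₁ ^ 2 - (R₀ + s) ^ 2))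
  have hpos : 0 < R₁ ^ 2 - (R₀ + s) ^ 2 := by nlinarith
  refine had_H hR₀ h hd (geo_outer hN hR₀ hs hs') 0 1 (by norm_num) (k₁ := k₁) ?_ ?_
  · intro k hk x hx
    have : etaK (0 : EE N) (-1) R₁ k x = 1 := by
      refine (Sc_one ?_).1
      have h2 := norm_sub_norm_le x (s • e1 N)
      rw [hse] at h2
      have h3 : R₁ ^ 2 - (R₀ + s) ^ 2 ≤ -1 * (‖x - 0‖ ^ 2 - R₁ ^ 2) := by
        rw [sub_zero]; nlinarith [norm_nonneg x]
      have hkk : 2 / (R₁ ^ 2 - (R₀ + s) ^ 2) ≤ k := hk₁.trans (by exact_mod_cast hk)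
      rw [div_le_iff₀ hpos] at hkk
      exact hkk.trans (mul_le_mul_of_nonneg_left h3 (Nat.cast_nonneg k))
    rw [this]; ring
  · intro k _ x hx
    have : etaK (0 : EE N) (-1) R₁ k x = 0 := by
      refine (Sc_zero ?_).1
      have : -1 * (‖x - 0‖ ^ 2 - R₁ ^ 2) ≤ 0 := by
        rw [sub_zero]; nlinarith [norm_nonneg x]
      linarith [mul_nonpos_of_nonneg_of_nonpos (Nat.cast_nonneg (α := ℝ) k) this]
    rw [this]; ring

end om


def Ep {N : ℕ} (c : EE N) (κ R ρ : ℝ) : Set (EE N) :=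
  {x | x ∈ ball (c + R • e1 N) ρ ∧ 0 < κ * (‖x - c‖ ^ 2 - R ^ 2)}

def Dp {N : ℕ} (c : EE N) (κ R ρ : ℝ) : Set (EE N) :=
  {x | x ∈ ball (c + R • e1 N) ρ ∧ 0 ≤ κ * (‖x - c‖ ^ 2 - R ^ 2)}

lemma Ep_open {N : ℕ} (c : EE N) (κ R ρ : ℝ) : IsOpen (Ep c κ R ρ) := by
  have hf : Continuous (fun x : EE N => κ * (‖x - c‖ ^ 2 - R ^ 2)) := by fun_prop
  exact isOpen_ball.inter (isOpen_lt continuous_const hf)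

/-- data for the strong maximum principle with vanishing Cauchy data on a sphere -/
structure Smp {N : ℕ} (c : EE N) (κ R ρ q c0 C : ℝ) (z : EE N → ℝ) (F : EE N → EE N) : Prop where
  hN : 2 ≤ N
  kap : κ = 1 ∨ κ = -1
  R0 : 0 < R
  rho0 : 0 < ρ
  q1 : 1 < q
  c00 : 0 < c0
  C0 : 0 < C
  zC : ContDiffOn ℝ 1 z (Ep c κ R ρ)
  znn : ∀ x ∈ Ep c κ R ρ, 0 ≤ z x
  zc : ContinuousOn z (Dp c κ R ρ)
  Fc : ContinuousOn F (Dp c κ R ρ)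
  z0 : ∀ x ∈ Dp c κ R ρ, ‖x - c‖ = R → z x = 0
  F0 : ∀ x ∈ Dp c κ R ρ, ‖x - c‖ = R → F x = 0
  ell : ∀ x ∈ Ep c κ R ρ, c0 * ‖gradient z x‖ ^ q ≤ ⟪F x, gradient z x⟫ ∧
    ‖F x‖ ≤ C * ‖gradient z x‖ ^ (q - 1)
  weak : ∀ φ : EE N → ℝ, ContDiff ℝ 1 φ → HasCompactSupport φ → tsupport φ ⊆ Ep c κ R ρ →
    (∀ x, 0 ≤ φ x) → 0 ≤ ∫ x, ⟪F x, gradient φ x⟫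

lemma young_T {q a b : ℝ} (hq : 1 < q) (ha : 0 < a) (hb : 0 ≤ b) :
    ∃ C > 0, ∀ T, 0 ≤ T → T + b * T ^ (q - 1) ≤ a * T ^ q + C := by
  set T0 := max (2 * b / a) ((2 / a) ^ (1 / (q - 1))) with hT0
  have hT00 : 0 < T0 := lt_max_of_lt_right (by positivity)
  refine ⟨T0 + b * T0 ^ (q - 1) , by positivity, fun T hT => ?_⟩
  rcases le_total T T0 with h | h
  · have h1 : T ^ (q - 1) ≤ T0 ^ (q - 1) := Real.rpow_le_rpow hT h (by linarith)
    have h2 : 0 ≤ a * T ^ q := by positivity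
    have := mul_le_mul_of_nonneg_left h1 hb
    linarith
  · have hTp : 0 < T := lt_of_lt_of_le hT00 h
    have e : T ^ q = T * T ^ (q - 1) := by
      have := Real.rpow_add hTp 1 (q - 1)
      rw [Real.rpow_one] at this
      rw [← this]
      congr 1; ring
    have h1 : 2 * b ≤ a * T := by
      have : 2 * b / a ≤ T := (le_max_left _ _).trans h
      rw [div_le_iff₀ ha] at this
      linarith
    have h2 : 2 ≤ a * T ^ (q - 1) := by
      have h3 : (2 / a) ^ (1 / (q - 1)) ≤ T := (le_max_right _ _).trans h
      have h4 := Real.rpow_le_rpow (by positivity) h3 (by linarith : 0 ≤ q - 1)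
      rw [← Real.rpow_mul (by positivity), one_div_mul_cancel (by linarith), Real.rpow_one,
        div_le_iff₀ ha] at h4
      linarith
    have h5 : 0 ≤ T ^ (q - 1) := by positivity
    have h6 : 0 ≤ T0 + b * T0 ^ (q - 1) := by positivity
    rw [e]
    nlinarith

section smp
variable {N : ℕ} {c : EE N} {κ R ρ q c0 C : ℝ} {z : EE N → ℝ} {F : EE N → EE N}

/-- compact sets -/
def KD {N : ℕ} (c : EE N) (κ R r : ℝ) : Set (EE N) :=
  {x | x ∈ closedBall (c + R • e1 N) r ∧ 0 ≤ κ * (‖x - c‖ ^ 2 - R ^ 2)}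

def KE {N : ℕ} (c : EE N) (κ R r k : ℝ) : Set (EE N) :=
  {x | x ∈ closedBall (c + R • e1 N) r ∧ 1 ≤ k * (κ * (‖x - c‖ ^ 2 - R ^ 2))}

lemma KD_compact {N : ℕ} (c : EE N) (κ R r : ℝ) : IsCompact (KD c κ R r) := by
  have hf : Continuous (fun x : EE N => κ * (‖x - c‖ ^ 2 - R ^ 2)) := by fun_prop
  exact (isCompact_closedBall _ r).inter_right (isClosed_le continuous_const hf)

lemma KE_compact {N : ℕ} (c : EE N) (κ R r k : ℝ) : IsCompact (KE c κ R r k) := by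
  have hf : Continuous (fun x : EE N => k * (κ * (‖x - c‖ ^ 2 - R ^ 2))) := by fun_prop
  exact (isCompact_closedBall _ r).inter_right (isClosed_le continuous_const hf)

lemma KD_sub {N : ℕ} (c : EE N) (κ R : ℝ) {r ρ : ℝ} (hr : r < ρ) : KD c κ R r ⊆ Dp c κ R ρ :=
  fun _ hx => ⟨closedBall_subset_ball hr hx.1, hx.2⟩

lemma KE_sub {N : ℕ} (c : EE N) (κ R : ℝ) {r ρ k : ℝ} (hk : 0 ≤ k) (hr : r < ρ) :
    KE c κ R r k ⊆ Ep c κ R ρ := by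
  intro x hx
  refine ⟨closedBall_subset_ball hr hx.1, ?_⟩
  by_contra hh
  push Not at hh
  have h1 := mul_nonpos_of_nonneg_of_nonpos hk hh
  have h2 := hx.2
  linarith

lemma KE_sub_KD {N : ℕ} (c : EE N) (κ R : ℝ) {r k : ℝ} (hk : 0 ≤ k) :
    KE c κ R r k ⊆ KD c κ R r := by
  intro x hx
  refine ⟨hx.1, ?_⟩
  by_contra hh
  push Not at hh
  have h1 := mul_nonpos_of_nonneg_of_nonpos hk hh.le
  have h2 := hx.2
  linarith

lemma Smp.nnK (S : Smp c κ R ρ q c0 C z F) {x : EE N} (hx : x ∈ Dp c κ R ρ) : 0 ≤ z x := by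
  rcases hx.2.eq_or_lt with h | h
  · rw [S.z0 x hx]
    have : ‖x - c‖ ^ 2 = R ^ 2 := by
      rcases S.kap with rfl | rfl <;> linarith
    exact (sq_eq_sq₀ (norm_nonneg _) S.R0.le).1 this
  · exact S.znn x ⟨hx.1, h⟩

lemma etaK_off {N : ℕ} {c : EE N} {κ R k r : ℝ} {x : EE N} (hx : x ∉ KE c κ R r k)
    (hb : x ∈ closedBall (c + R • e1 N) r) : etaK c κ R k x = 0 := by
  refine (Sc_zero ?_).1
  by_contra hh
  push Not at hh
  exact hx ⟨hb, hh.le⟩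

lemma Smp.log_energy (S : Smp c κ R ρ q c0 C z F) : ∃ C₁ > 0, ∀ μ > 0, ∃ e : ℕ → ℝ,
    Tendsto e atTop (𝓝 0) ∧ ∀ k : ℕ, ∫ x, etaK c κ R k x * (bb (c + R • e1 N) (ρ / 2) x *
      (‖gradient z x‖ / (z x + μ))) ≤ C₁ + e k := by
  have hq := S.q1
  have hρ := S.rho0
  set x0 := c + R • e1 N with hx0
  set ζ := bb x0 (ρ / 2) with hζ
  have hζC : ContDiff ℝ 1 ζ := bb_C1 _ _
  have hζ0 : ∀ x, 0 ≤ ζ x := bb_nonneg _ _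
  obtain ⟨G, hG⟩ := (isCompact_closedBall x0 (ρ / 2)).bddAbove_image
    (f := fun x => ‖gradient ζ x‖) (gradient_continuous hζC).norm.continuousOn
  have hG' : ∀ x ∈ closedBall x0 (ρ / 2), ‖gradient ζ x‖ ≤ |G| := fun x hx =>
    (hG (mem_image_of_mem _ hx)).trans (le_abs_self G)
  obtain ⟨C2, hC2, hY⟩ := young_T (a := (q - 1) * c0) (b := q * |G| * C) hq
    (mul_pos (by linarith) S.c00) (by have := S.C0; positivity)
  set K := KD c κ R (ρ / 2) with hK
  have hKc : IsCompact K := KD_compact _ _ _ _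
  have hKD : K ⊆ Dp c κ R ρ := KD_sub c κ R (by linarith)
  refine ⟨C2 * (volume K).toReal + 1, by positivity, fun μ hμ => ?_⟩
  set hf : EE N → ℝ := fun x => ζ x ^ q * (z x + μ) ^ (1 - q) * ⟪F x, x - c⟫ with hhf
  have hZpos : ∀ x ∈ Dp c κ R ρ, 0 < z x + μ := fun x hx => by linarith [S.nnK hx]
  have hfc : ContinuousOn hf K := by
    refine ((hζC.continuous.continuousOn.rpow_const fun x _ => Or.inr (by linarith)).mul
      (((S.zc.mono hKD).add continuousOn_const).rpow_const fun x hx =>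
        Or.inl (hZpos x (hKD hx)).ne')).mul ((S.Fc.mono hKD).inner (by fun_prop))
  have hf0 : ∀ x ∈ K, ‖x - c‖ = R → hf x = 0 := by
    intro x hx hxR
    simp only [hhf, S.F0 x (hKD hx) hxR, inner_zero_left, mul_zero]
  have hlim := shell_tendsto c S.kap S.R0 hKc hfc hf0
  refine ⟨fun k => 2 * ∫ x in K, thK c κ R k x * |hf x|, by simpa using hlim.const_mul 2, fun k => ?_⟩
  have hk0 : (0 : ℝ) ≤ k := Nat.cast_nonneg k
  set Kk := KE c κ R (ρ / 2) k with hKk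
  have hKkc : IsCompact Kk := KE_compact _ _ _ _ _
  have hKkE : Kk ⊆ Ep c κ R ρ := KE_sub c κ R hk0 (by linarith)
  have hKkK : Kk ⊆ K := KE_sub_KD c κ R hk0
  have hoff : ∀ x, x ∉ Kk → etaK c κ R k x = 0 ∨ ζ x = 0 := by
    intro x hx
    by_cases hb : x ∈ closedBall x0 (ρ / 2)
    · exact Or.inl (etaK_off hx hb)
    · exact Or.inr (bb_off (by linarith) fun hh => hb (ball_subset_closedBall hh))
  -- the test function
  set φ : EE N → ℝ := fun x => (ζ x ^ q * etaK c κ R k x) * (z x + μ) ^ (1 - q) with hφ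
  have hφ1 : ContDiffOn ℝ 1 φ (Ep c κ R ρ) := by
    have h1 : ContDiff ℝ 1 (fun x => ζ x ^ q) := hζC.rpow_const_of_le (by exact_mod_cast hq.le)
    have h2 : ContDiffOn ℝ 1 (fun x => (z x + μ) ^ (1 - q)) (Ep c κ R ρ) :=
      (S.zC.add contDiffOn_const).rpow_const_of_ne fun x hx => by
        have := S.znn x hx; positivity
    exact (h1.mul (etaK_C1 c κ R k)).contDiffOn.mul h2
  have hφ0 : ∀ x, x ∉ Kk → φ x = 0 := by
    intro x hx
    rcases hoff x hx with h | h
    · simp only [hφ, h, mul_zero, zero_mul]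
    · simp only [hφ, h, Real.zero_rpow (by linarith : q ≠ 0), zero_mul]
  obtain ⟨t1, t2, t3⟩ := test_C1 (Ep_open c κ R ρ) hKkc hKkE hφ1 hφ0
  have hφnn : ∀ x, 0 ≤ φ x := by
    intro x
    by_cases hx : x ∈ Kk
    · have := S.znn x (hKkE hx)
      have h1 := hζ0 x
      have h2 : 0 ≤ etaK c κ R k x := (Sc_facts _).1
      simp only [hφ]
      positivity
    · rw [hφ0 x hx]
  have hw := S.weak φ t1 t2 (t3.trans hKkE) hφnn
  have hgφ : ∀ x, x ∉ Kk → gradient φ x = 0 := fun x hx =>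
    gradient_eq_zero_off fun hh => hx (t3 hh)
  have hgz : ContinuousOn (gradient z) Kk := (gradient_continuousOn (Ep_open c κ R ρ) S.zC).mono hKkE
  have hZc : ContinuousOn (fun x => z x + μ) Kk := (S.zC.continuousOn.mono hKkE).add continuousOn_const
  have hZ0 : ∀ x ∈ Kk, z x + μ ≠ 0 := fun x hx => (hZpos x (hKD (hKkK hx))).ne'
  -- integrability
  have i1 : Integrable (fun x => etaK c κ R k x * (ζ x * (‖gradient z x‖ / (z x + μ)))) := by
    refine integrable_supp hKkc ((etaK_C1 c κ R k).continuous.continuousOn.mul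
      (hζC.continuous.continuousOn.mul (hgz.norm.div hZc hZ0))) fun x hx => ?_
    rcases hoff x hx with h | h
    · rw [h, zero_mul]
    · rw [h, zero_mul, mul_zero]
  have i2 : Integrable (fun x => ⟪F x, gradient φ x⟫) := by
    refine integrable_supp hKkc ((S.Fc.mono (hKkK.trans hKD)).inner
      (gradient_continuous t1).continuousOn) fun x hx => ?_
    rw [hgφ x hx, inner_zero_right]
  have i3 : Integrable (K.indicator fun x => 2 * (thK c κ R k x * |hf x|)) := by
    rw [integrable_indicator_iff hKc.measurableSet]
    exact ContinuousOn.integrableOn_compact hKc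
      (continuousOn_const.mul ((thK_cont c κ R k).continuousOn.mul hfc.abs))
  have i4 : Integrable (K.indicator fun _ => C2) := by
    rw [integrable_indicator_iff hKc.measurableSet]
    exact integrableOn_const hKc.measure_lt_top.ne
  have hpt : ∀ x, etaK c κ R k x * (ζ x * (‖gradient z x‖ / (z x + μ))) ≤
      (K.indicator (fun _ => C2) x + K.indicator (fun x => 2 * (thK c κ R k x * |hf x|)) x) -
        ⟪F x, gradient φ x⟫ := by
    intro x
    by_cases hx : x ∈ Kk
    · have hxE := hKkE hx
      have hxK := hKkK hx
      rw [indicator_of_mem hxK, indicator_of_mem hxK]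
      set Z := z x + μ with hZ
      have hZp : 0 < Z := hZpos x (hKD hxK)
      have hη0 : 0 ≤ etaK c κ R k x := (Sc_facts _).1
      have hη1 : etaK c κ R k x ≤ 1 := (Sc_facts _).2.1
      have hζx := hζ0 x
      have gz : HasGradientAt z (gradient z x) x :=
        hasGradientAt_of_contDiffOn (Ep_open c κ R ρ) S.zC hxE
      have gZ : HasGradientAt (fun y => (z y + μ) ^ (1 - q))
          (((1 - q) * Z ^ (1 - q - 1)) • gradient z x) x :=
        hg_comp (f := fun y => z y + μ) (Real.hasDerivAt_rpow_const (Or.inl hZp.ne'))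
          (hg_add_const gz μ)
      have gζ : HasGradientAt (fun y => ζ y ^ q) ((q * ζ x ^ (q - 1)) • gradient ζ x) x :=
        hg_comp (f := ζ) (Real.hasDerivAt_rpow_const (Or.inr hq.le))
          (hasGradientAt_of_contDiff hζC x)
      have gη := etaK_grad c κ R k x
      have gφ := (hg_mul (hg_mul gζ gη) gZ).gradient
      have hFφ : ⟪F x, gradient φ x⟫ =
          (1 - q) * etaK c κ R k x * (ζ x ^ q * Z ^ (1 - q - 1)) * ⟪F x, gradient z x⟫ +
          2 * κ * (thK c κ R k x * hf x) +
          q * etaK c κ R k x * (ζ x ^ (q - 1) * Z ^ (1 - q)) * ⟪F x, gradient ζ x⟫ := by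
        rw [gφ]
        simp only [inner_add_right, real_inner_smul_right, hhf, thK]
        ring
      set n := ‖gradient z x‖ with hn
      have hn0 : 0 ≤ n := norm_nonneg _
      set T := ζ x * (n / Z) with hT
      have hT0 : 0 ≤ T := by positivity
      have eT : T = ζ x * n * Z⁻¹ := by rw [hT]; ring
      have eTq : T ^ q = ζ x ^ q * Z ^ (1 - q - 1) * n ^ q := by
        rw [eT, Real.mul_rpow (by positivity) (by positivity), Real.mul_rpow hζx hn0,
          Real.inv_rpow hZp.le, ← Real.rpow_neg hZp.le]
        have : 1 - q - 1 = -q := by ring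
        rw [this]; ring
      have eTq1 : T ^ (q - 1) = ζ x ^ (q - 1) * Z ^ (1 - q) * n ^ (q - 1) := by
        rw [eT, Real.mul_rpow (by positivity) (by positivity), Real.mul_rpow hζx hn0,
          Real.inv_rpow hZp.le, ← Real.rpow_neg hZp.le]
        have : 1 - q = -(q - 1) := by ring
        rw [this]; ring
      obtain ⟨el1, el2⟩ := S.ell x hxE
      have b1 : (1 - q) * etaK c κ R k x * (ζ x ^ q * Z ^ (1 - q - 1)) * ⟪F x, gradient z x⟫ ≤
          - (etaK c κ R k x * ((q - 1) * c0 * T ^ q)) := by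
        have hc : 0 ≤ (q - 1) * etaK c κ R k x * (ζ x ^ q * Z ^ (1 - q - 1)) := by
          have : 0 ≤ q - 1 := by linarith
          positivity
        have := mul_le_mul_of_nonneg_left el1 hc
        rw [eTq]
        linarith
      have b2 : q * etaK c κ R k x * (ζ x ^ (q - 1) * Z ^ (1 - q)) * ⟪F x, gradient ζ x⟫ ≤
          etaK c κ R k x * (q * |G| * C * T ^ (q - 1)) := by
        have hc : 0 ≤ q * etaK c κ R k x * (ζ x ^ (q - 1) * Z ^ (1 - q)) := by
          have : 0 ≤ q := by linarith
          positivity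
        have h1 : ⟪F x, gradient ζ x⟫ ≤ C * n ^ (q - 1) * |G| :=
          (real_inner_le_norm _ _).trans (mul_le_mul el2 (hG' x hx.1) (norm_nonneg _)
            ((norm_nonneg _).trans el2))
        have := mul_le_mul_of_nonneg_left h1 hc
        rw [eTq1]
        linarith
      have b3 : 2 * κ * (thK c κ R k x * hf x) ≤ 2 * (thK c κ R k x * |hf x|) := by
        have hth := thK_nonneg c κ R hk0 x
        have h1 : κ * hf x ≤ |hf x| := by rw [← kap_abs S.kap]; exact le_abs_self _
        have := mul_le_mul_of_nonneg_left h1 hth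
        linarith
      have b4 := mul_le_mul_of_nonneg_left (hY T hT0) hη0
      have b5 : etaK c κ R k x * C2 ≤ C2 := by nlinarith
      rw [hFφ]
      linarith
    · rw [hgφ x hx, inner_zero_right, sub_zero]
      have h0 : etaK c κ R k x * (ζ x * (‖gradient z x‖ / (z x + μ))) = 0 := by
        rcases hoff x hx with h | h
        · rw [h, zero_mul]
        · rw [h, zero_mul, mul_zero]
      rw [h0]
      refine add_nonneg (indicator_nonneg (fun _ _ => hC2.le) x) (indicator_nonneg (fun y _ => ?_) x)
      have := thK_nonneg c κ R hk0 y
      positivity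
  have i34 : Integrable (fun x => K.indicator (fun _ => C2) x +
      K.indicator (fun x => 2 * (thK c κ R k x * |hf x|)) x) := i4.add i3
  have hfin := integral_mono i1 (i34.sub i2) hpt
  have hval : ∫ x, ((K.indicator (fun _ => C2) x +
      K.indicator (fun x => 2 * (thK c κ R k x * |hf x|)) x) - ⟪F x, gradient φ x⟫) =
      C2 * (volume K).toReal + 2 * (∫ x in K, thK c κ R k x * |hf x|) -
        ∫ x, ⟪F x, gradient φ x⟫ := by
    rw [integral_sub i34 i2, integral_add i4 i3, integral_indicator hKc.measurableSet,
      integral_indicator hKc.measurableSet, integral_const_mul, setIntegral_const, smul_eq_mul,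
      mul_comm, Measure.real]
  have hfin' : ∫ x, etaK c κ R k x * (ζ x * (‖gradient z x‖ / (z x + μ))) ≤ _ := hfin
  have hval' := hval ▸ hfin'
  linarith

end smp


noncomputable def ff {N : ℕ} (y : EE N) (κ r : ℝ) (x : EE N) : ℝ :=
  4 * max (r ^ 2 - ‖x - y‖ ^ 2) 0 * (κ * ⟪x - y, e1 N⟫)

lemma ff_cont {N : ℕ} (y : EE N) (κ r : ℝ) : Continuous (ff y κ r) := by
  unfold ff; fun_prop

lemma ff_off {N : ℕ} {y : EE N} {κ r : ℝ} (hr : 0 ≤ r) {x : EE N} (hx : x ∉ ball y r) :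
    ff y κ r x = 0 := by
  have h1 : r ≤ ‖x - y‖ := by
    by_contra hh
    exact hx (by rw [mem_ball, dist_eq_norm]; linarith)
  have h2 : r ^ 2 ≤ ‖x - y‖ ^ 2 := by gcongr
  rw [ff, max_eq_right (by linarith)]; ring

lemma etaK_ne {N : ℕ} {c : EE N} {κ R k : ℝ} (hk : 0 ≤ k) {x : EE N} (h : etaK c κ R k x ≠ 0) :
    0 < κ * (‖x - c‖ ^ 2 - R ^ 2) := by
  by_contra hh
  push Not at hh
  exact h (Sc_zero (by nlinarith [mul_nonpos_of_nonneg_of_nonpos hk hh])).1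

lemma ff_nonneg {N : ℕ} (hN : 2 ≤ N) {c : EE N} {κ R m : ℝ} (hκ : κ = 1 ∨ κ = -1) (hm : 0 < m)
    (hmR : m < R) (hr : 0 ≤ rc R m) {x : EE N} (hx : 0 ≤ κ * (‖x - c‖ ^ 2 - R ^ 2)) :
    0 ≤ ff (yc c κ R m) κ (rc R m) x := by
  by_cases hb : x ∈ ball (yc c κ R m) (rc R m)
  · have h1 : ‖x - yc c κ R m‖ < rc R m := by rwa [mem_ball, dist_eq_norm] at hb
    have := bb_dir hN hκ hm hmR hx (by gcongr)
    unfold ff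
    have h2 : 0 ≤ max (rc R m ^ 2 - ‖x - yc c κ R m‖ ^ 2) 0 := le_max_right _ _
    positivity
  · rw [ff_off hr hb]

section smp
variable {N : ℕ} {c : EE N} {κ R ρ q c0 C : ℝ} {z : EE N → ℝ} {F : EE N → EE N}

lemma Smp.log_bound (S : Smp c κ R ρ q c0 C z F) {m : ℝ} (hm : 0 < m) (hmR : m < R)
    (hsub : closedBall (yc c κ R m) (rc R m) ⊆ ball (c + R • e1 N) (ρ / 4))
    (hr : 0 ≤ rc R m) :
    ∃ C₂ > 0, ∀ μ > 0, ∀ k₀ : ℕ, ∫ x, ff (yc c κ R m) κ (rc R m) x * etaK c κ R k₀ x *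
      (Real.log (z x + μ) - Real.log μ) ≤ C₂ := by
  obtain ⟨C₁, hC₁, hlog⟩ := S.log_energy
  have hρ := S.rho0
  set x0 := c + R • e1 N with hx0
  set y := yc c κ R m with hy
  set r := rc R m with hrr
  set b := bb y r with hb
  set f := ff y κ r with hf
  set ζ := bb x0 (ρ / 2) with hζ
  have hbC : ContDiff ℝ 1 b := bb_C1 _ _
  have hb0 : ∀ x, 0 ≤ b x := bb_nonneg _ _
  have hζC : ContDiff ℝ 1 ζ := bb_C1 _ _
  have hζ0 : ∀ x, 0 ≤ ζ x := bb_nonneg _ _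
  have hfC : Continuous f := ff_cont _ _ _
  set ζ0 := (3 * ρ ^ 2 / 16) ^ 2 with hζ00
  have hζ0p : 0 < ζ0 := by positivity
  set M := (r ^ 2) ^ 2 / ζ0 + 1 with hM
  have hM0 : 0 < M := by positivity
  have hbM : ∀ x, b x ≤ M * ζ x := by
    intro x
    by_cases hx : x ∈ ball y r
    · have h1 := hsub (ball_subset_closedBall hx)
      rw [mem_ball, dist_eq_norm] at h1
      have h2 : ‖x - x0‖ ^ 2 ≤ (ρ / 4) ^ 2 := by gcongr
      have h3 : ζ0 ≤ ζ x := by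
        simp only [hζ, bb, hζ00]
        have : 3 * ρ ^ 2 / 16 ≤ max ((ρ / 2) ^ 2 - ‖x - x0‖ ^ 2) 0 :=
          le_max_of_le_left (by linarith)
        gcongr
      have h4 : b x ≤ (r ^ 2) ^ 2 := by
        simp only [hb, bb]
        have h6 : 0 ≤ max (r ^ 2 - ‖x - y‖ ^ 2) 0 := le_max_right _ _
        have : max (r ^ 2 - ‖x - y‖ ^ 2) 0 ≤ r ^ 2 :=
          max_le (by nlinarith [norm_nonneg (x - y)]) (by positivity)
        gcongr
      have h5 : (r ^ 2) ^ 2 / ζ0 * ζ0 = (r ^ 2) ^ 2 := div_mul_cancel₀ _ hζ0p.ne'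
      have h7 : M * ζ0 ≤ M * ζ x := mul_le_mul_of_nonneg_left h3 hM0.le
      have h8 : M * ζ0 = (r ^ 2) ^ 2 + ζ0 := by rw [hM, add_mul, h5, one_mul]
      linarith
    · rw [hb, bb_off hr hx]
      have := hζ0 x
      positivity
  refine ⟨M * C₁, by positivity, fun μ hμ k₀ => ?_⟩
  obtain ⟨e, he, hE⟩ := hlog μ hμ
  set ℓ : EE N → ℝ := fun x => Real.log (z x + μ) - Real.log μ with hℓ
  set K := KD c κ R (ρ / 2) with hK
  have hKc : IsCompact K := KD_compact _ _ _ _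
  have hKD : K ⊆ Dp c κ R ρ := KD_sub c κ R (by linarith)
  have hZpos : ∀ x ∈ Dp c κ R ρ, 0 < z x + μ := fun x hx => by linarith [S.nnK hx]
  have hℓc : ContinuousOn ℓ K := (((S.zc.mono hKD).add continuousOn_const).log
    fun x hx => (hZpos x (hKD hx)).ne').sub continuousOn_const
  have hℓ0 : ∀ x ∈ K, 0 ≤ ℓ x := by
    intro x hx
    have h1 := S.nnK (hKD hx)
    have := Real.log_le_log hμ (by linarith : μ ≤ z x + μ)
    simp only [hℓ]; linarith
  set hh : EE N → ℝ := fun x => b x * ℓ x * ⟪x - c, e1 N⟫ with hhh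
  have hhc : ContinuousOn hh K :=
    (hbC.continuous.continuousOn.mul hℓc).mul (by fun_prop)
  have hh0 : ∀ x ∈ K, ‖x - c‖ = R → hh x = 0 := by
    intro x hx hxR
    simp only [hhh, hℓ, S.z0 x (hKD hx) hxR, zero_add, sub_self, mul_zero, zero_mul]
  have hlim := shell_tendsto c S.kap S.R0 hKc hhc hh0
  have hballoff : ∀ x, x ∉ closedBall x0 (ρ / 2) → b x = 0 ∧ f x = 0 := by
    intro x hx
    have : x ∉ ball y r := fun h => hx (ball_subset_closedBall
      (ball_subset_ball (by linarith) (hsub (ball_subset_closedBall h))))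
    exact ⟨bb_off hr this, ff_off hr this⟩
  -- integrability of the main integrand
  have hoffk : ∀ (k : ℕ) (x : EE N), x ∉ KE c κ R (ρ / 2) k →
      etaK c κ R k x = 0 ∨ (b x = 0 ∧ f x = 0 ∧ ζ x = 0) := by
    intro k x hx
    by_cases hb' : x ∈ closedBall x0 (ρ / 2)
    · exact Or.inl (etaK_off hx hb')
    · exact Or.inr ⟨(hballoff x hb').1, (hballoff x hb').2,
        bb_off (by linarith) fun hh => hb' (ball_subset_closedBall hh)⟩
  have hI : ∀ k : ℕ, Integrable (fun x => f x * etaK c κ R k x * ℓ x) := by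
    intro k
    refine integrable_supp (KE_compact c κ R (ρ / 2) k) ((hfC.continuousOn.mul
      (etaK_C1 c κ R k).continuous.continuousOn).mul
      (hℓc.mono (KE_sub_KD c κ R (Nat.cast_nonneg k)))) fun x hx => ?_
    rcases hoffk k x hx with h | h
    · rw [h]; ring
    · rw [h.2.1]; ring
  have key : ∀ k : ℕ, ∫ x, f x * etaK c κ R k x * ℓ x ≤
      M * (C₁ + e k) + 2 * ∫ x in K, thK c κ R k x * |hh x| := by
    intro k
    have hk0 : (0 : ℝ) ≤ k := Nat.cast_nonneg k
    set Kk := KE c κ R (ρ / 2) k with hKk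
    have hKkc : IsCompact Kk := KE_compact _ _ _ _ _
    have hKkE : Kk ⊆ Ep c κ R ρ := KE_sub c κ R hk0 (by linarith)
    have hKkK : Kk ⊆ K := KE_sub_KD c κ R hk0
    set ψ : EE N → ℝ := fun x => (b x * etaK c κ R k x) * ℓ x with hψ
    have hψ1 : ContDiffOn ℝ 1 ψ (Ep c κ R ρ) := by
      refine (hbC.mul (etaK_C1 c κ R k)).contDiffOn.mul
        (((S.zC.add contDiffOn_const).log fun x hx => ?_).sub contDiffOn_const)
      have := S.znn x hx; positivity
    have hψ0 : ∀ x, x ∉ Kk → ψ x = 0 := by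
      intro x hx
      rcases hoffk k x hx with h | h
      · simp only [hψ, h, mul_zero, zero_mul]
      · simp only [hψ, h.1, zero_mul]
    obtain ⟨t1, t2, t3⟩ := test_C1 (Ep_open c κ R ρ) hKkc hKkE hψ1 hψ0
    have hdz := div_zero_test t1 t2 (κ • e1 N)
    have hgψ : ∀ x, x ∉ Kk → gradient ψ x = 0 := fun x hx =>
      gradient_eq_zero_off fun hh => hx (t3 hh)
    have hgz : ContinuousOn (gradient z) Kk :=
      (gradient_continuousOn (Ep_open c κ R ρ) S.zC).mono hKkE
    have hZc : ContinuousOn (fun x => z x + μ) Kk :=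
      (S.zC.continuousOn.mono hKkE).add continuousOn_const
    have hZ0 : ∀ x ∈ Kk, z x + μ ≠ 0 := fun x hx => (hZpos x (hKD (hKkK hx))).ne'
    have i1 : Integrable (fun x => M * (etaK c κ R k x * (ζ x * (‖gradient z x‖ / (z x + μ))))) := by
      refine Integrable.const_mul (f := fun x => etaK c κ R k x * (ζ x *
        (‖gradient z x‖ / (z x + μ)))) ?_ M
      refine integrable_supp hKkc ((etaK_C1 c κ R k).continuous.continuousOn.mul
        (hζC.continuous.continuousOn.mul (hgz.norm.div hZc hZ0))) fun x hx => ?_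
      rcases hoffk k x hx with h | h
      · rw [h, zero_mul]
      · rw [h.2.2, zero_mul, mul_zero]
    have i2 : Integrable (fun x => ⟪gradient ψ x, κ • e1 N⟫) := by
      refine integrable_supp hKkc ((gradient_continuous t1).continuousOn.inner
        continuousOn_const) fun x hx => ?_
      rw [hgψ x hx, inner_zero_left]
    have i3 : Integrable (K.indicator fun x => 2 * (thK c κ R k x * |hh x|)) := by
      rw [integrable_indicator_iff hKc.measurableSet]
      exact ContinuousOn.integrableOn_compact hKc
        (continuousOn_const.mul ((thK_cont c κ R k).continuousOn.mul hhc.abs))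
    have hpt : ∀ x, f x * etaK c κ R k x * ℓ x ≤
        (M * (etaK c κ R k x * (ζ x * (‖gradient z x‖ / (z x + μ)))) +
        K.indicator (fun x => 2 * (thK c κ R k x * |hh x|)) x) -
        ⟪gradient ψ x, κ • e1 N⟫ := by
      intro x
      by_cases hx : x ∈ Kk
      · have hxE := hKkE hx
        have hxK := hKkK hx
        rw [indicator_of_mem hxK]
        have hZp : 0 < z x + μ := hZpos x (hKD hxK)
        have hη0 : 0 ≤ etaK c κ R k x := (Sc_facts _).1
        have gz : HasGradientAt z (gradient z x) x :=
          hasGradientAt_of_contDiffOn (Ep_open c κ R ρ) S.zC hxE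
        have gℓ : HasGradientAt ℓ ((z x + μ)⁻¹ • gradient z x) x := by
          have h1 := hg_comp (f := fun y => z y + μ) (Real.hasDerivAt_log hZp.ne')
            (hg_add_const gz μ)
          have h2 := hg_add_const h1 (-Real.log μ)
          simpa only [hℓ, sub_eq_add_neg] using h2
        have gψ := (hg_mul (hg_mul (bb_grad y r x) (etaK_grad c κ R k x)) gℓ).gradient
        have hκκ : κ * κ = 1 := by rcases S.kap with h | h <;> rw [h] <;> norm_num
        have hval : ⟪gradient ψ x, κ • e1 N⟫ =
            (b x * etaK c κ R k x) * ((z x + μ)⁻¹ * (κ * ⟪gradient z x, e1 N⟫)) +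
            2 * (thK c κ R k x * hh x) - f x * etaK c κ R k x * ℓ x := by
          rw [gψ]
          simp only [inner_add_left, real_inner_smul_left, real_inner_smul_right, hhh, thK, hf, ff]
          linear_combination (2 * (k * ScD (k * (κ * (‖x - c‖ ^ 2 - R ^ 2)))) * b x * ℓ x *
            ⟪x - c, e1 N⟫) * hκκ
        have b1 : κ * ⟪gradient z x, e1 N⟫ ≤ ‖gradient z x‖ := by
          have h1 := abs_real_inner_le_norm (gradient z x) (e1 N)
          rw [norm_e1 S.hN, mul_one, ← kap_abs S.kap] at h1
          exact (le_abs_self _).trans h1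
        have b2 : (b x * etaK c κ R k x) * ((z x + μ)⁻¹ * (κ * ⟪gradient z x, e1 N⟫)) ≤
            M * (etaK c κ R k x * (ζ x * (‖gradient z x‖ / (z x + μ)))) := by
          have hbx := hb0 x
          calc (b x * etaK c κ R k x) * ((z x + μ)⁻¹ * (κ * ⟪gradient z x, e1 N⟫))
              ≤ (b x * etaK c κ R k x) * ((z x + μ)⁻¹ * ‖gradient z x‖) := by gcongr
            _ ≤ (M * ζ x * etaK c κ R k x) * ((z x + μ)⁻¹ * ‖gradient z x‖) := by
                have := hbM x
                gcongr
            _ = _ := by ring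
        have b3 : thK c κ R k x * hh x ≤ thK c κ R k x * |hh x| :=
          mul_le_mul_of_nonneg_left (le_abs_self _) (thK_nonneg c κ R hk0 x)
        rw [hval]
        linarith
      · have h0 : f x * etaK c κ R k x * ℓ x = 0 ∧
            etaK c κ R k x * (ζ x * (‖gradient z x‖ / (z x + μ))) = 0 := by
          rcases hoffk k x hx with h | h
          · rw [h]; constructor <;> ring
          · rw [h.2.1, h.2.2]; constructor <;> ring
        rw [hgψ x hx, inner_zero_left, sub_zero, h0.1, h0.2, mul_zero, zero_add]
        refine indicator_nonneg (fun y _ => ?_) x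
        have := thK_nonneg c κ R hk0 y
        positivity
    have i13 : Integrable (fun x => M * (etaK c κ R k x * (ζ x * (‖gradient z x‖ / (z x + μ)))) +
        K.indicator (fun x => 2 * (thK c κ R k x * |hh x|)) x) := i1.add i3
    have hfin := integral_mono (hI k) (i13.sub i2) hpt
    have hval : ∫ x, ((M * (etaK c κ R k x * (ζ x * (‖gradient z x‖ / (z x + μ)))) +
        K.indicator (fun x => 2 * (thK c κ R k x * |hh x|)) x) - ⟪gradient ψ x, κ • e1 N⟫) =
        M * (∫ x, etaK c κ R k x * (ζ x * (‖gradient z x‖ / (z x + μ)))) +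
          2 * (∫ x in K, thK c κ R k x * |hh x|) := by
      rw [integral_sub i13 i2, hdz, integral_add i1 i3, integral_indicator hKc.measurableSet,
        integral_const_mul, integral_const_mul, sub_zero]
    have hfin' : ∫ x, f x * etaK c κ R k x * ℓ x ≤ _ := hfin
    have hval' := hval ▸ hfin'
    have := mul_le_mul_of_nonneg_left (hE k) hM0.le
    linarith
  have hT : Tendsto (fun k : ℕ => M * (C₁ + e k) + 2 * ∫ x in K, thK c κ R k x * |hh x|) atTop
      (𝓝 (M * C₁)) := by
    have := ((he.const_add C₁).const_mul M).add (hlim.const_mul 2)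
    simpa using this
  refine ge_of_tendsto hT (eventually_atTop.2 ⟨k₀, fun k hk => (integral_mono (hI k₀) (hI k)
    fun x => ?_).trans (key k)⟩)
  show f x * etaK c κ R k₀ x * ℓ x ≤ f x * etaK c κ R k x * ℓ x
  have hk0 : (0 : ℝ) ≤ k₀ := Nat.cast_nonneg k₀
  have hkk : (k₀ : ℝ) ≤ k := Nat.cast_le.2 hk
  have hmono := etaK_mono c (κ := κ) (R := R) hk0 hkk x
  by_cases h0 : etaK c κ R k x = 0
  · have : etaK c κ R k₀ x = 0 := le_antisymm (h0 ▸ hmono) (Sc_facts _).1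
    rw [h0, this]
  · have hp := etaK_ne (hk0.trans hkk) h0
    by_cases hb' : x ∈ closedBall x0 (ρ / 2)
    · have h1 := hℓ0 x ⟨hb', hp.le⟩
      have h2 : 0 ≤ f x := ff_nonneg S.hN S.kap hm hmR hr hp.le
      gcongr
    · rw [(hballoff x hb').2]; simp

lemma Smp.vanish (S : Smp c κ R ρ q c0 C z F) :
    ∃ r > 0, r ≤ ρ ∧ ∀ x ∈ Ep c κ R r, z x = 0 := by
  have hρ := S.rho0
  obtain ⟨m, hm, hmR, hsub, hx0⟩ := ball_yc S.hN (c := c) S.kap S.R0 (by linarith : 0 < ρ / 4)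
  have hr : 0 < rc R m := lt_of_le_of_lt dist_nonneg (mem_ball.1 hx0)
  obtain ⟨r, hr0, hrsub⟩ := Metric.isOpen_iff.1 isOpen_ball _ hx0
  obtain ⟨C₂, hC₂, hB⟩ := S.log_bound hm hmR hsub hr.le
  refine ⟨min r ρ, lt_min hr0 hρ, min_le_right _ _, fun x1 hx1 => ?_⟩
  have hx1E : x1 ∈ Ep c κ R ρ := ⟨ball_subset_ball (min_le_right _ _) hx1.1, hx1.2⟩
  have hx1b : x1 ∈ ball (yc c κ R m) (rc R m) :=
    hrsub (ball_subset_ball (min_le_left _ _) hx1.1)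
  by_contra hz
  have hz1 : 0 < z x1 := lt_of_le_of_ne (S.znn x1 hx1E) (Ne.symm hz)
  set y := yc c κ R m
  set f := ff y κ (rc R m) with hf
  -- choose k₀
  obtain ⟨k₀, hk₀⟩ := exists_nat_ge (2 / (κ * (‖x1 - c‖ ^ 2 - R ^ 2)))
  have hη1 : etaK c κ R k₀ x1 = 1 := by
    refine (Sc_one ?_).1
    rwa [div_le_iff₀ hx1.2] at hk₀
  have hk0 : (0 : ℝ) ≤ k₀ := Nat.cast_nonneg k₀
  -- choose ε
  have hcz : ContinuousAt z x1 := (S.zC.continuousOn).continuousAt ((Ep_open c κ R ρ).mem_nhds hx1E)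
  have hev : ∀ᶠ x in 𝓝 x1, x ∈ Ep c κ R ρ ∧ x ∈ ball y (rc R m) ∧ z x1 / 2 < z x :=
    ((Ep_open c κ R ρ).eventually_mem hx1E).and ((isOpen_ball.eventually_mem hx1b).and
      (hcz.eventually (lt_mem_nhds (by linarith : z x1 / 2 < z x1))))
  obtain ⟨ε, hε, hεs⟩ := Metric.eventually_nhds_iff_ball.1 hev
  set w : EE N → ℝ := fun x => f x * etaK c κ R k₀ x * bb x1 ε x with hw
  have hwc : Continuous w := ((ff_cont _ _ _).mul (etaK_C1 c κ R k₀).continuous).mul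
    (bb_C1 x1 ε).continuous
  have hw0 : ∀ x, x ∉ closedBall x1 ε → w x = 0 := by
    intro x hx
    simp only [hw, bb_off hε.le (fun h => hx (ball_subset_closedBall h)), mul_zero]
  have hws : HasCompactSupport w := HasCompactSupport.intro (isCompact_closedBall x1 ε) hw0
  have hwnn : ∀ x, 0 ≤ w x := by
    intro x
    by_cases hx : x ∈ ball x1 ε
    · have h2 := (hεs x hx).1.2
      have h3 : 0 ≤ f x := ff_nonneg S.hN S.kap hm hmR hr.le h2.le
      have h4 : 0 ≤ etaK c κ R k₀ x := (Sc_facts _).1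
      exact mul_nonneg (mul_nonneg h3 h4) (bb_nonneg _ _ _)
    · simp only [hw, bb_off hε.le hx, mul_zero, le_refl]
  have hw1 : w x1 ≠ 0 := by
    have h1 : ‖x1 - y‖ < rc R m := by rwa [mem_ball, dist_eq_norm] at hx1b
    have h1' : ‖x1 - y‖ ^ 2 < rc R m ^ 2 := by gcongr
    have h2 := bb_dir S.hN S.kap hm hmR hx1.2.le h1'
    have h3 : 0 < f x1 := by
      simp only [hf, ff]
      have : 0 < max (rc R m ^ 2 - ‖x1 - y‖ ^ 2) 0 := lt_max_of_lt_left (by linarith)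
      positivity
    have h4 : 0 < bb x1 ε x1 := by
      simp only [bb, sub_self, norm_zero]
      have : 0 < max (ε ^ 2 - 0 ^ 2) (0 : ℝ) := lt_max_of_lt_left (by nlinarith)
      positivity
    simp only [hw, hη1]
    positivity
  have hIpos' := hwc.integral_pos_of_hasCompactSupport_nonneg_nonzero (μ := volume) hws hwnn hw1
  obtain ⟨I, hI⟩ : ∃ I, I = ∫ x, w x := ⟨_, rfl⟩
  have hIpos : 0 < I := hI ▸ hIpos'
  set T := (ε ^ 2) ^ 2 * C₂ / I + 1 with hT
  have hT0 : 0 < T := by positivity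
  set μ := z x1 / 2 * Real.exp (-T) with hμ
  have hμ0 : 0 < μ := by positivity
  have hbd := hB μ hμ0 k₀
  set ℓ : EE N → ℝ := fun x => Real.log (z x + μ) - Real.log μ with hℓ
  have hKc := KE_compact c κ R (ρ / 2) (k₀ : ℝ)
  have hKE : KE c κ R (ρ / 2) (k₀ : ℝ) ⊆ Ep c κ R ρ := KE_sub c κ R hk0 (by linarith)
  have hff0 : ∀ x, x ∉ closedBall (c + R • e1 N) (ρ / 2) → f x = 0 := by
    intro x hx
    refine ff_off hr.le fun h => hx (ball_subset_closedBall
      (ball_subset_ball (by linarith) (hsub (ball_subset_closedBall h))))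
  have i1 : Integrable (fun x => f x * etaK c κ R k₀ x * ℓ x) := by
    refine integrable_supp hKc (((ff_cont _ _ _).continuousOn.mul
      (etaK_C1 c κ R k₀).continuous.continuousOn).mul
      ((((S.zC.continuousOn.mono hKE).add continuousOn_const).log fun x hx => ?_).sub
        continuousOn_const)) fun x hx => ?_
    · have := S.znn x (hKE hx)
      exact (by linarith : 0 < z x + μ).ne'
    · by_cases hb' : x ∈ closedBall (c + R • e1 N) (ρ / 2)
      · rw [etaK_off hx hb']; ring
      · rw [hff0 x hb']; ring
  have hwI : Integrable (fun x => T * w x) := (hwc.integrable_of_hasCompactSupport hws).const_mul T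
  have hpt : ∀ x, T * w x ≤ (ε ^ 2) ^ 2 * (f x * etaK c κ R k₀ x * ℓ x) := by
    intro x
    by_cases hη : etaK c κ R k₀ x = 0
    · simp only [hw, hη, mul_zero, zero_mul, le_refl]
    have hp := etaK_ne hk0 hη
    by_cases hb' : x ∈ closedBall (c + R • e1 N) (ρ / 2)
    swap
    · simp only [hw, hff0 x hb', mul_zero, zero_mul, le_refl]
    have hxD : x ∈ Ep c κ R ρ := ⟨closedBall_subset_ball (by linarith) hb', hp⟩
    have hzx := S.znn x hxD
    have h3 : 0 ≤ f x := ff_nonneg S.hN S.kap hm hmR hr.le hp.le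
    have h4 : 0 ≤ etaK c κ R k₀ x := (Sc_facts _).1
    have hℓ0 : 0 ≤ ℓ x := by
      have := Real.log_le_log hμ0 (by linarith : μ ≤ z x + μ)
      simp only [hℓ]; linarith
    by_cases hx : x ∈ ball x1 ε
    · have h5 : T ≤ ℓ x := by
        have h6 := (hεs x hx).2.2
        have h7 := Real.log_le_log (by linarith : 0 < z x1 / 2) (by linarith : z x1 / 2 ≤ z x + μ)
        have h8 : Real.log μ = Real.log (z x1 / 2) - T := by
          rw [hμ, Real.log_mul (by positivity) (by positivity), Real.log_exp]; ring
        simp only [hℓ]; linarith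
      have h9 : bb x1 ε x ≤ (ε ^ 2) ^ 2 := by
        simp only [bb]
        have h6 : 0 ≤ max (ε ^ 2 - ‖x - x1‖ ^ 2) 0 := le_max_right _ _
        have : max (ε ^ 2 - ‖x - x1‖ ^ 2) 0 ≤ ε ^ 2 :=
          max_le (by nlinarith [norm_nonneg (x - x1)]) (by positivity)
        gcongr
      have h10 := bb_nonneg x1 ε x
      calc T * w x = (f x * etaK c κ R k₀ x) * (bb x1 ε x * T) := by simp only [hw]; ring
        _ ≤ (f x * etaK c κ R k₀ x) * ((ε ^ 2) ^ 2 * ℓ x) := by gcongr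
        _ = _ := by ring
    · simp only [hw, bb_off hε.le hx, mul_zero]
      positivity
  have hfin := integral_mono hwI (i1.const_mul ((ε ^ 2) ^ 2)) hpt
  rw [integral_const_mul, integral_const_mul, ← hI] at hfin
  have h1 : T * I ≤ (ε ^ 2) ^ 2 * C₂ := hfin.trans (mul_le_mul_of_nonneg_left hbd (by positivity))
  have h2 : T * I = (ε ^ 2) ^ 2 * C₂ + I := by
    rw [hT, add_mul, div_mul_cancel₀ _ hIpos.ne', one_mul]
  linarith

end smp


section cont
variable {N : ℕ} {p lam : ℝ} {Ω : Set (EE N)} {u : EE N → ℝ} {c : EE N} {κ R L : ℝ}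

lemma Geo.rt_pos (g : Geo Ω c κ R L) {t : ℝ} (h0 : 0 ≤ t) (h1 : t ≤ L) : 0 < R + κ * t := by
  have h2 := g.rL
  have h3 := g.R0
  rcases g.kap with h | h <;> rw [h] at h2 ⊢ <;> linarith

lemma Geo.kap_t (g : Geo Ω c κ R L) (t : ℝ) : κ * ((R + κ * t) - R) = t := by
  linear_combination t * g.kap_sq

lemma Geo.t_kap (g : Geo Ω c κ R L) (r : ℝ) : R + κ * (κ * (r - R)) = r := by
  linear_combination (r - R) * g.kap_sq

lemma Geo.mem_t (g : Geo Ω c κ R L) {t : ℝ} (h0 : 0 < t) (h1 : t < L) {x : EE N}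
    (hx : ‖x - c‖ = R + κ * t) : x ∈ Ω := by
  refine g.Q x ?_ ?_ <;> rw [hx, g.kap_t] <;> assumption

lemma Geo.mem_cl_t (g : Geo Ω c κ R L) {t : ℝ} (h0 : 0 ≤ t) (h1 : t < L) {x : EE N}
    (hx : ‖x - c‖ = R + κ * t) : x ∈ closure Ω := by
  rcases h0.eq_or_lt with h | h
  · rw [← h, mul_zero, add_zero] at hx
    exact g.mem_cl hx
  · exact subset_closure (g.mem_t h h1 hx)

lemma norm_pt (hN : 2 ≤ N) (c : EE N) {r : ℝ} (hr : 0 ≤ r) : ‖c + r • e1 N - c‖ = r ∧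
    ‖c - r • e1 N - c‖ = r := by
  constructor
  · rw [add_sub_cancel_left, norm_smul, norm_e1 hN, mul_one, Real.norm_of_nonneg hr]
  · rw [sub_sub_cancel_left, norm_neg, norm_smul, norm_e1 hN, mul_one, Real.norm_of_nonneg hr]

lemma kap_nonneg_sq {κ t R : ℝ} (ht : 0 ≤ t) (hR : 0 < R) :
    0 ≤ κ * (t ^ 2 - R ^ 2) ↔ 0 ≤ κ * (t - R) := by
  have : κ * (t ^ 2 - R ^ 2) = κ * (t - R) * (t + R) := by ring
  rw [this, mul_nonneg_iff_of_pos_right (by linarith)]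

lemma near_pt (hN : 2 ≤ N) {κ : ℝ} (hκ : κ = 1 ∨ κ = -1) {r ρ : ℝ} (hr : 0 ≤ r) {x : EE N}
    (hx : x ∈ ball (c + r • e1 N) ρ) : κ * (‖x - c‖ - r) < ρ := by
  have h1 := abs_norm_sub_norm_le (x - c) (c + r • e1 N - c)
  rw [(norm_pt hN c hr).1, sub_sub_sub_cancel_right] at h1
  rw [mem_ball, dist_eq_norm] at hx
  have h2 := le_abs_self (κ * (‖x - c‖ - r))
  rw [kap_abs hκ] at h2
  linarith

lemma Geo.Dp_t (g : Geo Ω c κ R L) {t ρ : ℝ} (h0 : 0 ≤ t) (h1 : t ≤ L) {x : EE N}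
    (hx : x ∈ Dp c κ (R + κ * t) ρ) : t ≤ κ * (‖x - c‖ - R) ∧ κ * (‖x - c‖ - R) < t + ρ := by
  have hr := g.rt_pos h0 h1
  have a1 := near_pt g.hN g.kap hr.le hx.1
  have a2 := (kap_nonneg_sq (norm_nonneg _) hr).1 hx.2
  have a3 := g.kap_t t
  constructor <;> linarith

lemma Geo.Ep_t (g : Geo Ω c κ R L) {t ρ : ℝ} (h0 : 0 ≤ t) (h1 : t ≤ L) {x : EE N}
    (hx : x ∈ Ep c κ (R + κ * t) ρ) : t < κ * (‖x - c‖ - R) ∧ κ * (‖x - c‖ - R) < t + ρ := by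
  have hr := g.rt_pos h0 h1
  have a1 := near_pt g.hN g.kap hr.le hx.1
  have a2 := (kap_pos_sq (norm_nonneg _) hr).1 hx.2
  have a3 := g.kap_t t
  constructor <;> linarith

lemma Geo.pt_Ep (g : Geo Ω c κ R L) {t ρ δ : ℝ} (h0 : 0 ≤ t) (h1 : t ≤ L) (hδ : 0 < δ)
    (hδρ : δ < ρ) (hδL : t + δ ≤ L) : c + (R + κ * (t + δ)) • e1 N ∈ Ep c κ (R + κ * t) ρ := by
  have hr := g.rt_pos h0 h1
  have hr' := g.rt_pos (by linarith : 0 ≤ t + δ) hδL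
  constructor
  · rw [mem_ball, dist_eq_norm]
    have : c + (R + κ * (t + δ)) • e1 N - (c + (R + κ * t) • e1 N) = (κ * δ) • e1 N := by
      module
    rw [this, norm_smul, norm_e1 g.hN, mul_one, Real.norm_eq_abs, kap_abs g.kap, abs_of_pos hδ]
    exact hδρ
  · refine (kap_pos_sq (norm_nonneg _) hr).2 ?_
    rw [(norm_pt g.hN c hr'.le).1]
    have := g.kap_sq
    have : κ * (R + κ * (t + δ) - (R + κ * t)) = δ := by linear_combination δ * g.kap_sq
    rwa [this]

lemma Geo.hopf (g : Geo Ω c κ R L) (h : USol p lam Ω u)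
    (hf : ‖gradient u (c - R • e1 N)‖ ≤ ‖gradient u (c + R • e1 N)‖) :
    gradient u (c + R • e1 N) ≠ 0 := by
  intro h0
  have hp := h.hp
  have hR : R = R + κ * 0 := by ring
  have hE : ∀ x ∈ Ep c κ R L, x ∈ Ω := by
    intro x hx
    rw [hR] at hx
    have := g.Ep_t le_rfl g.L0.le hx
    exact g.Q x this.1 (by linarith [this.2])
  have hD : ∀ x ∈ Dp c κ R L, x ∈ closure Ω := by
    intro x hx
    rw [hR] at hx
    have := g.Dp_t le_rfl g.L0.le hx
    exact g.mem_cl_t this.1 (by linarith [this.2]) (g.t_kap _).symm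
  have S : Smp c κ R L p 1 1 u (fun x => Afl p (gradient u x)) :=
    { hN := g.hN, kap := g.kap, R0 := g.R0, rho0 := g.L0, q1 := hp, c00 := one_pos, C0 := one_pos
      zC := h.contDiffOn.mono hE
      znn := fun x hx => (h.pos x (hE x hx)).le
      zc := h.cont.mono hD
      Fc := (continuous_Afl hp).comp_continuousOn (h.cgrad.mono hD)
      z0 := fun x _ hx => h.zer x (g.fr x hx)
      F0 := fun x _ hx => by
        have h1 := flatS g h hf hx
        rw [h0, norm_zero, norm_eq_zero] at h1
        simp only [h1, Afl_zero]
      ell := fun x _ => by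
        constructor
        · rw [inner_Afl_self hp, one_mul]
        · rw [norm_Afl hp, one_mul]
      weak := fun φ h1 h2 h3 h4 => by
        rw [h.weak φ h1 h2 (h3.trans hE)]
        refine integral_nonneg fun x => ?_
        show 0 ≤ lam * u x ^ (p - 1) * φ x
        by_cases hx : x ∈ tsupport φ
        · have := h.pos x (hE x (h3 hx))
          have h5 := h4 x
          have h6 := h.lam0
          positivity
        · rw [image_eq_zero_of_notMem_tsupport hx, mul_zero] }
  obtain ⟨r, hr, hrL, hz⟩ := S.vanish
  have hm := g.pt_Ep (t := 0) (δ := r / 2) (ρ := r) le_rfl g.L0.le (by linarith) (by linarith)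
    (by linarith)
  rw [← hR] at hm
  have h2 := hz _ hm
  have h3 := h.pos _ (hE _ ⟨ball_subset_ball hrL hm.1, hm.2⟩)
  linarith

/-- one continuation step -/
lemma Geo.step (g : Geo Ω c κ R L) (h : USol p lam Ω u) {t : ℝ} (ht0 : 0 ≤ t) (htL : t < L)
    (hz0 : ∀ x, ‖x - c‖ = R + κ * t → u (sig c (e1 N) x) = u x)
    (hg0 : ∀ x, ‖x - c‖ = R + κ * t → Tl (e1 N) (gradient u (sig c (e1 N) x)) = gradient u x)
    (hne : gradient u (c + (R + κ * t) • e1 N) ≠ 0) :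
    ∃ r > 0, t + r ≤ L ∧ ∀ x ∈ Ep c κ (R + κ * t) r, u (sig c (e1 N) x) = u x := by
  have hp := h.hp
  have he := norm_e1 g.hN
  have hRt := g.rt_pos ht0 htL.le
  set R' := R + κ * t with hR'
  set x0 := c + R' • e1 N with hx0
  have hx0n : ‖x0 - c‖ = R' := (norm_pt g.hN c hRt.le).1
  obtain ⟨ρ', hρ', c0, hc0, C, hC, hell⟩ := Afl_elliptic hp (gradient u x0) hne
  -- the annulus
  have hann : ∀ x, t ≤ κ * (‖x - c‖ - R) → κ * (‖x - c‖ - R) < L → x ∈ closure Ω ∧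
      sig c (e1 N) x ∈ closure Ω := by
    intro x h1 h2
    refine ⟨g.mem_cl_t (ht0.trans h1) h2 (g.t_kap _).symm, g.mem_cl_t (ht0.trans h1) h2 ?_⟩
    rw [norm_sig_sub, g.t_kap]
  have hD : ∀ x ∈ Dp c κ R' (L - t), x ∈ closure Ω ∧ sig c (e1 N) x ∈ closure Ω := by
    intro x hx
    have := g.Dp_t ht0 htL.le hx
    exact hann x this.1 (by linarith [this.2])
  have hE : ∀ x ∈ Ep c κ R' (L - t), x ∈ Ω ∧ sig c (e1 N) x ∈ Ω := by
    intro x hx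
    have := g.Ep_t ht0 htL.le hx
    refine ⟨g.Q x (by linarith) (by linarith), g.Q _ ?_ ?_⟩ <;> rw [norm_sig_sub] <;> linarith
  have hED : ∀ r, Ep c κ R' r ⊆ Dp c κ R' r := fun r x hx => ⟨hx.1, hx.2.le⟩
  set gw : EE N → EE N := fun x => Tl (e1 N) (gradient u (sig c (e1 N) x)) with hgw
  have c1 : ContinuousOn (gradient u) (Dp c κ R' (L - t)) := h.cgrad.mono fun x hx => (hD x hx).1
  have c2 : ContinuousOn gw (Dp c κ R' (L - t)) :=
    (Tl (e1 N)).continuous.comp_continuousOn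
      (h.cgrad.comp (sig_cont c (e1 N)).continuousOn fun x hx => (hD x hx).2)
  have hx0D : x0 ∈ Dp c κ R' (L - t) := by
    refine ⟨mem_ball_self (by linarith), ?_⟩
    rw [hx0n]; simp
  have m1 := (c1 x0 hx0D).eventually (isOpen_ball.eventually_mem (mem_ball_self hρ'))
  have m2 := (c2 x0 hx0D).eventually (isOpen_ball.eventually_mem
    (show gw x0 ∈ ball (gradient u x0) ρ' by
      simp only [hgw]; rw [hg0 x0 hx0n]; exact mem_ball_self hρ'))
  have m3 := m1.and m2
  rw [eventually_nhdsWithin_iff, Metric.eventually_nhds_iff_ball] at m3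
  obtain ⟨ε, hε, hεs⟩ := m3
  set ρ := min ε (min (L - t) R') with hρ
  have hρ0 : 0 < ρ := lt_min hε (lt_min (by linarith) hRt)
  have hρ1 : ρ ≤ ε := min_le_left _ _
  have hρ2 : ρ ≤ L - t := (min_le_right _ _).trans (min_le_left _ _)
  have hρ3 : ρ ≤ R' := (min_le_right _ _).trans (min_le_right _ _)
  have hDD : Dp c κ R' ρ ⊆ Dp c κ R' (L - t) := fun x hx => ⟨ball_subset_ball hρ2 hx.1, hx.2⟩
  have hEE : Ep c κ R' ρ ⊆ Ep c κ R' (L - t) := fun x hx => ⟨ball_subset_ball hρ2 hx.1, hx.2⟩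
  have hell' : ∀ x ∈ Dp c κ R' ρ, gradient u x ∈ ball (gradient u x0) ρ' ∧
      gw x ∈ ball (gradient u x0) ρ' := fun x hx =>
    hεs x (ball_subset_ball hρ1 hx.1) (hDD hx)
  have hpos : ∀ x ∈ Dp c κ R' ρ, 0 ≤ ⟪x - c, e1 N⟫ := by
    intro x hx
    have h1 : x - c = (x - x0) + R' • e1 N := by rw [hx0]; abel
    have h2 := hx.1
    rw [mem_ball, dist_eq_norm] at h2
    have h3 := (abs_le.1 (abs_real_inner_le_norm (x - x0) (e1 N))).1
    rw [he, mul_one] at h3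
    rw [h1, inner_add_left, real_inner_smul_left, real_inner_self_eq_norm_sq, he]
    linarith
  set z : EE N → ℝ := fun x => u (sig c (e1 N) x) - u x with hz
  have gz : ∀ x ∈ Ep c κ R' ρ, HasGradientAt z (gw x - gradient u x) x := by
    intro x hx
    have h1 := hE x (hEE hx)
    exact hg_sub (hg_sig (h.hgrad (subset_closure h1.2))) (h.hgrad (subset_closure h1.1))
  have S : Smp c κ R' ρ 2 c0 C z (fun x => Afl p (gw x) - Afl p (gradient u x)) :=
    { hN := g.hN, kap := g.kap, R0 := hRt, rho0 := hρ0, q1 := one_lt_two, c00 := hc0, C0 := hC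
      zC := by
        refine ContDiffOn.sub ?_ (h.contDiffOn.mono fun x hx => (hE x (hEE hx)).1)
        exact h.contDiffOn.comp (sig_contDiff c (e1 N)).contDiffOn fun x hx => (hE x (hEE hx)).2
      znn := fun x hx => by
        have := cmpr g h he (by rw [real_inner_self_eq_norm_sq, he]; norm_num)
          (hE x (hEE hx)).1 (hpos x (hED ρ hx))
        simp only [hz]; linarith
      zc := (h.cont.comp (sig_cont c (e1 N)).continuousOn fun x hx => (hD x (hDD hx)).2).sub
        (h.cont.mono fun x hx => (hD x (hDD hx)).1)
      Fc := ((continuous_Afl hp).comp_continuousOn (c2.mono hDD)).sub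
        ((continuous_Afl hp).comp_continuousOn (c1.mono hDD))
      z0 := fun x _ hx => by simp only [hz, hz0 x hx, sub_self]
      F0 := fun x _ hx => by simp only [hgw, hg0 x hx, sub_self]
      ell := fun x hx => by
        rw [(gz x hx).gradient]
        have h1 := hell' x (hED ρ hx)
        exact hell _ h1.2 _ h1.1
      weak := fun φ h1 h2 h3 h4 => by
        have w1 := h.weak φ h1 h2 (h3.trans fun x hx => (hE x (hEE hx)).1)
        have w2 := (h.sig c (e1 N)).weak φ h1 h2 (h3.trans fun x hx => (hE x (hEE hx)).2)
        have hgu : ∀ x ∈ tsupport φ, gradient (fun y => u (sig c (e1 N) y)) x = gw x := by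
          intro x hx
          exact (hg_sig (h.hgrad (subset_closure (hE x (hEE (h3 hx))).2))).gradient
        have hoff : ∀ x, x ∉ tsupport φ → gradient φ x = 0 := fun x hx => gradient_eq_zero_off hx
        have w3 : ∫ x, ⟪Afl p (gradient (fun y => u (sig c (e1 N) y)) x), gradient φ x⟫ =
            ∫ x, ⟪Afl p (gw x), gradient φ x⟫ := by
          refine integral_congr_ae (ae_of_all _ fun x => ?_)
          by_cases hx : x ∈ tsupport φ
          · show ⟪Afl p (gradient (fun y => u (sig c (e1 N) y)) x), gradient φ x⟫ = _
            rw [hgu x hx]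
          · show ⟪Afl p (gradient (fun y => u (sig c (e1 N) y)) x), gradient φ x⟫ =
              ⟪Afl p (gw x), gradient φ x⟫
            rw [hoff x hx, inner_zero_right, inner_zero_right]
        have hsD : tsupport φ ⊆ Dp c κ R' (L - t) := fun x hx => hDD (hED ρ (h3 hx))
        have i1 : Integrable (fun x => ⟪Afl p (gw x), gradient φ x⟫) :=
          integrable_supp h2 (((continuous_Afl hp).comp_continuousOn (c2.mono hsD)).inner
            (gradient_continuous h1).continuousOn) fun x hx => by rw [hoff x hx, inner_zero_right]
        have i2 : Integrable (fun x => ⟪Afl p (gradient u x), gradient φ x⟫) :=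
          integrable_supp h2 (((continuous_Afl hp).comp_continuousOn (c1.mono hsD)).inner
            (gradient_continuous h1).continuousOn) fun x hx => by rw [hoff x hx, inner_zero_right]
        have cu : ContinuousOn u (tsupport φ) := h.cont.mono fun x hx => (hD x (hsD hx)).1
        have cw : ContinuousOn (fun x => u (sig c (e1 N) x)) (tsupport φ) :=
          h.cont.comp (sig_cont c (e1 N)).continuousOn fun x hx => (hD x (hsD hx)).2
        have j1 : Integrable (fun x => lam * u x ^ (p - 1) * φ x) :=
          integrable_supp h2 ((continuousOn_const.mul (cu.rpow_const fun x _ =>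
            Or.inr (by linarith))).mul h1.continuous.continuousOn) fun x hx => by
            rw [image_eq_zero_of_notMem_tsupport hx, mul_zero]
        have j2 : Integrable (fun x => lam * u (sig c (e1 N) x) ^ (p - 1) * φ x) :=
          integrable_supp h2 ((continuousOn_const.mul (cw.rpow_const fun x _ =>
            Or.inr (by linarith))).mul h1.continuous.continuousOn) fun x hx => by
            rw [image_eq_zero_of_notMem_tsupport hx, mul_zero]
        simp only [inner_sub_left]
        rw [integral_sub i1 i2, w1, ← w3, w2, ← integral_sub j2 j1]
        refine integral_nonneg fun x => ?_
        show 0 ≤ lam * u (sig c (e1 N) x) ^ (p - 1) * φ x - lam * u x ^ (p - 1) * φ x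
        by_cases hx : x ∈ tsupport φ
        · have a1 := h.pos x (hE x (hEE (h3 hx))).1
          have a2 := cmpr g h he (by rw [real_inner_self_eq_norm_sq, he]; norm_num)
            (hE x (hEE (h3 hx))).1 (hpos x (hED ρ (h3 hx)))
          have a3 := Real.rpow_le_rpow a1.le a2 (by linarith : 0 ≤ p - 1)
          have a4 := mul_le_mul_of_nonneg_right (mul_le_mul_of_nonneg_left a3 h.lam0) (h4 x)
          linarith
        · rw [image_eq_zero_of_notMem_tsupport hx]; simp }
  obtain ⟨r, hr, hrρ, hv⟩ := S.vanish
  refine ⟨r, hr, by linarith, fun x hx => ?_⟩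
  have := hv x hx
  simp only [hz] at this
  linarith

end cont


section crit
variable {N : ℕ} {p lam : ℝ} {Ω : Set (EE N)} {u : EE N → ℝ} {c : EE N} {κ R L : ℝ}

lemma Geo.radial (g : Geo Ω c κ R L) (h : USol p lam Ω u) {t : ℝ} (ht0 : 0 ≤ t) (htL : t < L)
    (heq : u (c + (R + κ * t) • e1 N) = u (c - (R + κ * t) • e1 N)) {x : EE N}
    (hx : ‖x - c‖ = R + κ * t) : u x = u (c + (R + κ * t) • e1 N) := by
  have hRt := g.rt_pos ht0 htL.le
  have hn := norm_pt g.hN c hRt.le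
  rcases ht0.eq_or_lt with h0 | h0
  · rw [h.zer x (g.fr x (by rw [hx, ← h0]; ring)), h.zer _ (g.fr _ (by rw [hn.1, ← h0]; ring))]
  set r := R + κ * t with hr
  have hxΩ := g.mem_t h0 htL hx
  have he := norm_e1 g.hN
  have hee : ⟪e1 N, e1 N⟫ = 1 := by rw [real_inner_self_eq_norm_sq, he]; norm_num
  apply le_antisymm
  · rw [heq]
    by_cases hc : x - c = -(r • e1 N)
    · have : x = c - r • e1 N := by rw [sub_eq_iff_eq_add] at hc; rw [hc]; abel
      rw [this]
    · refine mon g h hxΩ (by rw [hn.2, hx]) ?_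
      have h1 := inner_lt_top g.hN (R := r) (v := -(x - c)) (by rw [norm_neg, hx])
        (fun hh => hc (by rw [← hh, neg_neg]))
      rw [inner_neg_left] at h1
      rw [sub_sub_cancel_left, inner_neg_left, real_inner_smul_left, hee]
      linarith
  · by_cases hc : x - c = r • e1 N
    · have : x = c + r • e1 N := by rw [← hc]; abel
      rw [this]
    · refine mon g h (g.mem_t h0 htL hn.1) (by rw [hn.1, hx]) ?_
      have h1 := inner_lt_top g.hN hx hc
      rw [add_sub_cancel_left, real_inner_smul_left, hee]
      linarith

lemma Geo.radgrad (g : Geo Ω c κ R L) (h : USol p lam Ω u) {t : ℝ} (ht0 : 0 < t) (htL : t < L)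
    (hrad : ∀ x y : EE N, ‖y - c‖ = ‖x - c‖ → 0 < κ * (‖x - c‖ - R) → κ * (‖x - c‖ - R) < t →
      u y = u x) (e : EE N) {x : EE N} (hx : ‖x - c‖ = R + κ * t) :
    Tl e (gradient u (sig c e x)) = gradient u x := by
  have hRt := g.rt_pos ht0.le htL.le
  have hxΩ := g.mem_t ht0 htL hx
  have hsΩ : sig c e x ∈ Ω := g.mem_t ht0 htL (by rw [norm_sig_sub, hx])
  have cg : ∀ y ∈ Ω, ContinuousAt (gradient u) y := fun y hy =>
    (h.cgrad.mono subset_closure).continuousAt (h.opn.mem_nhds hy)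
  set D : EE N → EE N := fun y => Tl e (gradient u (sig c e y)) - gradient u y with hD
  have hDc : ContinuousAt D x := by
    refine ContinuousAt.sub ?_ (cg x hxΩ)
    exact (Tl e).continuous.continuousAt.comp
      (ContinuousAt.comp (g := gradient u) (f := sig c e) (cg _ hsΩ) (sig_cont c e).continuousAt)
  set y : ℝ → EE N := fun τ => c + (1 - κ * τ) • (x - c) with hy
  have hyc : Continuous y := by simp only [hy]; fun_prop
  have hy0 : y 0 = x := by simp [hy]
  have hyt : Tendsto y (𝓝[>] 0) (𝓝 x) := by
    have := hyc.tendsto 0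
    rw [hy0] at this
    exact this.mono_left nhdsWithin_le_nhds
  have h1 : Tendsto (fun τ => D (y τ)) (𝓝[>] 0) (𝓝 (D x)) := hDc.tendsto.comp hyt
  have h2 : ∀ᶠ τ in 𝓝[>] (0 : ℝ), D (y τ) = 0 := by
    have hO : IsOpen {w : EE N | 0 < κ * (‖w - c‖ - R) ∧ κ * (‖w - c‖ - R) < t} := by
      have hf : Continuous (fun w : EE N => κ * (‖w - c‖ - R)) := by fun_prop
      exact (isOpen_lt continuous_const hf).inter (isOpen_lt hf continuous_const)
    have e1' : ∀ᶠ τ in 𝓝[>] (0 : ℝ), τ < min 1 (t / (R + κ * t)) :=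
      (gt_mem_nhds (lt_min one_pos (by positivity))).filter_mono nhdsWithin_le_nhds
    filter_upwards [e1', self_mem_nhdsWithin] with τ hτ1 hτ0
    have hτ0' : 0 < τ := hτ0
    have ha : τ < 1 := hτ1.trans_le (min_le_left _ _)
    have hb : τ * (R + κ * t) < t := by
      have := hτ1.trans_le (min_le_right _ _)
      rwa [lt_div_iff₀ hRt] at this
    have hn : ‖y τ - c‖ = (1 - κ * τ) * (R + κ * t) := by
      have : 0 ≤ 1 - κ * τ := by rcases g.kap with hk | hk <;> rw [hk] <;> linarith
      simp only [hy, add_sub_cancel_left, norm_smul, Real.norm_of_nonneg this, hx]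
    have hk : κ * (‖y τ - c‖ - R) = t - τ * (R + κ * t) := by
      rw [hn]; linear_combination (t - τ * (R + κ * t)) * g.kap_sq
    have hyO : y τ ∈ {w : EE N | 0 < κ * (‖w - c‖ - R) ∧ κ * (‖w - c‖ - R) < t} := by
      have : 0 < τ * (R + κ * t) := by positivity
      exact ⟨by rw [hk]; linarith, by rw [hk]; linarith⟩
    have m1 : y τ ∈ Ω := g.Q _ hyO.1 (hyO.2.trans htL)
    have m2 : sig c e (y τ) ∈ Ω :=
      g.Q _ (by rw [norm_sig_sub]; exact hyO.1) (by rw [norm_sig_sub]; exact hyO.2.trans htL)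
    have gz : HasGradientAt (fun w => u (sig c e w) - u w) (D (y τ)) (y τ) :=
      hg_sub (hg_sig (h.hgrad (subset_closure m2))) (h.hgrad (subset_closure m1))
    have hev : (fun _ : EE N => (0 : ℝ)) =ᶠ[𝓝 (y τ)] (fun w => u (sig c e w) - u w) := by
      filter_upwards [hO.eventually_mem hyO] with w hw
      rw [hrad w (sig c e w) (norm_sig_sub c e w) hw.1 hw.2, sub_self]
    have h3 := gz.congr_of_eventuallyEq hev
    exact h3.unique (hasGradientAt_const (y τ) (0 : ℝ))
  have h3 : D x = 0 := by
    refine tendsto_nhds_unique h1 ((tendsto_const_nhds (x := (0 : EE N))).congr' ?_)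
    filter_upwards [h2] with τ hτ using hτ.symm
  exact sub_eq_zero.1 h3

lemma Geo.bdgrad (g : Geo Ω c κ R L) (h : USol p lam Ω u)
    (hf : ‖gradient u (c - R • e1 N)‖ ≤ ‖gradient u (c + R • e1 N)‖) (e : EE N) {x : EE N}
    (hx : ‖x - c‖ = R) : Tl e (gradient u (sig c e x)) = gradient u x := by
  have hs : ‖sig c e x - c‖ = R := by rw [norm_sig_sub, hx]
  rw [g.bgrad h hs, g.bgrad h hx, flatS g h hf hs, flatS g h hf hx, map_smul, sig_sub, Tl_Tl]

lemma Geo.crit (g : Geo Ω c κ R L) (h : USol p lam Ω u)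
    (hf : ‖gradient u (c - R • e1 N)‖ ≤ ‖gradient u (c + R • e1 N)‖) :
    ∃ t, 0 < t ∧ t < L ∧ ∀ x, ‖x - c‖ = R + κ * t → gradient u x = 0 := by
  set f : ℝ → ℝ := fun t => u (c + (R + κ * t) • e1 N) - u (c - (R + κ * t) • e1 N) with hff
  set s : Set ℝ := {t | ∀ t', 0 ≤ t' → t' < t → f t' = 0} with hs
  have hsc : IsClosed s := by
    have : s = ⋂ t' ∈ {t' | 0 ≤ t' ∧ f t' ≠ 0}, Iic t' := by
      ext t
      simp only [hs, mem_iInter, mem_Iic, Set.mem_ofPred_eq]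
      constructor
      · intro h1 t' h2
        by_contra hh
        push Not at hh
        exact h2.2 (h1 t' h2.1 hh)
      · intro h1 t' h2 h3
        by_contra hh
        have := h1 t' ⟨h2, hh⟩
        linarith
    rw [this]
    exact isClosed_biInter fun _ _ => isClosed_Iic
  have hfc : ContinuousOn f (Icc 0 L) := by
    have hmem : ∀ t ∈ Icc 0 L, c + (R + κ * t) • e1 N ∈ closure Ω ∧
        c - (R + κ * t) • e1 N ∈ closure Ω := by
      intro t ht
      rcases ht.2.eq_or_lt with hh | hh
      · rw [hh]
        exact ⟨frontier_subset_closure g.frL, subset_closure g.inL⟩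
      · have hn := norm_pt g.hN c (g.rt_pos ht.1 ht.2).le
        exact ⟨g.mem_cl_t ht.1 hh hn.1, g.mem_cl_t ht.1 hh hn.2⟩
    refine ContinuousOn.sub ?_ ?_
    · exact h.cont.comp (f := fun t => c + (R + κ * t) • e1 N) (by fun_prop) fun t ht => (hmem t ht).1
    · exact h.cont.comp (f := fun t => c - (R + κ * t) • e1 N) (by fun_prop) fun t ht => (hmem t ht).2
  have hf0 : f 0 = 0 := by
    have hn := norm_pt g.hN c g.R0.le
    simp only [hff, mul_zero, add_zero]
    rw [h.zer _ (g.fr _ hn.1), h.zer _ (g.fr _ hn.2), sub_self]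
  have hft : ∀ t ∈ s, 0 ≤ t → t ≤ L → f t = 0 := by
    intro t hts ht0 htL
    rcases ht0.eq_or_lt with hh | hh
    · rw [← hh, hf0]
    · have : EqOn f (fun _ => 0) (Icc 0 t) := by
        refine EqOn.of_subset_closure (s := Ico 0 t) (fun t' ht' => hts t' ht'.1 ht'.2)
          (hfc.mono (Icc_subset_Icc_right htL)) continuousOn_const Ico_subset_Icc_self ?_
        rw [closure_Ico hh.ne]
      exact this ⟨ht0, le_rfl⟩
  by_contra hcon
  push Not at hcon
  have hall : Icc 0 L ⊆ s := by
    refine IsClosed.Icc_subset_of_forall_exists_gt (hsc.inter isClosed_Icc)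
      (fun t' h1 h2 => absurd h1 (not_le.2 h2)) ?_
    rintro t ⟨hts, ht0, htL⟩ y hy
    have hty : t < y := hy
    have ht00 := hft t hts ht0 htL.le
    have hrad : ∀ x y : EE N, ‖y - c‖ = ‖x - c‖ → 0 ≤ κ * (‖x - c‖ - R) →
        κ * (‖x - c‖ - R) ≤ t → u y = u x := by
      intro x y hxy h0 h1
      set τ := κ * (‖x - c‖ - R) with hτ
      have e0 : f τ = 0 := by
        rcases h1.eq_or_lt with hh | hh
        · rw [hh, ht00]
        · exact hts τ h0 hh
      have e1' := sub_eq_zero.1 e0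
      have hxn : ‖x - c‖ = R + κ * τ := (g.t_kap _).symm
      rw [g.radial h h0 (by linarith) e1' (hxy.trans hxn), g.radial h h0 (by linarith) e1' hxn]
    have hgr : ∀ (e : EE N) (x : EE N), ‖x - c‖ = R + κ * t →
        Tl e (gradient u (sig c e x)) = gradient u x := by
      intro e x hx
      rcases ht0.eq_or_lt with hh | hh
      · refine g.bdgrad h hf e ?_
        rw [hx, ← hh, mul_zero, add_zero]
      · exact g.radgrad h hh htL (fun x y h1 h2 h3 => hrad x y h1 h2.le h3.le) e hx
    have hx0 := (norm_pt g.hN c (g.rt_pos ht0 htL.le).le).1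
    have hne : gradient u (c + (R + κ * t) • e1 N) ≠ 0 := by
      rcases ht0.eq_or_lt with hh | hh
      · rw [← hh, mul_zero, add_zero]
        exact g.hopf h hf
      · intro h0
        obtain ⟨x, hx, hxne⟩ := hcon t hh htL
        apply hxne
        set v := x - c with hv
        set w := c + (R + κ * t) • e1 N - c with hw
        have hvw : ‖v‖ = ‖w‖ := by rw [hx, hx0]
        have hsig : sig c (v - w) x = c + (R + κ * t) • e1 N := by
          have h1 : sig c (v - w) x - c = w := by
            rw [sig_sub]; exact Submodule.reflection_sub hvw
          rw [hw] at h1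
          exact sub_left_inj.1 h1
        rw [← hgr (v - w) x hx, hsig, h0, map_zero]
    obtain ⟨r, hr, hrL, hv⟩ := g.step h ht0 htL (fun x hx => hrad x (sig c (e1 N) x)
      (norm_sig_sub _ _ _) (by rw [hx, g.kap_t]; exact ht0) (by rw [hx, g.kap_t]))
      (hgr (e1 N)) hne
    refine ⟨t + min (r / 2) (y - t), ?_, ?_, ?_⟩
    · intro t' ht'0 ht'
      rcases lt_trichotomy t' t with hh | hh | hh
      · exact hts t' ht'0 hh
      · rw [hh, ht00]
      · have hδ : t' - t < r := by
          have := min_le_left (r / 2) (y - t)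
          linarith
        have h1 := g.pt_Ep (t := t) (δ := t' - t) (ρ := r) ht0 htL.le (by linarith) hδ (by linarith)
        have h2 := hv _ h1
        rw [add_sub_cancel] at h2
        have h3 : sig c (e1 N) (c + (R + κ * t') • e1 N) = c - (R + κ * t') • e1 N := by
          rw [sig_apply (norm_e1 g.hN), add_sub_cancel_left, real_inner_smul_left,
            real_inner_self_eq_norm_sq, norm_e1 g.hN]
          module
        rw [h3] at h2
        simp only [hff]; linarith
    · have : 0 < min (r / 2) (y - t) := lt_min (by linarith) (by linarith)
      linarith
    · have := min_le_right (r / 2) (y - t)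
      linarith
  have hL := hft L (hall ⟨g.L0.le, le_rfl⟩) g.L0.le le_rfl
  simp only [hff] at hL
  rw [h.zer _ g.frL] at hL
  have := h.pos _ g.inL
  linarith

lemma Geo.lam_pos (g : Geo Ω c κ R L) (h : USol p lam Ω u)
    (hf : ‖gradient u (c - R • e1 N)‖ ≤ ‖gradient u (c + R • e1 N)‖) : 0 < lam := by
  refine lt_of_le_of_ne h.lam0 fun h0 => ?_
  have hp := h.hp
  have he := h.energy
  rw [← h0, zero_mul] at he
  have hc : ContinuousOn (fun x => ‖gradient u x‖ ^ p) (closure Ω) :=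
    h.cgrad.norm.rpow_const fun x _ => Or.inr (by linarith)
  have hz : ∀ x ∈ Ω, ‖gradient u x‖ ^ p = 0 := by
    have hi : IntegrableOn (fun x => ‖gradient u x‖ ^ p) Ω :=
      (hc.integrableOn_compact h.cpt).mono_set subset_closure
    have h1 := (setIntegral_eq_zero_iff_of_nonneg_ae (ae_of_all _ fun x => by
      show 0 ≤ ‖gradient u x‖ ^ p
      positivity) hi).1 he
    have h2 := Measure.eqOn_open_of_ae_eq h1 h.opn (hc.mono subset_closure) continuousOn_const
    exact fun x hx => h2 hx
  have h3 : EqOn (fun x => ‖gradient u x‖ ^ p) (fun _ => 0) (closure Ω) :=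
    EqOn.of_subset_closure (s := Ω) hz hc continuousOn_const subset_closure le_rfl
  have h4 := h3 (g.mem_cl (norm_pt g.hN c g.R0.le).1)
  have h5 : ‖gradient u (c + R • e1 N)‖ = 0 :=
    (Real.rpow_eq_zero (norm_nonneg _) (by linarith)).1 h4
  exact g.hopf h hf (norm_eq_zero.1 h5)

end crit


lemma final_contra {N : ℕ} {p lam : ℝ} {Ω : Set (EE N)} {u : EE N → ℝ} (h : USol p lam Ω u)
    (hlam : 0 < lam) {c₁ c₂ : EE N} {κ a b : ℝ} (hκ : κ = 1 ∨ κ = -1) (ha : 0 < a) (hb : 0 < b)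
    (hsub : ∀ x : EE N, 0 ≤ κ * (‖x - c₁‖ ^ 2 - a ^ 2) → 0 ≤ -κ * (‖x - c₂‖ ^ 2 - b ^ 2) → x ∈ Ω)
    (g1 : ∀ x : EE N, ‖x - c₁‖ = a → gradient u x = 0)
    (g2 : ∀ x : EE N, ‖x - c₂‖ = b → gradient u x = 0)
    {x1 : EE N} (hx1 : 0 < κ * (‖x1 - c₁‖ ^ 2 - a ^ 2)) (hx2 : 0 < -κ * (‖x1 - c₂‖ ^ 2 - b ^ 2)) :
    False := by
  have hp := h.hp
  have hκ' : -κ = 1 ∨ -κ = -1 := by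
    rcases hκ with h | h
    · right; rw [h]
    · left; rw [h]; norm_num
  set K : Set (EE N) := {x | 0 ≤ κ * (‖x - c₁‖ ^ 2 - a ^ 2) ∧ 0 ≤ -κ * (‖x - c₂‖ ^ 2 - b ^ 2)}
    with hK
  have hKΩ : K ⊆ Ω := fun x hx => hsub x hx.1 hx.2
  have hKcl : IsClosed K := by
    have hf1 : Continuous (fun x : EE N => κ * (‖x - c₁‖ ^ 2 - a ^ 2)) := by fun_prop
    have hf2 : Continuous (fun x : EE N => -κ * (‖x - c₂‖ ^ 2 - b ^ 2)) := by fun_prop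
    exact (isClosed_le continuous_const hf1).inter (isClosed_le continuous_const hf2)
  have hKc : IsCompact K := h.cpt.of_isClosed_subset hKcl (hKΩ.trans subset_closure)
  have cA : ContinuousOn (fun x => Afl p (gradient u x)) K :=
    (continuous_Afl hp).comp_continuousOn (h.cgrad.mono (hKΩ.trans subset_closure))
  have cu : ContinuousOn u K := h.contDiffOn.continuousOn.mono hKΩ
  set h1 : EE N → ℝ := fun x => ⟪Afl p (gradient u x), x - c₁⟫ with hh1
  set h2 : EE N → ℝ := fun x => ⟪Afl p (gradient u x), x - c₂⟫ with hh2
  have c1 : ContinuousOn h1 K := cA.inner (by fun_prop)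
  have c2 : ContinuousOn h2 K := cA.inner (by fun_prop)
  have l1 := shell_tendsto c₁ hκ ha hKc c1 fun x _ hx => by
    simp only [hh1, g1 x hx, Afl_zero, inner_zero_left]
  have l2 := shell_tendsto c₂ hκ' hb hKc c2 fun x _ hx => by
    simp only [hh2, g2 x hx, Afl_zero, inner_zero_left]
  set φ : ℕ → EE N → ℝ := fun k x => etaK c₁ κ a k x * etaK c₂ (-κ) b k x with hφ
  have hφC : ∀ k, ContDiff ℝ 1 (φ k) := fun k => (etaK_C1 c₁ κ a k).mul (etaK_C1 c₂ (-κ) b k)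
  have hφ0 : ∀ k x, x ∉ K → φ k x = 0 := by
    intro k x hx
    by_contra hne
    have hk : (0 : ℝ) ≤ k := Nat.cast_nonneg k
    exact hx ⟨(etaK_ne hk (left_ne_zero_of_mul hne)).le, (etaK_ne hk (right_ne_zero_of_mul hne)).le⟩
  have hφnn : ∀ k x, 0 ≤ φ k x := fun k x => mul_nonneg (Sc_facts _).1 (Sc_facts _).1
  have hI : ∀ k, Integrable (fun x => lam * u x ^ (p - 1) * φ k x) := by
    intro k
    refine integrable_supp hKc ((continuousOn_const.mul (cu.rpow_const fun x _ =>
      Or.inr (by linarith))).mul (hφC k).continuous.continuousOn) fun x hx => ?_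
    rw [hφ0 k x hx, mul_zero]
  have key : ∀ k : ℕ, ∫ x, lam * u x ^ (p - 1) * φ k x ≤
      2 * (∫ x in K, thK c₁ κ a k x * |h1 x|) + 2 * (∫ x in K, thK c₂ (-κ) b k x * |h2 x|) := by
    intro k
    have hk0 : (0 : ℝ) ≤ k := Nat.cast_nonneg k
    obtain ⟨t1, t2, t3⟩ := test_C1 h.opn hKc hKΩ (hφC k).contDiffOn (hφ0 k)
    rw [← h.weak (φ k) t1 t2 (t3.trans hKΩ)]
    have hoff : ∀ x, x ∉ K → gradient (φ k) x = 0 := fun x hx =>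
      gradient_eq_zero_off fun hh => hx (t3 hh)
    have j1 : IntegrableOn (fun x => thK c₁ κ a k x * |h1 x|) K :=
      ContinuousOn.integrableOn_compact hKc ((thK_cont c₁ κ a k).continuousOn.mul c1.abs)
    have j2 : IntegrableOn (fun x => thK c₂ (-κ) b k x * |h2 x|) K :=
      ContinuousOn.integrableOn_compact hKc ((thK_cont c₂ (-κ) b k).continuousOn.mul c2.abs)
    have j3 : IntegrableOn (fun x => ⟪Afl p (gradient u x), gradient (φ k) x⟫) K :=
      ContinuousOn.integrableOn_compact hKc (cA.inner (gradient_continuous t1).continuousOn)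
    rw [← setIntegral_test (Ω := K) (fun x hx => by rw [hoff x hx, inner_zero_right]),
      ← integral_const_mul, ← integral_const_mul, ← integral_add (j1.const_mul 2) (j2.const_mul 2)]
    refine setIntegral_mono_on j3 ((j1.const_mul 2).add (j2.const_mul 2)) hKc.measurableSet
      fun x _ => ?_
    have gφ := (hg_mul (etaK_grad c₁ κ a k x) (etaK_grad c₂ (-κ) b k x)).gradient
    have hval : ⟪Afl p (gradient u x), gradient (φ k) x⟫ =
        2 * (thK c₂ (-κ) b k x * (etaK c₁ κ a k x * (-κ * h2 x))) +
        2 * (thK c₁ κ a k x * (etaK c₂ (-κ) b k x * (κ * h1 x))) := by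
      simp only [hφ]
      rw [gφ]
      simp only [inner_add_right, real_inner_smul_right, hh1, hh2, thK]
      ring
    rw [hval]
    have e1' : ∀ {η κ' s : ℝ}, 0 ≤ η → η ≤ 1 → (κ' = 1 ∨ κ' = -1) → η * (κ' * s) ≤ |s| := by
      intro η κ' s h0 h1 h2
      have a1 : κ' * s ≤ |s| := by rw [← kap_abs h2]; exact le_abs_self _
      have a2 := mul_le_mul_of_nonneg_left a1 h0
      have a3 := abs_nonneg s
      nlinarith
    have b1 := mul_le_mul_of_nonneg_left
      (e1' (s := h1 x) (Sc_facts _).1 (Sc_facts _).2.1 hκ : etaK c₂ (-κ) b k x * _ ≤ _)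
      (thK_nonneg c₁ κ a hk0 x)
    have b2 := mul_le_mul_of_nonneg_left
      (e1' (s := h2 x) (Sc_facts _).1 (Sc_facts _).2.1 hκ' : etaK c₁ κ a k x * _ ≤ _)
      (thK_nonneg c₂ (-κ) b hk0 x)
    linarith
  have hlim : Tendsto (fun k : ℕ => 2 * (∫ x in K, thK c₁ κ a k x * |h1 x|) +
      2 * (∫ x in K, thK c₂ (-κ) b k x * |h2 x|)) atTop (𝓝 0) := by
    have := (l1.const_mul 2).add (l2.const_mul 2)
    simpa using this
  obtain ⟨m1, hm1⟩ := exists_nat_ge (2 / (κ * (‖x1 - c₁‖ ^ 2 - a ^ 2)))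
  obtain ⟨m2, hm2⟩ := exists_nat_ge (2 / (-κ * (‖x1 - c₂‖ ^ 2 - b ^ 2)))
  set k₀ := max m1 m2 with hk₀
  have hφ1 : φ k₀ x1 = 1 := by
    have e1' : (m1 : ℝ) ≤ k₀ := Nat.cast_le.2 (le_max_left _ _)
    have e2' : (m2 : ℝ) ≤ k₀ := Nat.cast_le.2 (le_max_right _ _)
    have a1 : etaK c₁ κ a k₀ x1 = 1 := (Sc_one (by
      rw [div_le_iff₀ hx1] at hm1
      exact hm1.trans (mul_le_mul_of_nonneg_right e1' hx1.le))).1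
    have a2 : etaK c₂ (-κ) b k₀ x1 = 1 := (Sc_one (by
      rw [div_le_iff₀ hx2] at hm2
      exact hm2.trans (mul_le_mul_of_nonneg_right e2' hx2.le))).1
    simp only [hφ, a1, a2, mul_one]
  have hnn : ∀ k x, 0 ≤ lam * u x ^ (p - 1) * φ k x := by
    intro k x
    by_cases hx : x ∈ K
    · have := h.pos x (hKΩ hx)
      have h3 := hφnn k x
      positivity
    · rw [hφ0 k x hx, mul_zero]
  have hpos : 0 < ∫ x, lam * u x ^ (p - 1) * φ k₀ x := by
    rw [integral_pos_iff_support_of_nonneg (hnn k₀) (hI k₀)]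
    have hO : IsOpen {x | φ k₀ x ≠ 0} := isOpen_ne_fun (hφC k₀).continuous continuous_const
    refine (hO.measure_pos volume ⟨x1, show φ k₀ x1 ≠ 0 by rw [hφ1]; norm_num⟩).trans_le
      (measure_mono fun x hx => ?_)
    have hx' : φ k₀ x ≠ 0 := hx
    have hxK : x ∈ K := by
      by_contra hh
      exact hx' (hφ0 k₀ x hh)
    have := h.pos x (hKΩ hxK)
    rw [Function.mem_support]
    exact mul_ne_zero (by positivity) hx'
  have hle : ∫ x, lam * u x ^ (p - 1) * φ k₀ x ≤ 0 := by
    refine ge_of_tendsto hlim (eventually_atTop.2 ⟨k₀, fun k hk => (integral_mono (hI k₀) (hI k)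
      fun x => ?_).trans (key k)⟩)
    show lam * u x ^ (p - 1) * φ k₀ x ≤ lam * u x ^ (p - 1) * φ k x
    by_cases hx : x ∈ K
    · have := h.pos x (hKΩ hx)
      have hk0 : (0 : ℝ) ≤ k₀ := Nat.cast_nonneg k₀
      have hkk : (k₀ : ℝ) ≤ k := Nat.cast_le.2 hk
      have a1 := etaK_mono c₁ (κ := κ) (R := a) hk0 hkk x
      have a2 := etaK_mono c₂ (κ := -κ) (R := b) hk0 hkk x
      have a3 : φ k₀ x ≤ φ k x := mul_le_mul a1 a2 (Sc_facts _).1 (Sc_facts _).1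
      gcongr
    · rw [hφ0 k x hx, hφ0 k₀ x hx]
  linarith

lemma main_false {N : ℕ} (hN : 2 ≤ N) {R₀ R₁ s p : ℝ} (hR₀ : 0 < R₀) (hs : 0 < s)
    (hs' : s < R₁ - R₀) (hp : 1 < p) {u : EE N → ℝ}
    (hu : IsFirstEigenfunction p (Om N R₀ R₁ s) (lam1 p (Om N R₀ R₁ s)) u)
    (hd : HasDerivAt (fun t : ℝ => lam1 p (Om N R₀ R₁ t)) 0 s) : False := by
  have h := USol_of hp (Om_open N R₀ R₁ s) (isCompact_closure_Om N R₀ R₁ s) hu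
  have gi := geo_inner (N := N) hN hR₀ hs hs'
  have go := geo_outer (N := N) hN hR₀ hs hs'
  have fi := bflat gi h (H_inner hN hR₀ hs hs' h hd)
  have fo := bflat go h (H_outer hN hR₀ hs hs' h hd)
  obtain ⟨ta, ha0, haL, hga⟩ := gi.crit h fi
  obtain ⟨tb, hb0, hbL, hgb⟩ := go.crit h fo
  have hlam := gi.lam_pos h fi
  have he := norm_e1 hN
  set a := R₀ + 1 * ta with ha
  set b := R₁ + -1 * tb with hb
  have hap : 0 < a := by linarith
  have hbp : 0 < b := by linarith
  rcases le_or_gt a b with hab | hab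
  · refine final_contra h hlam (κ := 1) (Or.inl rfl) hap hbp ?_ hga hgb
      (x1 := (-((a - s + b) / 2)) • e1 N) ?_ ?_
    · intro x h1 h2
      have h1' := (kap_nonneg_sq (norm_nonneg _) hap).1 h1
      have h2' := (kap_nonneg_sq (norm_nonneg _) hbp).1 h2
      rw [sub_zero] at h2'
      rw [mem_Om hR₀]
      constructor <;> linarith
    · refine (kap_pos_sq (norm_nonneg _) hap).2 ?_
      rw [← sub_smul, norm_smul, he, mul_one, Real.norm_eq_abs, abs_of_neg (by linarith)]
      linarith
    · refine (kap_pos_sq (norm_nonneg _) hbp).2 ?_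
      rw [sub_zero, norm_smul, he, mul_one, Real.norm_eq_abs, abs_of_neg (by linarith)]
      linarith
  · refine final_contra h hlam (κ := -1) (Or.inr rfl) hap hbp ?_ hga hgb
      (x1 := ((a + s + b) / 2) • e1 N) ?_ ?_
    · intro x h1 h2
      have h1' := (kap_nonneg_sq (norm_nonneg _) hap).1 h1
      have h2' := (kap_nonneg_sq (norm_nonneg _) hbp).1 h2
      rw [sub_zero] at h2'
      have hsn : ‖s • e1 N‖ = s := by rw [norm_smul, he, mul_one, Real.norm_of_nonneg hs.le]
      have t1 := norm_sub_norm_le x (s • e1 N)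
      rw [hsn] at t1
      rw [mem_Om hR₀]
      constructor <;> linarith
    · refine (kap_pos_sq (norm_nonneg _) hap).2 ?_
      rw [← sub_smul, norm_smul, he, mul_one, Real.norm_eq_abs, abs_of_pos (by linarith)]
      linarith
    · refine (kap_pos_sq (norm_nonneg _) hbp).2 ?_
      rw [sub_zero, norm_smul, he, mul_one, Real.norm_eq_abs, abs_of_pos (by linarith)]
      linarith


theorem stmt15 (N : ℕ) (hN : 2 ≤ N) (R₀ R₁ : ℝ) (hR₀ : 0 < R₀) (hR : R₀ < R₁)
    (p : ℝ) (hp : 1 < p) (s : ℝ) (hs : 0 < s) (hs' : s < R₁ - R₀)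
    (u : EuclideanSpace ℝ (Fin N) → ℝ)
    (hu : IsFirstEigenfunction p (Om N R₀ R₁ s) (lam1 p (Om N R₀ R₁ s)) u)
    (hd : HasDerivAt (fun t : ℝ => lam1 p (Om N R₀ R₁ t)) 0 s) :
    sInf ((fun x : EuclideanSpace ℝ (Fin N) => ‖x - s • e1 N‖) ''
        {x ∈ Om N R₀ R₁ s | ⟪gradient u x, x - s • e1 N⟫ = 0}) =
      sSup ((fun x : EuclideanSpace ℝ (Fin N) => ‖x‖) ''
        {x ∈ Om N R₀ R₁ s | ⟪gradient u x, x⟫ = 0}) := by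
  exact (main_false hN hR₀ hs hs' hp hu hd).elim
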